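/- arXiv:1406.0042 — 4 statements merged into one kernel-verified Lean document; each statement's English description precedes it below -/
import Mathlib

section
/- Let 0 ≤ a < b ≤ ∞, let I = (a,b) or I = [a,b), and let f : I → ℝ. Then each of the following assertions implies the next: (1) f[A] ∈ P_n for all A ∈ P_n(I) and all n ≥ 1; (2) there exist reals c_m ≥ 0 (m ≥ 0) such that the power series Σ_{m≥0} c_m x^m converges for all |x| < b and f(x) = Σ_{m≥0} c_m x^m for all x ∈ I; (3) f is absolutely monotonic on I. If moreover I = [0,b), then (3) implies (2), so all three assertions are equivalent. -/
open Matrix Set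

/-- A function is absolutely monotonic on an interval `I` if it is continuous on `I`,
infinitely differentiable on the interior of `I`, and all its derivatives are
nonnegative on the interior of `I`. -/
def AbsolutelyMonotonicOn (f : ℝ → ℝ) (I : Set ℝ) : Prop :=
  ContinuousOn f I ∧ ContDiffOn ℝ (⊤ : ℕ∞) f (interior I) ∧
    ∀ (k : ℕ), ∀ x ∈ interior I, 0 ≤ iteratedDerivWithin k f (interior I) x


/-! ### Moment functionals -/

lemma psHS {ι : Type*} {f g : ι → ℝ} {a b : ℝ} (h : HasSum f a) (h1 : ∀ i, g i = f i) (h2 : b = a) :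
    HasSum g b := by
  subst h2
  rwa [show g = f from funext h1]

lemma psSM {ι : Type*} {f g : ι → ℝ} (h : Summable f) (h1 : ∀ i, g i = f i) : Summable g := by
  rwa [show g = f from funext h1]


open Polynomial in
noncomputable def psMom (m : ℕ → ℝ) : ℝ[X] →ₗ[ℝ] ℝ := (Polynomial.basisMonomials ℝ).constr ℝ m

open Polynomial in
lemma psMom_X_pow (m : ℕ → ℝ) (n : ℕ) : psMom m (X ^ n) = m n := by
  have := (Polynomial.basisMonomials ℝ).constr_basis ℝ m n
  simpa [psMom, Polynomial.X_pow_eq_monomial] using this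

open Polynomial in
lemma psMom_eq_sum (m : ℕ → ℝ) (p : ℝ[X]) :
    psMom m p = ∑ i ∈ p.support, p.coeff i * m i := by
  conv_lhs => rw [p.as_sum_support_C_mul_X_pow]
  rw [map_sum]
  refine Finset.sum_congr rfl fun i _ => ?_
  rw [← Polynomial.smul_eq_C_mul, map_smul, psMom_X_pow, smul_eq_mul]

open Polynomial in
lemma psMom_mul_X_pow (m : ℕ → ℝ) (p : ℝ[X]) (n : ℕ) :
    psMom m (p * X ^ n) = ∑ i ∈ p.support, p.coeff i * m (i + n) := by
  conv_lhs => rw [p.as_sum_support_C_mul_X_pow]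
  rw [Finset.sum_mul, map_sum]
  refine Finset.sum_congr rfl fun i _ => ?_
  rw [mul_assoc, ← pow_add, ← Polynomial.smul_eq_C_mul, map_smul, psMom_X_pow, smul_eq_mul]

open Polynomial in
/-- falling factorial polynomials -/
noncomputable def psQ : ℕ → ℝ[X]
  | 0 => 1
  | k + 1 => psQ k * (X - C (k : ℝ))

open Polynomial in
lemma psQ_eval_nat (k i : ℕ) : (psQ k).eval (i : ℝ) = (i.descFactorial k : ℝ) := by
  induction k with
  | zero => simp [psQ]
  | succ k ih =>
    simp only [psQ, eval_mul, ih, eval_sub, eval_X, eval_C, Nat.descFactorial_succ]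
    rcases le_or_gt k i with h | h
    · push_cast [Nat.cast_sub h]; ring
    · have : i.descFactorial k = 0 := Nat.descFactorial_eq_zero_iff_lt.2 h
      simp [this]

open Polynomial in
lemma psX_pow_eq (n : ℕ) : (X ^ n : ℝ[X]) =
    ∑ k ∈ Finset.range (n + 1), (Nat.stirlingSecond n k : ℝ) • psQ k := by
  induction n with
  | zero => simp [psQ]
  | succ n ih =>
    rw [pow_succ, ih, Finset.sum_mul, Finset.sum_range_succ' _ (n+1)]
    have h1 : ∀ k, psQ k * X = psQ (k+1) + (k : ℝ) • psQ k := by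
      intro k; simp only [psQ, Polynomial.smul_eq_C_mul]; ring
    have h2 : ∀ k, (((n+1).stirlingSecond (k+1) : ℕ) : ℝ) =
        (k+1) * (n.stirlingSecond (k+1) : ℝ) + n.stirlingSecond k := by
      intro k; rw [Nat.stirlingSecond_succ_succ]; push_cast; ring
    simp only [h2, add_smul, Finset.sum_add_distrib, smul_mul_assoc, h1, smul_add]
    rw [Finset.sum_range_succ' (fun x => (n.stirlingSecond x : ℝ) • (x : ℝ) • psQ x),
      Finset.sum_range_succ (fun x => (((x:ℝ)+1) * (n.stirlingSecond (x+1) : ℝ)) • psQ (x+1))]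
    simp [Nat.stirlingSecond_eq_zero_of_lt, smul_smul, mul_comm, add_comm]

lemma psStir_eval (n i : ℕ) : (i : ℝ) ^ n =
    ∑ k ∈ Finset.range (n + 1), (Nat.stirlingSecond n k : ℝ) * (i.descFactorial k : ℝ) := by
  have := congrArg (Polynomial.eval (i : ℝ)) (psX_pow_eq n)
  simpa [Polynomial.eval_finsetSum, psQ_eval_nat] using this

lemma psStir_eval' (n i : ℕ) : (i : ℝ) ^ n =
    ∑ k ∈ Finset.range (i + 1), (Nat.stirlingSecond n k : ℝ) * (i.descFactorial k : ℝ) := by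
  rw [psStir_eval]
  have key : ∀ N, n ≤ N → i ≤ N → ∀ j, (j = n ∨ j = i) → 
     ∑ k ∈ Finset.range (j + 1), (Nat.stirlingSecond n k : ℝ) * (i.descFactorial k : ℝ) = 
     ∑ k ∈ Finset.range (N + 1), (Nat.stirlingSecond n k : ℝ) * (i.descFactorial k : ℝ) := by
    intro N h1 h2 j hj
    refine Finset.sum_subset (by intro x; simp; omega) ?_
    intro x _ hx
    simp at hx
    rcases hj with rfl | rfl
    · rw [Nat.stirlingSecond_eq_zero_of_lt (by omega)]; simp
    · rw [Nat.descFactorial_eq_zero_iff_lt.2 (by omega)]; simp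
  rw [key (max n i) (le_max_left _ _) (le_max_right _ _) n (Or.inl rfl),
    key (max n i) (le_max_left _ _) (le_max_right _ _) i (Or.inr rfl)]

lemma psStir_egf (h : ℝ) (k : ℕ) :
    HasSum (fun n : ℕ => (Nat.stirlingSecond n k : ℝ) * h ^ n / n.factorial)
      ((Real.exp h - 1) ^ k / k.factorial) := by
  have hexp : ∀ i : ℕ, HasSum (fun n : ℕ => (i:ℝ)^n * h ^ n / n.factorial) (Real.exp h ^ i) := by
    intro i
    have := NormedSpace.expSeries_div_hasSum_exp (𝔸 := ℝ) ((i:ℝ) * h)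
    rw [← Real.exp_eq_exp_ℝ, Real.exp_nat_mul] at this
    simpa [mul_pow] using this
  induction k using Nat.strong_induction_on with
  | _ i ih =>
    have h1 := hexp i
    have h2 : HasSum (fun n : ℕ => ∑ k ∈ Finset.range i,
        ((Nat.stirlingSecond n k : ℝ) * h ^ n / n.factorial) * (i.descFactorial k : ℝ))
        (∑ k ∈ Finset.range i, ((Real.exp h - 1) ^ k / k.factorial) * (i.descFactorial k : ℝ)) := by
      apply hasSum_sum
      intro k hk
      exact (ih k (Finset.mem_range.1 hk)).mul_right _
    have h3 := (h1.sub h2).div_const (i.factorial : ℝ)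
    have hf : (i.factorial : ℝ) ≠ 0 := by positivity
    refine psHS h3 ?_ ?_
    · intro n
      rw [psStir_eval', Finset.sum_range_succ, Nat.descFactorial_self]
      have : ∑ k ∈ Finset.range i,
        ((Nat.stirlingSecond n k : ℝ) * h ^ n / n.factorial) * (i.descFactorial k : ℝ) =
        (∑ k ∈ Finset.range i, (Nat.stirlingSecond n k : ℝ) * (i.descFactorial k : ℝ)) * h ^ n / n.factorial := by
        rw [Finset.sum_mul, Finset.sum_div]
        exact Finset.sum_congr rfl fun k _ => by ring
      rw [this]
      field_simp
      ring
    · have h4 : Real.exp h ^ i = ∑ k ∈ Finset.range (i+1),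
          ((Real.exp h - 1) ^ k / k.factorial) * (i.descFactorial k : ℝ) := by
        conv_lhs => rw [show Real.exp h = (Real.exp h - 1) + 1 by ring, add_pow]
        refine Finset.sum_congr rfl fun k _ => ?_
        rw [Nat.descFactorial_eq_factorial_mul_choose]
        have : (k.factorial : ℝ) ≠ 0 := by positivity
        push_cast
        field_simp
        simp
      rw [h4, Finset.sum_range_succ, Nat.descFactorial_self]
      field_simp
      ring

/-- positivity property of moment sequences -/
def psP (m : ℕ → ℝ) : Prop := ∀ (p : Polynomial ℝ) (k : ℕ), 0 ≤ psMom m (p ^ 2 * psQ k)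

lemma psP.q_nonneg {m : ℕ → ℝ} (hm : psP m) (k : ℕ) : 0 ≤ psMom m (psQ k) := by
  simpa using hm 1 k

lemma psMom_m_eq (m : ℕ → ℝ) (n : ℕ) : m n =
    ∑ k ∈ Finset.range (n + 1), (Nat.stirlingSecond n k : ℝ) * psMom m (psQ k) := by
  rw [← psMom_X_pow m n, psX_pow_eq, map_sum]
  simp

lemma psP.nonneg {m : ℕ → ℝ} (hm : psP m) (n : ℕ) : 0 ≤ m n := by
  rw [psMom_m_eq m n]
  exact Finset.sum_nonneg fun k _ => mul_nonneg (by positivity) (hm.q_nonneg k)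

lemma psP.reexpand {m : ℕ → ℝ} (hm : psP m) {h G : ℝ} (hh : 0 ≤ h)
    (hs : HasSum (fun n : ℕ => m n * h ^ n / n.factorial) G) :
    HasSum (fun k : ℕ => psMom m (psQ k) / k.factorial * (Real.exp h - 1) ^ k) G := by
  set a : ℕ × ℕ → ℝ := fun p =>
    (Nat.stirlingSecond p.1 p.2 : ℝ) * psMom m (psQ p.2) * h ^ p.1 / p.1.factorial with ha
  have ha0 : ∀ p, 0 ≤ a p := fun p => by
    have := hm.q_nonneg p.2
    simp only [ha]; positivity
  have hrow : ∀ n, HasSum (fun k => a (n, k)) (m n * h ^ n / n.factorial) := by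
    intro n
    rw [psMom_m_eq m n, Finset.sum_mul, Finset.sum_div]
    apply hasSum_sum_of_ne_finset_zero
    intro k hk
    simp only [ha]
    rw [Nat.stirlingSecond_eq_zero_of_lt (by simpa using hk)]
    simp
  have hsum : Summable a := by
    rw [summable_prod_of_nonneg ha0]
    refine ⟨fun n => (hrow n).summable, ?_⟩
    simp only [fun n => (hrow n).tsum_eq]
    exact hs.summable
  have htot : HasSum a G := by
    have := hsum.hasSum.prod_fiberwise hrow
    rw [hs.unique this]; exact hsum.hasSum
  have hsw : HasSum (fun p : ℕ × ℕ => a p.swap) G := (Equiv.prodComm ℕ ℕ).hasSum_iff.2 htot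
  refine hsw.prod_fiberwise fun k => ?_
  have := (psStir_egf h k).mul_left (psMom m (psQ k))
  refine psHS this ?_ ?_
  · intro n; simp only [ha, Prod.swap]; ring
  · ring

/-! ### Double sums -/

lemma psDS_hasSum {a : ℕ → ℝ} {u v G : ℝ}
    (hs : HasSum (fun p : ℕ × ℕ => a (p.1 + p.2) * u ^ p.1 * v ^ p.2 /
      (p.1.factorial * p.2.factorial)) G) :
    HasSum (fun n : ℕ => a n * (u + v) ^ n / n.factorial) G := by
  have h1 := (Finset.HasAntidiagonal.sigmaAntidiagonalEquivProd (A := ℕ)).hasSum_iff.2 hs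
  refine h1.sigma fun n => ?_
  have h2 : a n * (u + v) ^ n / n.factorial =
    ∑ p ∈ Finset.HasAntidiagonal.antidiagonal n, a (p.1 + p.2) * u ^ p.1 * v ^ p.2 /
      (p.1.factorial * p.2.factorial) := by
    rw [(Commute.all u v).add_pow', Finset.mul_sum, Finset.sum_div]
    refine Finset.sum_congr rfl fun p hp => ?_
    rw [Finset.HasAntidiagonal.mem_antidiagonal] at hp
    subst hp
    rw [nsmul_eq_mul, Nat.cast_add_choose]
    have h1 : ((p.1+p.2).factorial : ℝ) ≠ 0 := by positivity
    field_simp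
  rw [h2, ← Finset.sum_coe_sort]
  exact hasSum_fintype _

lemma psDS_summable {a : ℕ → ℝ} {u v : ℝ} (ha : ∀ n, 0 ≤ a n) (hu : 0 ≤ u) (hv : 0 ≤ v)
    (hs : Summable (fun n : ℕ => a n * (u + v) ^ n / n.factorial)) :
    Summable (fun p : ℕ × ℕ => a (p.1 + p.2) * u ^ p.1 * v ^ p.2 /
      (p.1.factorial * p.2.factorial)) := by
  rw [← (Finset.HasAntidiagonal.sigmaAntidiagonalEquivProd (A := ℕ)).summable_iff]
  rw [summable_sigma_of_nonneg]
  · refine ⟨fun n => (hasSum_fintype _).summable, ?_⟩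
    refine psSM hs fun n => ?_
    have h2 : a n * (u + v) ^ n / n.factorial =
    ∑ p ∈ Finset.HasAntidiagonal.antidiagonal n, a (p.1 + p.2) * u ^ p.1 * v ^ p.2 /
      (p.1.factorial * p.2.factorial) := by
      rw [(Commute.all u v).add_pow', Finset.mul_sum, Finset.sum_div]
      refine Finset.sum_congr rfl fun p hp => ?_
      rw [Finset.HasAntidiagonal.mem_antidiagonal] at hp
      subst hp
      rw [nsmul_eq_mul, Nat.cast_add_choose]
      have h1 : ((p.1+p.2).factorial : ℝ) ≠ 0 := by positivity
      field_simp
    rw [h2, ← Finset.sum_coe_sort, tsum_fintype]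
    rfl
  · intro x
    have := ha (x.2.1.1 + x.2.1.2)
    simp only [Function.comp, Finset.HasAntidiagonal.sigmaAntidiagonalEquivProd_apply]
    positivity

lemma psDS_summable_abs {a : ℕ → ℝ} {u v : ℝ} (ha : ∀ n, 0 ≤ a n)
    (hs : Summable (fun n : ℕ => a n * (|u| + |v|) ^ n / n.factorial)) :
    Summable (fun p : ℕ × ℕ => a (p.1 + p.2) * u ^ p.1 * v ^ p.2 /
      (p.1.factorial * p.2.factorial)) := by
  refine Summable.of_norm_bounded (psDS_summable ha (abs_nonneg u) (abs_nonneg v) hs) ?_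
  intro p
  simp [abs_of_nonneg (ha _)]

lemma psSummable_shift {m : ℕ → ℝ} {R : ℝ} (hm : ∀ n, 0 ≤ m n)
    (hs : ∀ h, 0 ≤ h → h < R → Summable (fun n : ℕ => m n * h ^ n / n.factorial))
    (i : ℕ) (h : ℝ) (h0 : 0 ≤ h) (hR : h < R) :
    Summable (fun n : ℕ => m (i + n) * h ^ n / n.factorial) := by
  have h1 := psDS_summable hm (u := (R - h)/2) (v := h) (by linarith) h0 (hs _ (by linarith) (by linarith))
  have h2 := (h1.prod_factor i).mul_left (((R-h)/2)^i / i.factorial)⁻¹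
  refine psSM h2 fun n => ?_
  have : ((R-h)/2)^i ≠ 0 := pow_ne_zero _ (by linarith)
  have : (i.factorial : ℝ) ≠ 0 := by positivity
  field_simp

/-- shifted moment sequence -/
noncomputable def psShift (m : ℕ → ℝ) (h : ℝ) (i : ℕ) : ℝ :=
  ∑' n : ℕ, m (i + n) * (-h) ^ n / n.factorial

lemma psShift_hasSum {m : ℕ → ℝ} {R h : ℝ} (hm : ∀ n, 0 ≤ m n)
    (hs : ∀ h, 0 ≤ h → h < R → Summable (fun n : ℕ => m n * h ^ n / n.factorial))
    (h0 : 0 ≤ h) (hR : h < R) (i : ℕ) :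
    HasSum (fun n : ℕ => m (i + n) * (-h) ^ n / n.factorial) (psShift m h i) := by
  have : Summable (fun n : ℕ => m (i + n) * (-h) ^ n / n.factorial) := by
    refine Summable.of_norm_bounded (psSummable_shift hm hs i h h0 hR) fun n => ?_
    simp [abs_of_nonneg (hm _), abs_of_nonneg h0]
  exact this.hasSum

lemma psShift_P {m : ℕ → ℝ} {R h : ℝ} (hP : psP m)
    (hs : ∀ h, 0 ≤ h → h < R → Summable (fun n : ℕ => m n * h ^ n / n.factorial))
    (h0 : 0 ≤ h) (hR : h < R) : psP (psShift m h) := by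
  intro p k
  have hm := hP.nonneg
  set Q := p ^ 2 * psQ k with hQ
  -- double sum for each coefficient
  have hd : ∀ i, HasSum (fun q : ℕ × ℕ => m (i + (q.1 + q.2)) * (-(h/2)) ^ q.1 * (-(h/2)) ^ q.2 /
      (q.1.factorial * q.2.factorial)) (psShift m h i) := by
    intro i
    have h1 : Summable (fun q : ℕ × ℕ => m (i + (q.1 + q.2)) * (-(h/2)) ^ q.1 * (-(h/2)) ^ q.2 /
      (q.1.factorial * q.2.factorial)) := by
      refine psDS_summable_abs (a := fun n => m (i + n)) (fun n => hm _) ?_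
      have : |(-(h/2))| + |(-(h/2))| = h := by
        rw [abs_neg, abs_of_nonneg (by linarith)]; ring
      rw [this]
      exact psSummable_shift hm hs i h h0 hR
    have h2 := psDS_hasSum (a := fun n => m (i + n)) h1.hasSum
    rw [show -(h/2) + -(h/2) = -h by ring] at h2
    rw [(psShift_hasSum hm hs h0 hR i).unique h2]
    exact h1.hasSum
  have htot : HasSum (fun q : ℕ × ℕ => psMom m (Q * Polynomial.X ^ (q.1 + q.2)) *
      (-(h/2)) ^ q.1 * (-(h/2)) ^ q.2 / (q.1.factorial * q.2.factorial)) (psMom (psShift m h) Q) := by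
    rw [psMom_eq_sum]
    have := hasSum_sum (f := fun i (q : ℕ × ℕ) => Q.coeff i * (m (i + (q.1 + q.2)) * (-(h/2)) ^ q.1 *
      (-(h/2)) ^ q.2 / (q.1.factorial * q.2.factorial))) (s := Q.support)
      (fun i _ => (hd i).mul_left (Q.coeff i))
    refine psHS this (fun q => ?_) rfl
    rw [psMom_mul_X_pow, Finset.sum_mul, Finset.sum_mul, Finset.sum_div]
    exact Finset.sum_congr rfl fun i _ => by ring
  have htend : Filter.Tendsto (fun N : ℕ => Finset.range N ×ˢ Finset.range N)
      Filter.atTop Filter.atTop := by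
    apply Filter.tendsto_atTop_finset_of_monotone
    · intro a b hab
      exact Finset.product_subset_product (Finset.range_mono hab) (Finset.range_mono hab)
    · rintro ⟨x, y⟩
      exact ⟨max x y + 1, by simp⟩
  have hlim := Filter.Tendsto.comp htot htend
  refine ge_of_tendsto' hlim fun N => ?_
  have h3 := hP (p * ∑ n ∈ Finset.range N, Polynomial.C ((-(h/2)) ^ n / n.factorial) * Polynomial.X ^ n) k
  refine h3.trans_eq ?_
  have h4 : (p * ∑ n ∈ Finset.range N, Polynomial.C ((-(h/2)) ^ n / n.factorial) * Polynomial.X ^ n) ^ 2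
      * psQ k = ∑ q ∈ Finset.range N ×ˢ Finset.range N,
        (((-(h/2)) ^ q.1 / q.1.factorial) * ((-(h/2)) ^ q.2 / q.2.factorial)) •
          (Q * Polynomial.X ^ (q.1 + q.2)) := by
    rw [mul_pow, mul_right_comm, ← hQ, sq, Finset.sum_mul_sum, ← Finset.sum_product', Finset.mul_sum]
    refine Finset.sum_congr rfl fun q _ => ?_
    rw [Polynomial.smul_eq_C_mul, Polynomial.C_mul, pow_add]
    ring
  rw [h4, map_sum]
  refine Finset.sum_congr rfl fun q _ => ?_
  rw [map_smul, smul_eq_mul]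
  ring

lemma psShift_expand {m : ℕ → ℝ} {R h v G : ℝ} (hP : psP m)
    (hs : ∀ h, 0 ≤ h → h < R → Summable (fun n : ℕ => m n * h ^ n / n.factorial))
    (h0 : 0 ≤ h) (hR : 2 * h < R) (hv : 0 ≤ v)
    (hG : HasSum (fun n : ℕ => m n * v ^ n / n.factorial) G) :
    HasSum (fun n : ℕ => psShift m h n * (h + v) ^ n / n.factorial) G := by
  have hm := hP.nonneg
  have hm' := (psShift_P hP hs h0 (by linarith)).nonneg
  -- shifting back
  have hback : ∀ i, HasSum (fun n : ℕ => psShift m h (n + i) * h ^ n / n.factorial) (m i) := by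
    intro i
    have h1 : Summable (fun q : ℕ × ℕ => m (i + (q.1 + q.2)) * h ^ q.1 * (-h) ^ q.2 /
      (q.1.factorial * q.2.factorial)) := by
      refine psDS_summable_abs (a := fun n => m (i + n)) (fun n => hm _) ?_
      have : |h| + |(-h)| = 2 * h := by
        rw [abs_neg, abs_of_nonneg (by linarith)]; ring
      rw [this]
      exact psSummable_shift hm hs i (2*h) (by linarith) hR
    have h2 := psDS_hasSum (a := fun n => m (i + n)) h1.hasSum
    have h3 : HasSum (fun n : ℕ => m (i + n) * (h + -h) ^ n / n.factorial) (m i) := by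
      have := hasSum_single (f := fun n : ℕ => m (i + n) * (h + -h) ^ n / n.factorial) 0
        (fun n hn => by simp [hn])
      simpa using this
    have h4 := h1.hasSum
    rw [h2.unique h3] at h4
    refine h4.prod_fiberwise fun n => ?_
    have h5 := (psShift_hasSum hm hs h0 (by linarith) (n + i)).mul_right (h ^ n / n.factorial)
    refine psHS h5 (fun l => ?_) (by ring)
    simp only
    rw [show i + (n + l) = n + i + l by ring]
    ring
  set b : ℕ × ℕ → ℝ := fun q => psShift m h (q.1 + q.2) * v ^ q.1 * h ^ q.2 /
      (q.1.factorial * q.2.factorial) with hb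
  have hb0 : ∀ q, 0 ≤ b q := fun q => by
    have := hm' (q.1 + q.2)
    simp only [hb]; positivity
  have hrow : ∀ n, HasSum (fun l => b (n, l)) (m n * v ^ n / n.factorial) := by
    intro n
    refine psHS ((hback n).mul_right (v ^ n / n.factorial)) (fun l => ?_) (by ring)
    simp only [hb]
    rw [add_comm n l]
    ring
  have hsum : Summable b := by
    rw [summable_prod_of_nonneg hb0]
    refine ⟨fun n => (hrow n).summable, ?_⟩
    simp only [fun n => (hrow n).tsum_eq]
    exact hG.summable
  have htot : HasSum b G := by
    have := hsum.hasSum.prod_fiberwise hrow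
    rw [hG.unique this]; exact hsum.hasSum
  have := psDS_hasSum htot
  rwa [add_comm v h] at this

lemma psIter {m : ℕ → ℝ} {R h : ℝ} {G : ℝ → ℝ} (hP : psP m) (h0 : 0 ≤ h) (hR : 2 * h < R)
    (hG : ∀ v, 0 ≤ v → v < R → HasSum (fun n : ℕ => m n * v ^ n / n.factorial) (G v)) (j : ℕ) :
    ∃ m' : ℕ → ℝ, psP m' ∧ ∀ v, 0 ≤ v → v < R →
      HasSum (fun n : ℕ => m' n * (j * h + v) ^ n / n.factorial) (G v) := by
  induction j with
  | zero => exact ⟨m, hP, by simpa using hG⟩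
  | succ j ih =>
    obtain ⟨m', hP', hG'⟩ := ih
    have hjh : 0 ≤ (j : ℝ) * h := by positivity
    have hs : ∀ u, 0 ≤ u → u < j * h + R → Summable (fun n : ℕ => m' n * u ^ n / n.factorial) := by
      intro u hu0 huR
      have h1 := (hG' (max 0 (u - j * h)) (le_max_left _ _) (by
        rw [max_lt_iff]; constructor <;> linarith)).summable
      refine Summable.of_nonneg_of_le (fun n => ?_) (fun n => ?_) h1
      · have := hP'.nonneg n; positivity
      · have := hP'.nonneg n
        have h2 : u ≤ j * h + max 0 (u - j * h) := by
          have := le_max_right 0 (u - j * h); linarith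
        gcongr
    refine ⟨psShift m' h, psShift_P hP' hs h0 (by linarith), fun v hv hvR => ?_⟩
    have := psShift_expand hP' hs h0 (by linarith) (by positivity) (hG' v hv hvR)
    refine psHS this (fun n => ?_) rfl
    push_cast
    ring_nf

/-- closure of power series with nonnegative coefficients under pointwise limits -/
lemma psClosure {c : ℕ → ℕ → ℝ} {F : ℕ → ℝ → ℝ} {f : ℝ → ℝ} {I : Set ℝ}
    (hc : ∀ j m, 0 ≤ c j m) (hI0 : ∀ x ∈ I, 0 < x) (hI : ∀ x ∈ I, ∃ y ∈ I, x < y)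
    (hF : ∀ x ∈ I, ∀ᶠ j in Filter.atTop, HasSum (fun m => c j m * x ^ m) (F j x))
    (hlim : ∀ x ∈ I, Filter.Tendsto (fun j => F j x) Filter.atTop (nhds (f x))) :
    ∃ d : ℕ → ℝ, (∀ m, 0 ≤ d m) ∧ ∀ x ∈ I, HasSum (fun m => d m * x ^ m) (f x) := by
  rcases I.eq_empty_or_nonempty with rfl | ⟨x0, hx0⟩
  · exact ⟨fun _ => 0, fun _ => le_rfl, by simp⟩
  have hbd : ∀ x ∈ I, ∀ᶠ j in Filter.atTop, ∀ m, c j m * x ^ m ≤ f x + 1 := by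
    intro x hx
    have h1 : ∀ᶠ j in Filter.atTop, F j x < f x + 1 :=
      (hlim x hx).eventually (gt_mem_nhds (by linarith))
    filter_upwards [h1, hF x hx] with j h1 h2 m
    have h3 := le_hasSum h2 m (fun i _ => mul_nonneg (hc j i) (pow_nonneg (hI0 x hx).le i))
    linarith
  set U : Ultrafilter ℕ := Filter.hyperfilter ℕ with hU
  have hUle : (U : Filter ℕ) ≤ Filter.atTop := Nat.hyperfilter_le_atTop
  have hex : ∀ m, ∃ d, 0 ≤ d ∧ Filter.Tendsto (fun j => c j m) U (nhds d) := by
    intro m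
    have hx0p := hI0 x0 hx0
    have hcomp : IsCompact (Set.Icc (0:ℝ) ((f x0 + 1) / x0 ^ m)) := isCompact_Icc
    have hmem : Set.Icc (0:ℝ) ((f x0 + 1) / x0 ^ m) ∈ (U.map (fun j => c j m)) := by
      rw [Ultrafilter.mem_map]
      apply hUle
      filter_upwards [hbd x0 hx0] with j hj
      refine ⟨hc j m, ?_⟩
      rw [le_div_iff₀ (by positivity)]
      exact hj m
    obtain ⟨d, hd, hle⟩ := hcomp.ultrafilter_le_nhds' _ hmem
    exact ⟨d, hd.1, hle⟩
  choose d hd0 hd using hex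
  refine ⟨d, hd0, fun x hx => ?_⟩
  obtain ⟨y, hy, hxy⟩ := hI x hx
  have hxp := hI0 x hx
  have hyp := hI0 y hy
  have hr0 : 0 ≤ x / y := by positivity
  have hr1 : x / y < 1 := (div_lt_one hyp).2 hxy
  have hbsum : Summable (fun m : ℕ => (f y + 1) * (x / y) ^ m) :=
    (summable_geometric_of_lt_one hr0 hr1).mul_left _
  have hdom : ∀ᶠ j in Filter.atTop, ∀ m, ‖c j m * x ^ m‖ ≤ (f y + 1) * (x / y) ^ m := by
    filter_upwards [hbd y hy] with j hj m
    rw [Real.norm_of_nonneg (mul_nonneg (hc j m) (by positivity))]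
    have : x ^ m = y ^ m * (x / y) ^ m := by rw [← mul_pow, mul_div_cancel₀ _ hyp.ne']
    rw [this, ← mul_assoc]
    exact mul_le_mul_of_nonneg_right (hj m) (by positivity)
  have ht := tendsto_tsum_of_dominated_convergence (𝓕 := (U : Filter ℕ))
    (f := fun j m => c j m * x ^ m) (g := fun m => d m * x ^ m) hbsum
    (fun m => (hd m).mul_const _) (hUle hdom)
  have ht2 : Filter.Tendsto (fun j => ∑' m, c j m * x ^ m) U (nhds (f x)) := by
    refine ((hlim x hx).mono_left hUle).congr' ?_
    apply hUle
    filter_upwards [hF x hx] with j hj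
    exact hj.tsum_eq.symm
  have hs : Summable (fun m => d m * x ^ m) := by
    refine Summable.of_norm_bounded hbsum fun m => ?_
    refine le_of_tendsto (((hd m).mul_const _).norm) ?_
    apply hUle
    filter_upwards [hdom] with j hj
    exact hj m
  rw [← tendsto_nhds_unique ht ht2]
  exact hs.hasSum

/-! ### Bernstein's theorem -/

noncomputable def psRem (D : ℕ → ℝ → ℝ) (s0 : ℝ) (n i : ℕ) (v : ℝ) : ℝ :=
  D i (s0 + v) - ∑ k ∈ Finset.range n, D (i + k) s0 * v ^ k / k.factorial

lemma psRem_deriv {D : ℕ → ℝ → ℝ} {s0 v : ℝ} (n i : ℕ)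
    (hD : HasDerivAt (D i) (D (i + 1) (s0 + v)) (s0 + v)) :
    HasDerivAt (psRem D s0 (n + 1) i) (psRem D s0 n (i + 1) v) v := by
  have h1 : HasDerivAt (fun v => D i (s0 + v)) (D (i + 1) (s0 + v)) v := by
    exact hD.comp_const_add s0 v
  have h2 : HasDerivAt (fun v : ℝ => ∑ k ∈ Finset.range (n + 1), D (i + k) s0 * v ^ k / k.factorial)
      (∑ k ∈ Finset.range n, D (i + 1 + k) s0 * v ^ k / k.factorial) v := by
    have h3 : HasDerivAt (fun v : ℝ => ∑ k ∈ Finset.range (n + 1), D (i + k) s0 * v ^ k / k.factorial)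
      (∑ k ∈ Finset.range (n + 1), D (i + k) s0 * (k * v ^ (k - 1)) / k.factorial) v := by
      apply HasDerivAt.fun_sum
      intro k _
      exact ((hasDerivAt_pow k v).const_mul _).div_const _
    rw [Finset.sum_range_succ'] at h3
    simp only [Nat.cast_zero, zero_mul, mul_zero, zero_div, add_zero] at h3
    refine h3.congr_deriv (Finset.sum_congr rfl fun k _ => ?_)
    rw [Nat.factorial_succ, show i + (k + 1) = i + 1 + k by ring]
    push_cast
    have h4 : (k.factorial : ℝ) ≠ 0 := by positivity
    have h5 : (k : ℝ) + 1 ≠ 0 := by positivity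
    field_simp
  exact h1.sub h2

lemma psRem_zero (D : ℕ → ℝ → ℝ) (s0 : ℝ) (n i : ℕ) : psRem D s0 (n + 1) i 0 = 0 := by
  simp [psRem, Finset.sum_range_succ']

lemma psNonneg_of_deriv {φ φ' : ℝ → ℝ} {r : ℝ} (h0 : 0 ≤ φ 0)
    (hd : ∀ v, 0 ≤ v → v ≤ r → HasDerivAt φ (φ' v) v) (hp : ∀ v, 0 ≤ v → v ≤ r → 0 ≤ φ' v) :
    ∀ v, 0 ≤ v → v ≤ r → 0 ≤ φ v := by
  intro v hv hvr
  have hmono : MonotoneOn φ (Set.Icc 0 r) := by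
    apply monotoneOn_of_deriv_nonneg (convex_Icc 0 r)
    · intro x hx; exact (hd x hx.1 hx.2).continuousAt.continuousWithinAt
    · intro x hx; rw [interior_Icc] at hx
      exact (hd x hx.1.le hx.2.le).differentiableAt.differentiableWithinAt
    · intro x hx; rw [interior_Icc] at hx
      rw [(hd x hx.1.le hx.2.le).deriv]; exact hp x hx.1.le hx.2.le
  exact h0.trans (hmono ⟨le_rfl, hv.trans hvr⟩ ⟨hv, hvr⟩ hv)

lemma psRem_nonneg {D : ℕ → ℝ → ℝ} {s0 r : ℝ}
    (hD : ∀ i v, 0 ≤ v → v ≤ r → HasDerivAt (D i) (D (i + 1) (s0 + v)) (s0 + v))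
    (hp : ∀ i v, 0 ≤ v → v ≤ r → 0 ≤ D i (s0 + v)) (n : ℕ) :
    ∀ i v, 0 ≤ v → v ≤ r → 0 ≤ psRem D s0 n i v := by
  induction n with
  | zero => intro i v h1 h2; simpa [psRem] using hp i v h1 h2
  | succ n ih =>
    intro i
    exact psNonneg_of_deriv (psRem_zero D s0 n i).ge
      (fun v h1 h2 => psRem_deriv n i (hD i v h1 h2)) (ih (i + 1))

lemma psRem_contract {D : ℕ → ℝ → ℝ} {s0 r c : ℝ} (hc0 : 0 ≤ c) (hc1 : c ≤ 1)
    (hD : ∀ i v, 0 ≤ v → v ≤ r → HasDerivAt (D i) (D (i + 1) (s0 + v)) (s0 + v))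
    (hp : ∀ i v, 0 ≤ v → v ≤ r → 0 ≤ D i (s0 + v)) (n : ℕ) :
    ∀ i v, 0 ≤ v → v ≤ r → 0 ≤ c ^ n * psRem D s0 n i v - psRem D s0 n i (c * v) := by
  have hcv : ∀ v, 0 ≤ v → v ≤ r → 0 ≤ c * v ∧ c * v ≤ r := fun v h1 h2 =>
    ⟨by positivity, (mul_le_of_le_one_left h1 hc1).trans h2⟩
  induction n with
  | zero =>
    intro i
    have h := psNonneg_of_deriv (r := r)
      (φ := fun v => c ^ 0 * psRem D s0 0 i v - psRem D s0 0 i (c * v))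
      (φ' := fun v => D (i+1) (s0 + v) - c * D (i+1) (s0 + c * v)) (by simp) ?_ ?_
    · exact h
    · intro v h1 h2
      simp only [psRem, Finset.range_zero, Finset.sum_empty, sub_zero, pow_zero, one_mul]
      refine HasDerivAt.sub ?_ ?_
      · exact (hD i v h1 h2).comp_const_add s0 v
      · have h3 := (hD i (c * v) (hcv v h1 h2).1 (hcv v h1 h2).2).comp_const_add s0 (c * v)
        have h4 := h3.comp v ((hasDerivAt_id v).const_mul c)
        refine h4.congr_deriv (by simp [mul_comm])
    · intro v h1 h2
      have hm : D (i+1) (s0 + c * v) ≤ D (i+1) (s0 + v) := by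
        have hmono : MonotoneOn (D (i+1)) (Set.Icc s0 (s0 + r)) := by
          have hd' : ∀ x ∈ Set.Icc s0 (s0 + r), HasDerivAt (D (i+1)) (D (i+1+1) x) x := by
            intro x hx
            have := hD (i+1) (x - s0) (by linarith [hx.1]) (by linarith [hx.2])
            rwa [add_sub_cancel] at this
          apply monotoneOn_of_deriv_nonneg (convex_Icc _ _)
          · intro x hx; exact (hd' x hx).continuousAt.continuousWithinAt
          · intro x hx
            exact (hd' x (interior_subset hx)).differentiableAt.differentiableWithinAt
          · intro x hx
            have hx := interior_subset hx
            rw [(hd' x hx).deriv]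
            have := hp (i+1+1) (x - s0) (by linarith [hx.1]) (by linarith [hx.2])
            rwa [add_sub_cancel] at this
        have := hcv v h1 h2
        have h5 : c * v ≤ v := mul_le_of_le_one_left h1 hc1
        exact hmono ⟨by linarith, by linarith⟩ ⟨by linarith, by linarith⟩ (by linarith)
      have := hp (i+1) v h1 h2
      have h6 := hp (i+1) (c * v) (hcv v h1 h2).1 (hcv v h1 h2).2
      nlinarith
  | succ n ih =>
    intro i
    refine psNonneg_of_deriv (r := r)
      (φ := fun v => c ^ (n+1) * psRem D s0 (n+1) i v - psRem D s0 (n+1) i (c * v))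
      (φ' := fun v => c * (c ^ n * psRem D s0 n (i+1) v - psRem D s0 n (i+1) (c * v)))
      (by simp [psRem_zero]) ?_ (fun v h1 h2 => mul_nonneg hc0 (ih (i+1) v h1 h2))
    intro v h1 h2
    have h3 := (psRem_deriv n i (hD i v h1 h2)).const_mul (c ^ (n+1))
    have h4 := (psRem_deriv n i (hD i (c * v) (hcv v h1 h2).1 (hcv v h1 h2).2)).comp v
      ((hasDerivAt_id v).const_mul c)
    exact (h3.sub h4).congr_deriv (by simp; ring)

lemma psBernstein {D : ℕ → ℝ → ℝ} {s0 r : ℝ}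
    (hD : ∀ i v, 0 ≤ v → v ≤ r → HasDerivAt (D i) (D (i + 1) (s0 + v)) (s0 + v))
    (hp : ∀ i v, 0 ≤ v → v ≤ r → 0 ≤ D i (s0 + v)) (v : ℝ) (hv0 : 0 ≤ v) (hvr : v < r) :
    HasSum (fun n : ℕ => D n s0 * v ^ n / n.factorial) (D 0 (s0 + v)) := by
  have hr : 0 < r := by linarith
  rw [hasSum_iff_tendsto_nat_of_nonneg]
  · have h1 : ∀ n, psRem D s0 n 0 v ≤ (v / r) ^ n * D 0 (s0 + r) := by
      intro n
      have h2 := psRem_contract (c := v / r) (by positivity) ((div_lt_one hr).2 hvr).le hD hp n 0 r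
        hr.le le_rfl
      rw [div_mul_cancel₀ _ hr.ne'] at h2
      have h3 : psRem D s0 n 0 r ≤ D 0 (s0 + r) := by
        simp only [psRem, sub_le_self_iff]
        refine Finset.sum_nonneg fun k _ => ?_
        have := hp (0 + k) 0 le_rfl hr.le
        rw [add_zero] at this
        positivity
      have := mul_le_mul_of_nonneg_left h3 (by positivity : 0 ≤ (v / r) ^ n)
      linarith
    have h4 : Filter.Tendsto (fun n => psRem D s0 n 0 v) Filter.atTop (nhds 0) := by
      refine squeeze_zero (fun n => psRem_nonneg hD hp n 0 v hv0 hvr.le) h1 ?_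
      have := (tendsto_pow_atTop_nhds_zero_of_lt_one (by positivity : 0 ≤ v / r)
        ((div_lt_one hr).2 hvr)).mul_const (D 0 (s0 + r))
      simpa using this
    have h5 := (tendsto_const_nhds (x := D 0 (s0 + v))).sub h4
    simpa [psRem] using h5
  · intro n
    have := hp n 0 le_rfl hr.le
    rw [add_zero] at this
    positivity

/-! ### From matrices to moment positivity -/

/-- entrywise preservers in quadratic form version -/
def psPres (F : ℝ → ℝ) (S : Set ℝ) : Prop :=
  ∀ (ι : Type) [Fintype ι] (A : Matrix ι ι ℝ), A.PosSemidef → (∀ i j, A i j ∈ S) →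
    ∀ y : ι → ℝ, 0 ≤ ∑ i, ∑ j, y i * y j * F (A i j)

lemma psNonneg_lead {D : ℕ → ℝ → ℝ} {r : ℝ} (hr : 0 < r) (k : ℕ)
    (hD : ∀ i v, 0 ≤ v → v ≤ r → HasDerivAt (D i) (D (i + 1) v) v)
    (h0 : ∀ i, i < k → D i 0 = 0) (hp : ∀ v, 0 ≤ v → v ≤ r → 0 ≤ D 0 v) : 0 ≤ D k 0 := by
  by_contra hneg
  push Not at hneg
  set η := - D k 0 / 2 with hη
  have hηp : 0 < η := by rw [hη]; linarith
  have hcont : ContinuousAt (D k) 0 := (hD k 0 le_rfl hr.le).continuousAt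
  have hev : ∀ᶠ v in nhds (0:ℝ), D k v < -η := hcont.eventually (gt_mem_nhds (by rw [hη]; linarith))
  obtain ⟨ρ, hρ, hball⟩ := Metric.eventually_nhds_iff.1 hev
  set r' := min r (ρ/2) with hr'
  have hr'p : 0 < r' := lt_min hr (by linarith)
  have hk : ∀ v, 0 ≤ v → v ≤ r' → D k v < -η := by
    intro v h1 h2
    apply hball
    rw [Real.dist_eq, sub_zero, abs_of_nonneg h1]
    have := min_le_right r (ρ/2)
    linarith
  have key : ∀ n, n ≤ k → ∀ v, 0 ≤ v → v ≤ r' → 0 ≤ - D (k - n) v - η * v ^ n / n.factorial := by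
    intro n
    induction n with
    | zero => intro _ v h1 h2; simpa using by linarith [hk v h1 h2]
    | succ n ih =>
      intro hn
      refine psNonneg_of_deriv (φ' := fun v => - D (k - n) v - η * v ^ n / n.factorial) ?_ ?_
        (ih (by omega))
      · simp [h0 (k - (n+1)) (by omega)]
      · intro v h1 h2
        have h3 := hD (k - (n+1)) v h1 (h2.trans (min_le_left _ _))
        rw [show k - (n+1) + 1 = k - n by omega] at h3
        have h4 := ((hasDerivAt_pow (n+1) v).const_mul η).div_const ((n+1).factorial : ℝ)
        refine (h3.neg.sub h4).congr_deriv ?_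
        rw [Nat.factorial_succ]
        push_cast
        have h4 : (n.factorial : ℝ) ≠ 0 := by positivity
        have h5 : (n : ℝ) + 1 ≠ 0 := by positivity
        field_simp
  have h1 := key k le_rfl r' hr'p.le le_rfl
  have h2 := hp r' hr'p.le (min_le_left _ _)
  rw [Nat.sub_self] at h1
  have : 0 < η * r' ^ k / k.factorial := by positivity
  linarith

lemma psBinomMoment (k n : ℕ) (hn : n ≤ k) :
    ∑ l : Fin (k + 1), ((-1 : ℝ) ^ (k - (l : ℕ)) * (k.choose l : ℝ)) * ((l : ℕ) : ℝ) ^ n =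
      if n = k then (k.factorial : ℝ) else 0 := by
  have h1 : ∀ f : ℝ → ℝ, (fwdDiff (1:ℝ))^[k] f 0 =
      ∑ l : Fin (k + 1), ((-1 : ℝ) ^ (k - (l : ℕ)) * (k.choose l : ℝ)) * f ((l : ℕ) : ℝ) := by
    intro f
    rw [fwdDiff_iter_eq_sum_shift, Finset.sum_range]
    simp
  rw [← h1 (fun x => x ^ n)]
  split_ifs with h
  · subst h
    rw [fwdDiff_iter_eq_factorial]; simp
  · rw [fwdDiff_iter_pow_eq_zero_of_lt (by omega)]; rfl

lemma psPres_deriv {F : ℕ → ℝ → ℝ} {u v : ℝ} (hu : 0 ≤ u)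
    (hF : ∀ n, ∀ x, 0 < x → HasDerivAt (F n) (F (n + 1) x) x)
    (hP : psPres (F 0) (Ioo u v)) (k : ℕ) (x : ℝ) (hx : x ∈ Ioo u v) : 0 ≤ F k x := by
  set z : Fin (k + 1) → ℝ := fun l => (-1 : ℝ) ^ (k - (l : ℕ)) * (k.choose l : ℝ) with hz
  set Φ : ℕ → ℝ → ℝ := fun n δ => ∑ l : Fin (k+1), ∑ l' : Fin (k+1), z l * z l' *
    (((l : ℕ) : ℝ) * ((l' : ℕ) : ℝ)) ^ n * F n (x + δ * (((l : ℕ) : ℝ) * ((l' : ℕ) : ℝ))) with hΦ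
  have hx0 : 0 < x := lt_of_le_of_lt hu hx.1
  have hΦ0 : ∀ n, Φ n 0 = F n x * (∑ l : Fin (k+1), z l * ((l : ℕ) : ℝ) ^ n) ^ 2 := by
    intro n
    simp only [hΦ, zero_mul, add_zero]
    rw [sq, Finset.sum_mul_sum, Finset.mul_sum]
    refine Finset.sum_congr rfl fun l _ => ?_
    rw [Finset.mul_sum]
    refine Finset.sum_congr rfl fun l' _ => ?_
    rw [mul_pow]; ring
  have hder : ∀ n δ, 0 ≤ δ → HasDerivAt (Φ n) (Φ (n+1) δ) δ := by
    intro n δ hδ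
    simp only [hΦ]
    refine HasDerivAt.fun_sum fun l _ => HasDerivAt.fun_sum fun l' _ => ?_
    have h1 : HasDerivAt (fun δ : ℝ => x + δ * (((l : ℕ) : ℝ) * ((l' : ℕ) : ℝ)))
        (((l : ℕ) : ℝ) * ((l' : ℕ) : ℝ)) δ := by
      simpa using ((hasDerivAt_id δ).mul_const (((l : ℕ) : ℝ) * ((l' : ℕ) : ℝ))).const_add x
    have h2 := ((hF n _ (by positivity : 0 < x + δ * (((l : ℕ) : ℝ) * ((l' : ℕ) : ℝ)))).comp δ h1).const_mul
      (z l * z l' * (((l : ℕ) : ℝ) * ((l' : ℕ) : ℝ)) ^ n)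
    exact h2.congr_deriv (by ring)
  set r : ℝ := (v - x) / (2 * ((k:ℝ) * k + 1)) with hr
  have hden : 0 < 2 * ((k:ℝ) * k + 1) := by positivity
  have hrp : 0 < r := div_pos (by linarith [hx.2]) hden
  have hpos : ∀ δ, 0 ≤ δ → δ ≤ r → 0 ≤ Φ 0 δ := by
    intro δ h1 h2
    have hA : (Matrix.of fun l l' : Fin (k+1) => x + δ * (((l : ℕ) : ℝ) * ((l' : ℕ) : ℝ))).PosSemidef := by
      have e : (Matrix.of fun l l' : Fin (k+1) => x + δ * (((l : ℕ) : ℝ) * ((l' : ℕ) : ℝ))) =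
        x • Matrix.vecMulVec (fun _ => (1:ℝ)) (star fun _ => (1:ℝ)) +
          δ • Matrix.vecMulVec (fun l : Fin (k+1) => ((l : ℕ) : ℝ)) (star fun l : Fin (k+1) => ((l : ℕ) : ℝ)) := by
        ext l l'
        simp [Matrix.vecMulVec]
      rw [e]
      exact ((Matrix.posSemidef_vecMulVec_self_star _).smul hx0.le).add
        ((Matrix.posSemidef_vecMulVec_self_star _).smul h1)
    have := hP (Fin (k+1)) _ hA ?_ z
    · simpa [hΦ] using this
    · intro l l'
      have hl : ((l : ℕ) : ℝ) ≤ k := by exact_mod_cast Nat.lt_succ_iff.1 l.2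
      have hl' : ((l' : ℕ) : ℝ) ≤ k := by exact_mod_cast Nat.lt_succ_iff.1 l'.2
      have h3 : ((l : ℕ) : ℝ) * ((l' : ℕ) : ℝ) ≤ k * k := by gcongr
      have h4 : δ * (((l : ℕ) : ℝ) * ((l' : ℕ) : ℝ)) ≤ r * (k * k) := by gcongr
      have h5 : r * (2 * ((k:ℝ) * k + 1)) = v - x := div_mul_cancel₀ _ hden.ne'
      have h6 : 0 ≤ δ * (((l : ℕ) : ℝ) * ((l' : ℕ) : ℝ)) := by positivity
      have h7 : 0 ≤ r * (k * k) := by positivity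
      simp only [Matrix.of_apply]
      constructor
      · linarith [hx.1]
      · nlinarith
  have hfin := psNonneg_lead hrp k (fun i δ h1 _ => hder i δ h1) ?_ hpos
  · rw [hΦ0, psBinomMoment k k le_rfl, if_pos rfl] at hfin
    have : (0:ℝ) < (k.factorial : ℝ) ^ 2 := by positivity
    exact nonneg_of_mul_nonneg_left hfin this
  · intro i hi
    rw [hΦ0, psBinomMoment k i hi.le, if_neg hi.ne]; simp

/-- the moment functional of the derivatives of `g` at `s` -/
noncomputable def psJet (g : ℝ → ℝ) (p : Polynomial ℝ) (s : ℝ) : ℝ :=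
  psMom (fun i => iteratedDeriv i g s) p

lemma psJet_deriv {g : ℝ → ℝ} (hg : ContDiff ℝ (⊤ : ℕ∞) g) (p : Polynomial ℝ) (s : ℝ) :
    HasDerivAt (psJet g p) (psJet g (p * Polynomial.X) s) s := by
  have h1 : psJet g p = fun s => ∑ i ∈ p.support, p.coeff i * iteratedDeriv i g s := by
    ext s; exact psMom_eq_sum _ _
  have h2 : psJet g (p * Polynomial.X) s = ∑ i ∈ p.support, p.coeff i * iteratedDeriv (i + 1) g s := by
    have := psMom_mul_X_pow (fun i => iteratedDeriv i g s) p 1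
    rwa [pow_one] at this
  rw [h1, h2]
  refine HasDerivAt.fun_sum fun i _ => HasDerivAt.const_mul _ ?_
  rw [iteratedDeriv_succ]
  apply DifferentiableAt.hasDerivAt
  exact (hg.differentiable_iteratedDeriv i (by exact_mod_cast WithTop.coe_lt_top i)) s

lemma psJet_q_nonneg {g : ℝ → ℝ} (hg : ContDiff ℝ (⊤ : ℕ∞) g) {u v : ℝ} (hu : 0 ≤ u)
    (hP : psPres (fun x => g (Real.log x)) (Ioo u v)) (k : ℕ) (x : ℝ) (hx : x ∈ Ioo u v) :
    0 ≤ psJet g (psQ k) (Real.log x) := by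
  have hx0 : 0 < x := lt_of_le_of_lt hu hx.1
  have h := psPres_deriv (F := fun n x => (x ^ n)⁻¹ * psJet g (psQ n) (Real.log x)) hu ?_ ?_ k x hx
  · have : 0 < (x ^ k)⁻¹ := by positivity
    exact nonneg_of_mul_nonneg_right h this
  · intro n y hy
    have h1 := (psJet_deriv hg (psQ n) (Real.log y)).comp y (Real.hasDerivAt_log hy.ne')
    have h2 := (hasDerivAt_pow n y).inv (by positivity)
    refine (h2.mul h1).congr_deriv ?_
    have h3 : psJet g (psQ (n+1)) (Real.log y) = psJet g (psQ n * Polynomial.X) (Real.log y) -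
        n * psJet g (psQ n) (Real.log y) := by
      simp only [psJet, psQ]
      rw [mul_sub, map_sub, mul_comm (psQ n) (Polynomial.C _), ← Polynomial.smul_eq_C_mul, map_smul,
        smul_eq_mul]
    rw [h3]
    simp only [Function.comp, Pi.inv_apply]
    rcases n with _ | n
    · simp [mul_comm]
    · simp only [Nat.add_sub_cancel]
      field_simp
      ring
  · have e : (fun x => (x ^ 0)⁻¹ * psJet g (psQ 0) (Real.log x)) = fun x => g (Real.log x) := by
      ext y
      have : psMom (fun i => iteratedDeriv i g (Real.log y)) (1 : Polynomial ℝ) = g (Real.log y) := by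
        have := psMom_X_pow (fun i => iteratedDeriv i g (Real.log y)) 0
        simpa using this
      simp [psJet, psQ, this]
    rw [e]; exact hP

lemma psDiff_mean {D : ℕ → ℝ → ℝ} (hD : ∀ i s, HasDerivAt (D i) (D (i + 1) s) s) {ε : ℝ}
    (hε : 0 < ε) (n : ℕ) : ∀ i s, ∃ ξ ∈ Icc s (s + n * ε),
      psMom (fun j => D i (s + ε * j)) ((Polynomial.X - 1) ^ n) = ε ^ n * D (i + n) ξ := by
  induction n with
  | zero =>
    intro i s
    refine ⟨s, by simp, ?_⟩
    have := psMom_X_pow (fun j : ℕ => D i (s + ε * j)) 0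
    simpa using this
  | succ n ih =>
    intro i s
    set H : ℝ → ℝ := fun t => psMom (fun j => D i (t + ε * j)) ((Polynomial.X - 1) ^ n) with hH
    have hder : ∀ t, HasDerivAt H (psMom (fun j => D (i+1) (t + ε * j)) ((Polynomial.X - 1) ^ n)) t := by
      intro t
      simp only [hH, psMom_eq_sum]
      refine HasDerivAt.fun_sum fun j _ => HasDerivAt.const_mul _ ?_
      exact (hD i _).comp_add_const t (ε * j)
    obtain ⟨t, ht, hslope⟩ := exists_hasDerivAt_eq_slope H _ (show s < s + ε by linarith)
      (fun t _ => (hder t).continuousAt.continuousWithinAt) (fun t _ => hder t)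
    obtain ⟨ξ, hξ, hξe⟩ := ih (i + 1) t
    refine ⟨ξ, ⟨by linarith [hξ.1, ht.1], ?_⟩, ?_⟩
    · push_cast; nlinarith [hξ.2, ht.2]
    · have h1 : psMom (fun j => D i (s + ε * j)) ((Polynomial.X - 1) ^ (n+1)) = H (s + ε) - H s := by
        rw [pow_succ, mul_sub, mul_one, map_sub]
        congr 1
        have := psMom_mul_X_pow (fun j : ℕ => D i (s + ε * j)) ((Polynomial.X - 1) ^ n) 1
        rw [pow_one] at this
        rw [this]
        simp only [hH, psMom_eq_sum]
        refine Finset.sum_congr rfl fun j _ => ?_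
        push_cast
        ring_nf
      rw [h1]
      rw [hξe, eq_div_iff (by linarith)] at hslope
      rw [← hslope, show i + (n + 1) = i + 1 + n by ring]
      ring

open Polynomial in
lemma psDiff_tendsto {D : ℕ → ℝ → ℝ} (hD : ∀ i s, HasDerivAt (D i) (D (i + 1) s) s) (s : ℝ)
    (q : ℝ[X]) : Filter.Tendsto
      (fun ε : ℝ => psMom (fun j => D 0 (s + ε * j)) (q.comp (C ε⁻¹ * (X - 1))))
      (nhdsWithin 0 (Ioi 0)) (nhds (psMom (fun j => D j s) q)) := by
  have hn : ∀ n : ℕ, Filter.Tendsto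
      (fun ε : ℝ => psMom (fun j => D 0 (s + ε * j)) ((C ε⁻¹ * (X - 1)) ^ n))
      (nhdsWithin 0 (Ioi 0)) (nhds (D n s)) := by
    intro n
    have hc : ContinuousAt (D n) s := (hD n s).continuousAt
    rw [Metric.tendsto_nhds]
    intro η hη
    obtain ⟨ρ, hρ, hball⟩ := Metric.continuousAt_iff.1 hc η hη
    have hev : ∀ᶠ ε : ℝ in nhdsWithin 0 (Ioi 0), ε ∈ Ioo 0 (ρ / (n + 1)) :=
      Ioo_mem_nhdsGT (by positivity)
    filter_upwards [hev] with ε hε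
    obtain ⟨ξ, hξ, he⟩ := psDiff_mean hD hε.1 n 0 s
    have : psMom (fun j => D 0 (s + ε * j)) ((C ε⁻¹ * (X - 1)) ^ n) = D n ξ := by
      rw [mul_pow, ← C_pow, ← smul_eq_C_mul, map_smul, he, zero_add, smul_eq_mul, ← mul_assoc,
        ← mul_pow, inv_mul_cancel₀ hε.1.ne', one_pow, one_mul]
    rw [this]
    apply hball
    rw [Real.dist_eq, abs_of_nonneg (by linarith [hξ.1])]
    have h1 := hε.2
    rw [lt_div_iff₀ (by positivity)] at h1
    nlinarith [hξ.2, hε.1]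
  have h := tendsto_finsetSum q.support (fun n _ => (hn n).const_mul (q.coeff n))
  rw [psMom_eq_sum]
  refine h.congr fun ε => ?_
  rw [comp_eq_sum_left, Polynomial.sum, map_sum]
  refine Finset.sum_congr rfl fun n _ => ?_
  rw [← smul_eq_C_mul (q.coeff n), map_smul, smul_eq_mul]

open Polynomial in
lemma psMom_sq (a : ℕ → ℝ) (r : ℝ[X]) (d : ℕ) (hd : r.natDegree ≤ d) :
    psMom a (r ^ 2) = ∑ i : Fin (d+1), ∑ i' : Fin (d+1), r.coeff i * r.coeff i' * a (i + i') := by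
  conv_lhs => rw [r.as_sum_range_C_mul_X_pow' (n := d + 1) (by omega)]
  rw [sq, Finset.sum_range, Finset.sum_mul_sum, map_sum]
  refine Finset.sum_congr rfl fun i _ => ?_
  rw [map_sum]
  refine Finset.sum_congr rfl fun i' _ => ?_
  rw [show (C (r.coeff i) * X ^ (i:ℕ) * (C (r.coeff i') * X ^ (i':ℕ)) : ℝ[X]) =
    (r.coeff i * r.coeff i') • X ^ ((i : ℕ) + i') by rw [smul_eq_C_mul, C_mul, pow_add]; ring]
  rw [map_smul, psMom_X_pow, smul_eq_mul]

lemma psPres_combo {g : ℝ → ℝ} {u v : ℝ} (hu : 0 ≤ u)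
    (hP : psPres (fun x => g (Real.log x)) (Ioo u v)) (d : ℕ) (c : Fin (d+1) → ℝ) {ε v' : ℝ}
    (hε : 0 ≤ ε) (hv' : v' * Real.exp (ε * (2 * d)) ≤ v) :
    psPres (fun x => ∑ i : Fin (d+1), ∑ i' : Fin (d+1), c i * c i' *
      g (Real.log x + ε * ((i : ℕ) + (i' : ℕ) : ℕ))) (Ioo u v') := by
  intro ι _ A hA hAe y
  set w : Fin (d+1) → ℝ := fun i => Real.exp (ε * (i : ℕ)) with hw
  have hB : (Matrix.kroneckerMap (· * ·) (Matrix.vecMulVec w (star w)) A).PosSemidef :=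
    (Matrix.posSemidef_vecMulVec_self_star w).kronecker hA
  have h := hP (Fin (d+1) × ι) _ hB ?_ (fun q => c q.1 * y q.2)
  · refine h.trans_eq ?_
    simp only [Fintype.sum_prod_type, Finset.mul_sum]
    have hentry : ∀ i i' j j', Real.log (Matrix.kroneckerMap (· * ·) (Matrix.vecMulVec w (star w)) A
        (i, j) (i', j')) = Real.log (A j j') + ε * (((i : ℕ) + (i' : ℕ) : ℕ) : ℝ) := by
      intro i i' j j'
      have hpos : 0 < A j j' := lt_of_le_of_lt hu (hAe j j').1
      simp only [Matrix.kroneckerMap_apply, Matrix.vecMulVec_apply, hw, star_trivial]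
      rw [← Real.exp_add, Real.log_mul (Real.exp_pos _).ne' hpos.ne', Real.log_exp]
      push_cast; ring
    simp only [hentry]
    rw [Finset.sum_comm]
    refine Finset.sum_congr rfl fun j _ => ?_
    conv_rhs => rw [Finset.sum_comm]
    refine Finset.sum_congr rfl fun i _ => ?_
    rw [Finset.sum_comm]
    refine Finset.sum_congr rfl fun j' _ => ?_
    refine Finset.sum_congr rfl fun i' _ => ?_
    ring
  · rintro ⟨i, j⟩ ⟨i', j'⟩
    have hpos : 0 < A j j' := lt_of_le_of_lt hu (hAe j j').1
    simp only [Matrix.kroneckerMap_apply, Matrix.vecMulVec_apply, hw, star_trivial]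
    rw [← Real.exp_add]
    have hi : ((i : ℕ) : ℝ) ≤ d := by exact_mod_cast Nat.lt_succ_iff.1 i.2
    have hi' : ((i' : ℕ) : ℝ) ≤ d := by exact_mod_cast Nat.lt_succ_iff.1 i'.2
    constructor
    · have h1 : 1 ≤ Real.exp (ε * (i : ℕ) + ε * (i' : ℕ)) := Real.one_le_exp (by positivity)
      have := (hAe j j').1
      nlinarith
    · have h1 : Real.exp (ε * (i : ℕ) + ε * (i' : ℕ)) ≤ Real.exp (ε * (2 * d)) := by
        apply Real.exp_le_exp.2; nlinarith
      have h2 := (hAe j j').2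
      calc _ ≤ Real.exp (ε * (2 * d)) * A j j' := by gcongr
        _ < Real.exp (ε * (2 * d)) * v' := by gcongr
        _ ≤ v := by linarith

lemma psJet_combo {g : ℝ → ℝ} (hg : ContDiff ℝ (⊤ : ℕ∞) g) (d : ℕ) (c : Fin (d+1) → Fin (d+1) → ℝ)
    (t : Fin (d+1) → Fin (d+1) → ℝ) (p : Polynomial ℝ) (s : ℝ) :
    psJet (fun s => ∑ i, ∑ i', c i i' * g (s + t i i')) p s =
      ∑ i, ∑ i', c i i' * psJet g p (s + t i i') := by
  have h1 : ∀ n, iteratedDeriv n (fun s => ∑ i, ∑ i', c i i' * g (s + t i i')) s =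
      ∑ i, ∑ i', c i i' * iteratedDeriv n g (s + t i i') := by
    intro n
    have hc : ∀ i i', ContDiffAt ℝ n (fun s => c i i' * g (s + t i i')) s := by
      intro i i'
      have : ContDiff ℝ (⊤ : ℕ∞) (fun s => c i i' * g (s + t i i')) :=
        contDiff_const.mul (hg.comp (contDiff_id.add contDiff_const))
      exact (this.of_le (by exact_mod_cast le_top)).contDiffAt
    rw [iteratedDeriv_fun_sum (fun i _ => ContDiffAt.sum fun i' _ => hc i i')]
    refine Finset.sum_congr rfl fun i _ => ?_
    rw [iteratedDeriv_fun_sum (fun i' _ => hc i i')]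
    refine Finset.sum_congr rfl fun i' _ => ?_
    rw [iteratedDeriv_const_mul_field, iteratedDeriv_comp_add_const]
  simp only [psJet, psMom_eq_sum, h1, Finset.mul_sum]
  rw [Finset.sum_comm]
  refine Finset.sum_congr rfl fun i _ => ?_
  rw [Finset.sum_comm]
  refine Finset.sum_congr rfl fun i' _ => ?_
  refine Finset.sum_congr rfl fun n _ => ?_
  ring

lemma psJet_P {g : ℝ → ℝ} (hg : ContDiff ℝ (⊤ : ℕ∞) g) {u v : ℝ} (hu : 0 ≤ u)
    (hP : psPres (fun x => g (Real.log x)) (Ioo u v)) (x : ℝ) (hx : x ∈ Ioo u v) :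
    psP (fun i => iteratedDeriv i g (Real.log x)) := by
  intro p k
  have hx0 : 0 < x := lt_of_le_of_lt hu hx.1
  set s := Real.log x with hs
  set D : ℕ → ℝ → ℝ := fun n => psJet g (psQ k * Polynomial.X ^ n) with hDdef
  have hD : ∀ i s, HasDerivAt (D i) (D (i + 1) s) s := by
    intro i s
    have := psJet_deriv hg (psQ k * Polynomial.X ^ i) s
    rwa [mul_assoc, ← pow_succ] at this
  have hlim := psDiff_tendsto hD s (p ^ 2)
  have hval : psMom (fun j => D j s) (p ^ 2) = psMom (fun i => iteratedDeriv i g s) (p ^ 2 * psQ k) := by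
    conv_rhs => rw [(p ^ 2).as_sum_support_C_mul_X_pow]
    rw [psMom_eq_sum, Finset.sum_mul, map_sum]
    refine Finset.sum_congr rfl fun i _ => ?_
    rw [mul_assoc, ← Polynomial.smul_eq_C_mul, map_smul, smul_eq_mul, mul_comm (Polynomial.X ^ i)]
    rfl
  rw [hval] at hlim
  refine ge_of_tendsto hlim ?_
  set d := p.natDegree with hd
  have hev : ∀ᶠ ε : ℝ in nhdsWithin 0 (Ioi 0), x * Real.exp (ε * (2 * d)) < v := by
    apply nhdsWithin_le_nhds
    have hc : ContinuousAt (fun ε : ℝ => x * Real.exp (ε * (2 * d))) 0 := by fun_prop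
    exact hc.eventually (gt_mem_nhds (by simpa using hx.2))
  filter_upwards [hev, self_mem_nhdsWithin] with ε hε hε0
  have hε0 : 0 < ε := hε0
  set v' := v * (Real.exp (ε * (2 * d)))⁻¹ with hv'
  have hxv : x < v' := by
    rw [hv', ← div_eq_mul_inv, lt_div_iff₀ (Real.exp_pos _)]; exact hε
  set r := p.comp (Polynomial.C ε⁻¹ * (Polynomial.X - 1)) with hr
  have hrdeg : r.natDegree ≤ d := by
    rw [hr, Polynomial.natDegree_comp]
    have h1 : (Polynomial.C ε⁻¹ * (Polynomial.X - 1) : Polynomial ℝ).natDegree ≤ 1 := by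
      refine Polynomial.natDegree_C_mul_le _ _ |>.trans ?_
      rw [← Polynomial.C_1]; exact (Polynomial.natDegree_X_sub_C _).le
    calc _ ≤ d * 1 := Nat.mul_le_mul_left _ h1
      _ = d := mul_one _
  rw [Polynomial.pow_comp, psMom_sq _ r d hrdeg]
  have h1 := psPres_combo hu hP d (fun i => r.coeff i) hε0.le (v' := v')
    (by rw [hv', mul_assoc, inv_mul_cancel₀ (Real.exp_pos _).ne', mul_one])
  have h2 := psJet_q_nonneg (g := fun s => ∑ i : Fin (d+1), ∑ i' : Fin (d+1), r.coeff i * r.coeff i' *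
      g (s + ε * ((i : ℕ) + (i' : ℕ) : ℕ))) ?_ hu h1 k x ⟨hx.1, hxv⟩
  · rw [psJet_combo hg d (fun i i' => r.coeff i * r.coeff i') (fun i i' => ε * ((i : ℕ) + (i' : ℕ) : ℕ))] at h2
    simpa [hDdef] using h2
  · refine ContDiff.sum fun i _ => ContDiff.sum fun i' _ => ?_
    exact contDiff_const.mul (hg.comp (contDiff_id.add contDiff_const))

/-! ### The smooth case -/

lemma psSmooth {g : ℝ → ℝ} (hg : ContDiff ℝ (⊤ : ℕ∞) g) {u v x0 : ℝ} (hu : 0 ≤ u)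
    (hP : psPres (fun x => g (Real.log x)) (Ioo u v)) (hx0 : u < x0) :
    ∃ d : ℕ → ℝ, (∀ m, 0 ≤ d m) ∧ ∀ x ∈ Ioo x0 v, HasSum (fun m => d m * x ^ m) (g (Real.log x)) := by
  rcases le_or_gt v x0 with hv | hv
  · exact ⟨fun _ => 0, fun _ => le_rfl, fun x hx => absurd (hx.1.trans hx.2) (not_lt.2 hv)⟩
  have hx0p : 0 < x0 := lt_of_le_of_lt hu hx0
  have hvp : 0 < v := hx0p.trans hv
  set s0 := Real.log x0 with hs0
  set R := Real.log v - s0 with hR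
  have hRp : 0 < R := sub_pos.2 (Real.log_lt_log hx0p hv)
  have hexp : ∀ w, 0 ≤ w → w < R → Real.exp (s0 + w) ∈ Ioo u v := by
    intro w hw hw'
    constructor
    · rw [Real.exp_add, hs0, Real.exp_log hx0p]
      have := Real.one_le_exp hw
      nlinarith
    · rw [← Real.lt_log_iff_exp_lt hvp]; linarith
  have hPs : ∀ w, 0 ≤ w → w < R → psP (fun i => iteratedDeriv i g (s0 + w)) := by
    intro w hw hw'
    have := psJet_P hg hu hP _ (hexp w hw hw')
    rwa [Real.log_exp] at this
  have hDer : ∀ i s, HasDerivAt (iteratedDeriv i g) (iteratedDeriv (i+1) g s) s := by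
    intro i s
    have hd : Differentiable ℝ (iteratedDeriv i g) :=
      hg.differentiable_iteratedDeriv i (by exact_mod_cast ENat.natCast_lt_top i)
    have := (hd s).hasDerivAt
    rwa [← iteratedDeriv_succ] at this
  have hG : ∀ w, 0 ≤ w → w < R →
      HasSum (fun n => iteratedDeriv n g s0 * w ^ n / n.factorial) (g (s0 + w)) := by
    intro w hw hw'
    obtain ⟨r, hr1, hr2⟩ := exists_between hw'
    have := psBernstein (D := fun i => iteratedDeriv i g) (s0 := s0) (r := r)
      (fun i t _ _ => hDer i _) (fun i t ht ht' => (hPs t ht (by linarith)).nonneg i) w hw hr1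
    simpa using this
  have hP0 : psP (fun i => iteratedDeriv i g s0) := by simpa using hPs 0 le_rfl hRp
  set h := R / 4 with hh
  have hhp : 0 < h := by positivity
  choose m' hm' hmG using fun j => psIter hP0 hhp.le (by linarith : 2 * h < R) hG j
  set X : ℕ → ℝ := fun j => Real.exp (s0 - j * h) with hX
  have hXp : ∀ j, 0 < X j := fun j => Real.exp_pos _
  have hXlim : Filter.Tendsto X Filter.atTop (nhds 0) := by
    apply Real.tendsto_exp_atBot.comp
    have : Filter.Tendsto (fun j : ℕ => (j : ℝ) * h) Filter.atTop Filter.atTop :=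
      tendsto_natCast_atTop_atTop.atTop_mul_const hhp
    simpa [sub_eq_add_neg] using Filter.tendsto_atBot_add_const_left _ s0
      (Filter.tendsto_neg_atTop_atBot.comp this)
  refine psClosure (c := fun j k => psMom (m' j) (psQ k) / k.factorial / (X j) ^ k)
    (F := fun j x => g (Real.log (x + X j))) ?_ (fun x hx => hx0p.trans hx.1) ?_ ?_ ?_
  · intro j k
    have := (hm' j).q_nonneg k
    have := hXp j
    positivity
  · intro x hx
    obtain ⟨y, hy1, hy2⟩ := exists_between hx.2
    exact ⟨y, ⟨hx.1.trans hy1, hy2⟩, hy1⟩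
  · intro x hx
    have hxp : 0 < x := hx0p.trans hx.1
    have hev : ∀ᶠ j in Filter.atTop, X j < v - x :=
      hXlim.eventually (gt_mem_nhds (sub_pos.2 hx.2))
    filter_upwards [hev] with j hj
    have hz : 0 < x + X j := add_pos hxp (hXp j)
    set w := Real.log (x + X j) - s0 with hw
    have hw0 : 0 ≤ w := by
      rw [hw, sub_nonneg, hs0]
      exact Real.log_le_log hx0p (by linarith [hx.1, hXp j])
    have hwR : w < R := by
      rw [hw, hR]
      have := Real.log_lt_log hz (by linarith : x + X j < v)
      linarith
    have h1 := (hm' j).reexpand (by positivity) (hmG j w hw0 hwR)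
    have h2 : Real.exp (j * h + w) - 1 = x / X j := by
      have : (j * h + w : ℝ) = Real.log (x + X j) - (s0 - j * h) := by rw [hw]; ring
      rw [this, Real.exp_sub, Real.exp_log hz]
      have := (hXp j).ne'
      change (x + X j) / X j - 1 = _
      field_simp
      ring
    rw [h2] at h1
    refine psHS h1 (fun k => ?_) ?_
    · rw [div_pow]; ring
    · rw [hw]; congr 1; ring
  · intro x hx
    have hxp : 0 < x := hx0p.trans hx.1
    have hc : ContinuousAt (fun y => g (Real.log y)) x :=
      hg.continuous.continuousAt.comp (Real.continuousAt_log hxp.ne')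
    have : Filter.Tendsto (fun j => x + X j) Filter.atTop (nhds x) := by
      simpa using hXlim.const_add x
    exact hc.tendsto.comp this

/-! ### Basic properties of preservers -/

lemma psPres.subset {f : ℝ → ℝ} {S T : Set ℝ} (h : psPres f T) (hST : S ⊆ T) : psPres f S :=
  fun ι _ A hA hAe y => h ι A hA (fun i j => hST (hAe i j)) y

lemma psPres_of {f : ℝ → ℝ} {I : Set ℝ}
    (h : ∀ n : ℕ, 1 ≤ n → ∀ A : Matrix (Fin n) (Fin n) ℝ, A.PosSemidef →
        (∀ i j, A i j ∈ I) → (A.map f).PosSemidef) : psPres f I := by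
  intro ι _ A hA hAe y
  rcases isEmpty_or_nonempty ι with hι | hι
  · simp
  set e := Fintype.equivFin ι with he
  have h1 := h (Fintype.card ι) Fintype.card_pos (A.submatrix e.symm e.symm) (hA.submatrix _)
    (fun i j => hAe _ _)
  have h2 := h1.dotProduct_mulVec_nonneg (fun i => y (e.symm i))
  refine h2.trans_eq ?_
  simp only [dotProduct, Matrix.mulVec, Finset.mul_sum, star_trivial, Matrix.map_apply,
    Matrix.submatrix_apply, Pi.star_apply]
  rw [← Equiv.sum_comp e.symm]
  refine Finset.sum_congr rfl fun i _ => ?_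
  rw [← Equiv.sum_comp e.symm]
  refine Finset.sum_congr rfl fun j _ => ?_
  ring

lemma psPSD_two {x y z : ℝ} (hx : 0 ≤ x) (hy : 0 ≤ y) (hz : z ^ 2 ≤ x * y) :
    (!![x, z; z, y] : Matrix (Fin 2) (Fin 2) ℝ).PosSemidef := by
  refine Matrix.PosSemidef.of_dotProduct_mulVec_nonneg ?_ ?_
  · ext i j; fin_cases i <;> fin_cases j <;> rfl
  · intro w
    simp only [dotProduct, Matrix.mulVec, Fin.sum_univ_two, Pi.star_apply, star_trivial]
    simp only [of_apply, cons_val', cons_val_zero, cons_val_one, cons_val_fin_one]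
    rcases hx.eq_or_lt with rfl | hx
    · have : z = 0 := by nlinarith
      subst this
      nlinarith [mul_nonneg hy (sq_nonneg (w 1))]
    · have : 0 ≤ x * (w 0 * (x * w 0 + z * w 1) + w 1 * (z * w 0 + y * w 1)) := by
        nlinarith [sq_nonneg (x * w 0 + z * w 1), mul_nonneg (sub_nonneg.2 hz) (sq_nonneg (w 1))]
      exact nonneg_of_mul_nonneg_right this hx

lemma psPres_two {f : ℝ → ℝ} {S : Set ℝ} (h : psPres f S) {x y z : ℝ} (hx : x ∈ S) (hy : y ∈ S)
    (hz : z ∈ S) (hx0 : 0 ≤ x) (hy0 : 0 ≤ y) (hzxy : z ^ 2 ≤ x * y) : f z ^ 2 ≤ f x * f y := by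
  have h1 := h (Fin 2) _ (psPSD_two hx0 hy0 hzxy) (by
    intro i j; fin_cases i <;> fin_cases j <;> assumption)
  have h2 : ∀ t : ℝ, 0 ≤ f x * (t * t) + 2 * f z * t + f y := by
    intro t
    have := h1 ![t, 1]
    simp [Fin.sum_univ_two] at this
    linarith
  have := discrim_le_zero h2
  simp only [discrim] at this
  linarith

lemma psPres_nonneg {f : ℝ → ℝ} {S : Set ℝ} (h : psPres f S) {x : ℝ} (hx : x ∈ S)
    (hx0 : 0 ≤ x) : 0 ≤ f x := by
  have h1 := h (Fin 2) _ (psPSD_two hx0 hx0 (sq x).le) (by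
    intro i j; fin_cases i <;> fin_cases j <;> assumption)
  have := h1 ![1, 0]
  simpa [Fin.sum_univ_two] using this

lemma psPres_mono {f : ℝ → ℝ} {S : Set ℝ} (h : psPres f S) {x y : ℝ} (hx : x ∈ S) (hy : y ∈ S)
    (hx0 : 0 ≤ x) (hxy : x ≤ y) : f x ≤ f y := by
  have h1 := psPres_two h hx hy hx hx0 (hx0.trans hxy) (by nlinarith)
  have h2 := psPres_nonneg h hx hx0
  have h3 := psPres_nonneg h hy (hx0.trans hxy)
  by_contra hc
  push Not at hc
  nlinarith

lemma psPres_continuousOn {f : ℝ → ℝ} {u v : ℝ} (hu : 0 ≤ u) (h : psPres f (Ioo u v)) :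
    ContinuousOn f (Ioo u v) := by
  intro x hx
  apply ContinuousAt.continuousWithinAt
  have hx0 : 0 < x := lt_of_le_of_lt hu hx.1
  have hmono : MonotoneOn f (Ioo u v) := fun p hp q hq hpq =>
    psPres_mono h hp hq (hu.trans hp.1.le) hpq
  have hR := MonotoneOn.tendsto_nhdsWithin_Ioo_right (f := f) (x := x) (y := v) (nonempty_Ioo.2 hx.2)
    (hmono.mono (Ioo_subset_Ioo_left hx.1.le))
    ⟨f x, by rintro _ ⟨y, hy, rfl⟩; exact hmono hx ⟨hx.1.trans hy.1, hy.2⟩ hy.1.le⟩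
  have hL := MonotoneOn.tendsto_nhdsWithin_Ioo_left (f := f) (x := x) (y := u) (nonempty_Ioo.2 hx.1)
    (hmono.mono (Ioo_subset_Ioo_right hx.2.le))
    ⟨f x, by rintro _ ⟨y, hy, rfl⟩; exact hmono ⟨hy.1, hy.2.trans hx.2⟩ hx hy.2.le⟩
  set r := sInf (f '' Ioo x v)
  set l := sSup (f '' Ioo u x)
  have hlf : l ≤ f x := by
    refine le_of_tendsto hL ?_
    filter_upwards [Ioo_mem_nhdsLT hx.1] with y hy
    exact hmono ⟨hy.1, hy.2.trans hx.2⟩ hx hy.2.le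
  have hfr : f x ≤ r := by
    refine ge_of_tendsto hR ?_
    filter_upwards [Ioo_mem_nhdsGT hx.2] with y hy
    exact hmono hx ⟨hx.1.trans hy.1, hy.2⟩ hy.1.le
  have hl0 : 0 ≤ l := by
    refine ge_of_tendsto hL ?_
    filter_upwards [Ioo_mem_nhdsLT hx.1] with y hy
    exact psPres_nonneg h ⟨hy.1, hy.2.trans hx.2⟩ (hu.trans hy.1.le)
  have key : r ^ 2 ≤ l * r := by
    have e1 : Filter.Tendsto (fun t : ℝ => x * t) (nhdsWithin 1 (Ioi 1)) (nhdsWithin x (Ioi x)) := by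
      refine tendsto_nhdsWithin_iff.2 ⟨?_, ?_⟩
      · have : ContinuousAt (fun t : ℝ => x * t) 1 := by fun_prop
        have := this.tendsto
        rw [mul_one] at this
        exact this.mono_left nhdsWithin_le_nhds
      · filter_upwards [self_mem_nhdsWithin] with t ht
        have ht : 1 < t := ht
        show x < x * t
        nlinarith
    have e2 : Filter.Tendsto (fun t : ℝ => x * t ^ 3) (nhdsWithin 1 (Ioi 1)) (nhdsWithin x (Ioi x)) := by
      refine tendsto_nhdsWithin_iff.2 ⟨?_, ?_⟩
      · have : ContinuousAt (fun t : ℝ => x * t ^ 3) 1 := by fun_prop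
        have := this.tendsto
        rw [one_pow, mul_one] at this
        exact this.mono_left nhdsWithin_le_nhds
      · filter_upwards [self_mem_nhdsWithin] with t ht
        have ht : 1 < t ^ 3 := one_lt_pow₀ ht (by norm_num)
        show x < x * t ^ 3
        nlinarith
    have e3 : Filter.Tendsto (fun t : ℝ => x * t⁻¹) (nhdsWithin 1 (Ioi 1)) (nhdsWithin x (Iio x)) := by
      refine tendsto_nhdsWithin_iff.2 ⟨?_, ?_⟩
      · have : ContinuousAt (fun t : ℝ => x * t⁻¹) 1 :=
          continuousAt_const.mul (continuousAt_inv₀ one_ne_zero)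
        have := this.tendsto
        rw [inv_one, mul_one] at this
        exact this.mono_left nhdsWithin_le_nhds
      · filter_upwards [self_mem_nhdsWithin] with t ht
        have ht : t⁻¹ < 1 := inv_lt_one_of_one_lt₀ ht
        show x * t⁻¹ < x
        nlinarith
    refine le_of_tendsto_of_tendsto ((hR.comp e1).pow 2) ((hL.comp e3).mul (hR.comp e2)) ?_
    filter_upwards [self_mem_nhdsWithin, e1 (Ioo_mem_nhdsGT hx.2), e2 (Ioo_mem_nhdsGT hx.2),
      e3 (Ioo_mem_nhdsLT hx.1)] with t ht h1 h2 h3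
    have ht : 1 < t := ht
    simp only [mem_preimage] at h1 h2 h3
    refine psPres_two h ⟨h3.1, h3.2.trans hx.2⟩ ⟨hx.1.trans h2.1, h2.2⟩ ⟨hx.1.trans h1.1, h1.2⟩
      (hu.trans h3.1.le) (hx0.le.trans h2.1.le) (le_of_eq ?_)
    field_simp
  have hrl : r ≤ l := by
    by_contra hc
    push Not at hc
    nlinarith
  have hl : l = f x := le_antisymm hlf (hfr.trans hrl)
  have hr : r = f x := le_antisymm (hrl.trans hlf) hfr
  rw [hl] at hL
  rw [hr] at hR
  exact continuousAt_iff_continuous_left'_right'.2 ⟨hL, hR⟩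

/-! ### Mollification -/

open MeasureTheory in
lemma psMoll_pres {f G : ℝ → ℝ} (hG : Continuous G) (φ : ContDiffBump (0 : ℝ)) {u v u2 v2 : ℝ}
    (hu2 : 0 < u2) (hf : psPres f (Ioo u v))
    (hGf : ∀ x ∈ Ioo u2 v2, ∀ t : ℝ, |t| < φ.rOut →
      G (Real.log x - t) = f (Real.exp (-t) * x) ∧ Real.exp (-t) * x ∈ Ioo u v) :
    psPres (fun x => convolution (φ.normed volume) G (ContinuousLinearMap.lsmul ℝ ℝ) volume (Real.log x))
      (Ioo u2 v2) := by
  intro ι _ A hA hAe y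
  have hint : ∀ s, Integrable (fun t => φ.normed volume t * G (s - t)) volume := by
    intro s
    refine Continuous.integrable_of_hasCompactSupport ?_ ?_
    · exact φ.continuous_normed.mul (hG.comp (continuous_const.sub continuous_id))
    · exact φ.hasCompactSupport_normed.mul_right
  have h1 : ∑ i, ∑ j, y i * y j *
      convolution (φ.normed volume) G (ContinuousLinearMap.lsmul ℝ ℝ) volume (Real.log (A i j)) =
      ∫ t, ∑ i, ∑ j, y i * y j * (φ.normed volume t * G (Real.log (A i j) - t)) := by
    rw [integral_finsetSum _ (fun i _ => integrable_finsetSum _ fun j _ =>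
      (hint _).const_mul _)]
    refine Finset.sum_congr rfl fun i _ => ?_
    rw [integral_finsetSum _ (fun j _ => (hint _).const_mul _)]
    refine Finset.sum_congr rfl fun j _ => ?_
    rw [integral_const_mul]
    rfl
  rw [h1]
  refine integral_nonneg fun t => ?_
  simp only [Pi.zero_apply]
  by_cases ht : |t| < φ.rOut
  · have h2 : ∑ i, ∑ j, y i * y j * (φ.normed volume t * G (Real.log (A i j) - t)) =
        φ.normed volume t * ∑ i, ∑ j, y i * y j * f ((Real.exp (-t) • A) i j) := by
      simp only [Finset.mul_sum]
      refine Finset.sum_congr rfl fun i _ => Finset.sum_congr rfl fun j _ => ?_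
      rw [(hGf _ (hAe i j) t ht).1, Matrix.smul_apply, smul_eq_mul]
      ring
    rw [h2]
    refine mul_nonneg (φ.nonneg_normed t) ?_
    exact hf ι _ (hA.smul (Real.exp_pos _).le) (fun i j => (hGf _ (hAe i j) t ht).2) y
  · have : φ.normed volume t = 0 := by
      have hs := φ.support_normed_eq (μ := (volume : Measure ℝ))
      by_contra hc
      have : t ∈ Function.support (φ.normed volume) := hc
      rw [hs] at this
      simp at this
      exact ht this
    simp [this]

open MeasureTheory in
lemma psMoll {f : ℝ → ℝ} {u v u' v' : ℝ} (hu : 0 ≤ u) (hf : psPres f (Ioo u v)) (huu : u < u')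
    (huv : u' < v') (hvv : v' < v) :
    ∃ d : ℕ → ℝ, (∀ m, 0 ≤ d m) ∧ ∀ x ∈ Ioo u' v', HasSum (fun m => d m * x ^ m) (f x) := by
  obtain ⟨u1, hu1, hu1'⟩ := exists_between huu
  obtain ⟨u2, hu2, hu2'⟩ := exists_between hu1'
  obtain ⟨v1, hv1, hv1'⟩ := exists_between hvv
  have hu1p : 0 < u1 := by linarith
  have hu2p : 0 < u2 := by linarith
  have hv'p : 0 < v' := by linarith
  have hv1p : 0 < v1 := by linarith
  have hcont := psPres_continuousOn hu hf
  set α := Real.log u1 with hα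
  set β := Real.log v1 with hβ
  have hαβ : α ≤ β := Real.log_le_log hu1p (by linarith)
  set cl : ℝ → ℝ := fun s => max α (min s β) with hcl
  have hclmem : ∀ s, Real.exp (cl s) ∈ Ioo u v := by
    intro s
    have h1 : α ≤ cl s := le_max_left _ _
    have h2 : cl s ≤ β := max_le hαβ (min_le_right _ _)
    have h3 := Real.exp_le_exp.2 h1
    have h4 := Real.exp_le_exp.2 h2
    rw [hα, Real.exp_log hu1p] at h3
    rw [hβ, Real.exp_log hv1p] at h4
    exact ⟨by linarith, by linarith⟩
  have hclid : ∀ s, α ≤ s → s ≤ β → cl s = s := by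
    intro s h1 h2
    simp [hcl, h1, h2]
  set G : ℝ → ℝ := fun s => f (Real.exp (cl s)) with hG
  have hGc : Continuous G := by
    refine hcont.comp_continuous ?_ hclmem
    exact Real.continuous_exp.comp (by fun_prop)
  set δ := min (Real.log u2 - α) (β - Real.log v') with hδ
  have hδp : 0 < δ := lt_min (sub_pos.2 (Real.log_lt_log hu1p hu2))
    (sub_pos.2 (Real.log_lt_log hv'p hv1))
  have hδ1 : δ ≤ Real.log u2 - α := min_le_left _ _
  have hδ2 : δ ≤ β - Real.log v' := min_le_right _ _
  set ρ : ℕ → ℝ := fun j => δ / ((j : ℝ) + 1) with hρ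
  have hρp : ∀ j, 0 < ρ j := fun j => by positivity
  have hρδ : ∀ j, ρ j ≤ δ := fun j => div_le_self hδp.le (by linarith [Nat.cast_nonneg (α := ℝ) j])
  set φ : ℕ → ContDiffBump (0 : ℝ) := fun j => ⟨ρ j / 2, ρ j, half_pos (hρp j), half_lt_self (hρp j)⟩
    with hφ
  have hlim : Filter.Tendsto (fun j => (φ j).rOut) Filter.atTop (nhds 0) := by
    have := tendsto_one_div_add_atTop_nhds_zero_nat (𝕜 := ℝ)
    have := this.const_mul δ
    simp only [mul_zero, mul_one_div] at this
    exact this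
  set g : ℕ → ℝ → ℝ := fun j =>
    convolution ((φ j).normed volume) G (ContinuousLinearMap.lsmul ℝ ℝ) volume with hg
  have hgs : ∀ j, ContDiff ℝ (⊤ : ℕ∞) (g j) := fun j =>
    (φ j).hasCompactSupport_normed.contDiff_convolution_left _ (φ j).contDiff_normed
      hGc.locallyIntegrable
  have hgp : ∀ j, psPres (fun x => g j (Real.log x)) (Ioo u2 v') := by
    intro j
    refine psMoll_pres hGc (φ j) hu2p hf ?_
    intro x hx t ht
    have ht' : |t| < δ := lt_of_lt_of_le ht (hρδ j)
    rw [abs_lt] at ht'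
    have hxp : 0 < x := hu2p.trans hx.1
    have l1 := Real.log_lt_log hu2p hx.1
    have l2 := Real.log_lt_log hxp hx.2
    have hid := hclid (Real.log x - t) (by linarith) (by linarith)
    have he : Real.exp (Real.log x - t) = Real.exp (-t) * x := by
      rw [sub_eq_add_neg, Real.exp_add, Real.exp_log hxp, mul_comm]
    have hm := hclmem (Real.log x - t)
    rw [hid, he] at hm
    refine ⟨?_, hm⟩
    simp only [hG]
    rw [hid, he]
  choose d hd hds using fun j => psSmooth (hgs j) hu2p.le (hgp j) hu2'
  refine psClosure (c := d) (F := fun j x => g j (Real.log x)) hd (fun x hx => by linarith [hx.1]) ?_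
    (fun x hx => Filter.Eventually.of_forall fun j => hds j x hx) ?_
  · intro x hx
    obtain ⟨y, hy1, hy2⟩ := exists_between hx.2
    exact ⟨y, ⟨hx.1.trans hy1, hy2⟩, hy1⟩
  · intro x hx
    have hxp : 0 < x := by linarith [hx.1]
    have h1 := ContDiffBump.convolution_tendsto_right_of_continuous (μ := (volume : Measure ℝ)) hlim hGc
      (Real.log x)
    have h2 : G (Real.log x) = f x := by
      simp only [hG]
      rw [hclid _ (Real.log_le_log hu1p (by linarith [hx.1])) (Real.log_le_log hxp (by linarith [hx.2])),
        Real.exp_log hxp]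
    rw [h2] at h1
    exact h1

/-! ### Power series with nonnegative coefficients -/

def psJ (a : ℝ) (b : EReal) : Set ℝ := {x : ℝ | a < x ∧ (x : EReal) < b}

lemma psJ_isOpen (a : ℝ) (b : EReal) : IsOpen (psJ a b) :=
  (isOpen_Ioi (a := a)).inter ((isOpen_Iio (a := b)).preimage continuous_coe_real_ereal)

lemma psInterior {a : ℝ} {b : EReal} {I : Set ℝ} (hI : I = {x : ℝ | a < x ∧ (x : EReal) < b} ∨
          I = {x : ℝ | a ≤ x ∧ (x : EReal) < b}) : interior I = psJ a b := by
  rcases hI with rfl | rfl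
  · exact (psJ_isOpen a b).interior_eq
  · have : {x : ℝ | a ≤ x ∧ (x : EReal) < b} = Ici a ∩ (fun x : ℝ => (x : EReal)) ⁻¹' Iio b := rfl
    rw [this, interior_inter, interior_Ici,
      ((isOpen_Iio (a := b)).preimage continuous_coe_real_ereal).interior_eq]
    rfl

lemma psJ_up {a : ℝ} {b : EReal} {x : ℝ} (hx : (x : EReal) < b) : ∃ y : ℝ, x < y ∧ (y : EReal) < b := by
  obtain ⟨y, h1, h2⟩ := EReal.lt_iff_exists_real_btwn.1 hx
  exact ⟨y, by exact_mod_cast h1, h2⟩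

lemma psSummable_le {c : ℕ → ℝ} (hc : ∀ m, 0 ≤ c m) {x y : ℝ} (hxy : |x| ≤ y)
    (hs : Summable fun m => c m * y ^ m) : Summable fun m => c m * x ^ m := by
  refine Summable.of_norm_bounded hs fun m => ?_
  rw [Real.norm_eq_abs, abs_mul, abs_pow, abs_of_nonneg (hc m)]
  exact mul_le_mul_of_nonneg_left (pow_le_pow_left₀ (abs_nonneg _) hxy m) (hc m)

lemma psSummable_all {c : ℕ → ℝ} (hc : ∀ m, 0 ≤ c m) {a : ℝ} {b : EReal} (hab : (a : EReal) < b)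
    (hs : ∀ x ∈ psJ a b, Summable fun m => c m * x ^ m) (x : ℝ) (hx : ((|x| : ℝ) : EReal) < b) :
    Summable fun m => c m * x ^ m := by
  have : ((max |x| a : ℝ) : EReal) < b := by
    rcases max_choice |x| a with h | h <;> rw [h] <;> assumption
  obtain ⟨y, hy1, hy2⟩ := psJ_up (a := a) this
  exact psSummable_le hc ((le_max_left _ _).trans hy1.le)
    (hs y ⟨lt_of_le_of_lt (le_max_right _ _) hy1, hy2⟩)

lemma psCont {c : ℕ → ℝ} (hc : ∀ m, 0 ≤ c m) {b : EReal}
    (hs : ∀ x : ℝ, ((|x| : ℝ) : EReal) < b → Summable fun m => c m * x ^ m) (x : ℝ)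
    (hx : ((|x| : ℝ) : EReal) < b) : ContinuousAt (fun x => ∑' m, c m * x ^ m) x := by
  obtain ⟨y, hy1, hy2⟩ := psJ_up (a := 0) hx
  have hy0 : 0 ≤ y := (abs_nonneg x).trans hy1.le
  have h1 : ContinuousOn (fun x => ∑' m, c m * x ^ m) (Icc (-y) y) := by
    refine continuousOn_tsum (fun m => by fun_prop) (hs y (by rwa [abs_of_nonneg hy0])) ?_
    intro m z hz
    rw [Real.norm_eq_abs, abs_mul, abs_pow, abs_of_nonneg (hc m)]
    exact mul_le_mul_of_nonneg_left (pow_le_pow_left₀ (abs_nonneg _) (abs_le.2 hz) m) (hc m)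
  exact h1.continuousAt (Icc_mem_nhds (abs_lt.1 hy1).1 (abs_lt.1 hy1).2)

lemma psPow_bound {r y : ℝ} (hr : 0 ≤ r) (hry : r ≤ y) (m : ℕ) :
    (m + 1 : ℝ) * r ^ m * (y - r) ≤ y ^ (m + 1) := by
  suffices h : (m + 1 : ℝ) * r ^ m * (y - r) + r ^ (m + 1) ≤ y ^ (m + 1) by
    have := pow_nonneg hr (m + 1)
    linarith
  induction m with
  | zero => simp
  | succ m ih =>
    have h1 := mul_le_mul_of_nonneg_right ih (hr.trans hry)
    have h2 : (m + 1 : ℝ) * r ^ m * (y - r) * (y - r) ≥ 0 := by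
      have := sub_nonneg.2 hry
      positivity
    rw [pow_succ y (m+1)]
    refine le_trans ?_ h1
    push_cast
    rw [pow_succ r (m+1), pow_succ r m] at *
    nlinarith

lemma psDeriv_summable {c : ℕ → ℝ} (hc : ∀ m, 0 ≤ c m) {r y : ℝ} (hr : 0 ≤ r) (hry : r < y)
    (hs : Summable fun m => c m * y ^ m) :
    Summable fun m : ℕ => (m + 1 : ℝ) * c (m + 1) * r ^ m := by
  have h1 : Summable fun m => c (m + 1) * y ^ (m + 1) := (summable_nat_add_iff 1).2 hs
  refine Summable.of_nonneg_of_le (fun m => ?_) (fun m => ?_) (h1.mul_left (y - r)⁻¹)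
  · have := hc (m + 1); positivity
  · have h2 := psPow_bound hr hry.le m
    have h3 := mul_le_mul_of_nonneg_left h2 (hc (m + 1))
    rw [inv_mul_eq_div, le_div_iff₀ (sub_pos.2 hry)]
    linarith

lemma psDeriv_all {c : ℕ → ℝ} (hc : ∀ m, 0 ≤ c m) {b : EReal}
    (hs : ∀ x : ℝ, ((|x| : ℝ) : EReal) < b → Summable fun m => c m * x ^ m) (x : ℝ)
    (hx : ((|x| : ℝ) : EReal) < b) : Summable fun m : ℕ => (m + 1 : ℝ) * c (m + 1) * x ^ m := by
  obtain ⟨y, hy1, hy2⟩ := psJ_up (a := 0) hx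
  have hy0 : 0 ≤ y := (abs_nonneg x).trans hy1.le
  have h1 := psDeriv_summable hc (abs_nonneg x) hy1 (hs y (by rwa [abs_of_nonneg hy0]))
  exact psSummable_le (c := fun m : ℕ => (m + 1 : ℝ) * c (m + 1))
    (fun m => mul_nonneg (by positivity) (hc _)) le_rfl h1

lemma psDeriv {c : ℕ → ℝ} (hc : ∀ m, 0 ≤ c m) {b : EReal}
    (hs : ∀ x : ℝ, ((|x| : ℝ) : EReal) < b → Summable fun m => c m * x ^ m) (x : ℝ)
    (hx : ((|x| : ℝ) : EReal) < b) :
    HasDerivAt (fun x => ∑' m, c m * x ^ m) (∑' m : ℕ, (m + 1 : ℝ) * c (m + 1) * x ^ m) x := by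
  obtain ⟨r, hr1, hr2⟩ := psJ_up (a := 0) hx
  obtain ⟨y, hy1, hy2⟩ := psJ_up (a := 0) hr2
  have hr0 : 0 ≤ r := (abs_nonneg x).trans hr1.le
  have hy0 : 0 ≤ y := hr0.trans hy1.le
  have h1 := psDeriv_summable hc hr0 hy1 (hs y (by rwa [abs_of_nonneg hy0]))
  have hu : Summable fun m : ℕ => c m * (m * r ^ (m - 1)) := by
    rw [← summable_nat_add_iff 1]
    refine psSM h1 fun m => ?_
    push_cast
    ring
  have hxm : x ∈ Ioo (-r) r := abs_lt.1 hr1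
  have h2 := hasDerivAt_tsum_of_isPreconnected (g := fun m x => c m * x ^ m)
    (g' := fun m x => c m * (m * x ^ (m - 1))) hu isOpen_Ioo isPreconnected_Ioo
    (fun m z _ => (hasDerivAt_pow m z).const_mul (c m)) (fun m z hz => ?_) hxm (hs x hx) hxm
  · refine h2.congr_deriv ?_
    have hsum : Summable fun m : ℕ => c m * (m * x ^ (m - 1)) := by
      rw [← summable_nat_add_iff 1]
      refine psSM (psDeriv_all hc hs x hx) fun m => ?_
      push_cast
      ring
    rw [hsum.tsum_eq_zero_add]
    simp only [Nat.cast_zero, zero_mul, mul_zero, zero_add]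
    refine tsum_congr fun m => ?_
    push_cast
    ring
  · rw [Real.norm_eq_abs, abs_mul, abs_mul, abs_pow, abs_of_nonneg (hc m), Nat.abs_cast]
    have := pow_le_pow_left₀ (abs_nonneg z) (abs_le.2 ⟨hz.1.le, hz.2.le⟩) (m - 1)
    have := hc m
    gcongr

lemma psJ_abs {a : ℝ} (ha : 0 ≤ a) {b : EReal} {x : ℝ} (hx : x ∈ psJ a b) :
    ((|x| : ℝ) : EReal) < b := by
  rw [abs_of_nonneg (ha.trans hx.1.le)]; exact hx.2

lemma psDerivOn {c : ℕ → ℝ} (hc : ∀ m, 0 ≤ c m) {a : ℝ} (ha : 0 ≤ a) {b : EReal}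
    (hs : ∀ x : ℝ, ((|x| : ℝ) : EReal) < b → Summable fun m => c m * x ^ m) {f : ℝ → ℝ}
    (hf : ∀ x ∈ psJ a b, HasSum (fun m => c m * x ^ m) (f x)) (x : ℝ) (hx : x ∈ psJ a b) :
    HasDerivAt f (∑' m : ℕ, (m + 1 : ℝ) * c (m + 1) * x ^ m) x := by
  refine (psDeriv hc hs x (psJ_abs ha hx)).congr_of_eventuallyEq ?_
  filter_upwards [(psJ_isOpen a b).mem_nhds hx] with z hz
  exact (hf z hz).tsum_eq.symm

lemma psAM_nonneg {a : ℝ} (ha : 0 ≤ a) {b : EReal} (k : ℕ) : ∀ (c : ℕ → ℝ) (f : ℝ → ℝ),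
    (∀ m, 0 ≤ c m) →
    (∀ x : ℝ, ((|x| : ℝ) : EReal) < b → Summable fun m => c m * x ^ m) →
    (∀ x ∈ psJ a b, HasSum (fun m => c m * x ^ m) (f x)) →
    ContDiffOn ℝ k f (psJ a b) ∧ ∀ x ∈ psJ a b, 0 ≤ iteratedDerivWithin k f (psJ a b) x := by
  induction k with
  | zero =>
    intro c f hc hs hf
    refine ⟨?_, fun x hx => ?_⟩
    · rw [Nat.cast_zero, contDiffOn_zero]
      exact fun x hx => (psDerivOn hc ha hs hf x hx).continuousAt.continuousWithinAt
    · rw [iteratedDerivWithin_zero]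
      exact (hf x hx).nonneg fun m => mul_nonneg (hc m) (pow_nonneg (ha.trans hx.1.le) m)
  | succ k ih =>
    intro c f hc hs hf
    have hd := psDerivOn hc ha hs hf
    have hO := psJ_isOpen a b
    have hf' : ∀ x ∈ psJ a b, HasSum (fun m : ℕ => (m + 1 : ℝ) * c (m + 1) * x ^ m) (deriv f x) := by
      intro x hx
      rw [(hd x hx).deriv]
      exact (psDeriv_all hc hs x (psJ_abs ha hx)).hasSum
    obtain ⟨h1, h2⟩ := ih (fun m : ℕ => (m + 1 : ℝ) * c (m + 1)) (deriv f)
      (fun m => mul_nonneg (by positivity) (hc _)) (psDeriv_all hc hs) hf'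
    constructor
    · rw [Nat.cast_succ, contDiffOn_succ_iff_deriv_of_isOpen hO]
      refine ⟨fun x hx => (hd x hx).differentiableAt.differentiableWithinAt, ?_, h1⟩
      intro h; simp at h
    · intro x hx
      rw [iteratedDerivWithin_succ']
      rw [iteratedDerivWithin_congr (g := deriv f) (fun z hz => derivWithin_of_isOpen hO hz) hx]
      exact h2 x hx
/-! ### Assembling -/

lemma psExhaust {f : ℝ → ℝ} {a : ℝ} (ha : 0 ≤ a) {b : EReal} (hab : (a : EReal) < b)
    (hf : psPres f (psJ a b)) :
    ∃ d : ℕ → ℝ, (∀ m, 0 ≤ d m) ∧ ∀ x ∈ psJ a b, HasSum (fun m => d m * x ^ m) (f x) := by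
  obtain ⟨V, hVm, hV, hVlim⟩ := exists_seq_strictMono_tendsto' hab
  have hVr : ∀ j, ((V j).toReal : EReal) = V j := fun j =>
    EReal.coe_toReal (ne_top_of_lt (hV j).2) (ne_bot_of_gt (hV j).1)
  have haV : ∀ j, a < (V j).toReal := fun j => by
    have := (hV j).1
    rw [← hVr j] at this
    exact_mod_cast this
  set U : ℕ → ℝ := fun j => a + ((V 0).toReal - a) * (1 / ((j : ℝ) + 1)) with hU
  have hUlim : Filter.Tendsto U Filter.atTop (nhds a) := by
    have := ((tendsto_one_div_add_atTop_nhds_zero_nat (𝕜 := ℝ)).const_mul ((V 0).toReal - a)).const_add a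
    simpa [hU] using this
  have haU : ∀ j, a < U j := fun j => by
    have h1 : 0 < ((V 0).toReal - a) * (1 / ((j : ℝ) + 1)) :=
      mul_pos (sub_pos.2 (haV 0)) (by positivity)
    simp only [hU]; linarith
  have hUV : ∀ j, U j < (V (j + 1)).toReal := fun j => by
    have h1 : ((V 0).toReal - a) * (1 / ((j : ℝ) + 1)) ≤ (V 0).toReal - a := by
      rw [mul_one_div]
      exact div_le_self (sub_pos.2 (haV 0)).le (by linarith [Nat.cast_nonneg (α := ℝ) j])
    have h2 : (V 0).toReal < (V (j + 1)).toReal := by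
      have := hVm (Nat.succ_pos j)
      rw [← hVr 0, ← hVr (j + 1)] at this
      exact_mod_cast this
    simp only [hU]; linarith
  have hrep : ∀ j, ∃ d : ℕ → ℝ, (∀ m, 0 ≤ d m) ∧
      ∀ x ∈ Ioo (U j) (V (j + 1)).toReal, HasSum (fun m => d m * x ^ m) (f x) := by
    intro j
    have h3 : (V (j + 1)).toReal < (V (j + 2)).toReal := by
      have := hVm (Nat.lt_succ_self (j + 1))
      rw [← hVr (j + 1), ← hVr (j + 1 + 1)] at this
      exact_mod_cast this
    refine psMoll ha (hf.subset ?_) (haU j) (hUV j) h3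
    intro x hx
    refine ⟨hx.1, lt_trans ?_ (hV (j + 2)).2⟩
    rw [← hVr (j + 2)]
    exact_mod_cast hx.2
  choose d hd hds using hrep
  refine psClosure (c := d) (F := fun _ => f) hd (fun x hx => lt_of_le_of_lt ha hx.1) ?_ ?_
    (fun x _ => tendsto_const_nhds)
  · intro x hx
    obtain ⟨y, h1, h2⟩ := psJ_up (a := 0) hx.2
    exact ⟨y, ⟨hx.1.trans h1, h2⟩, h1⟩
  · intro x hx
    filter_upwards [hUlim.eventually (gt_mem_nhds hx.1),
      (hVlim.comp (Filter.tendsto_add_atTop_nat 1)).eventually (lt_mem_nhds hx.2)] with j h1 h2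
    refine hds j x ⟨h1, ?_⟩
    simp only [Function.comp] at h2
    rw [← hVr (j + 1)] at h2
    exact_mod_cast h2

lemma psRightLim {c : ℕ → ℝ} (hc : ∀ m, 0 ≤ c m) {a : ℝ} (ha : 0 ≤ a) {b : EReal}
    (hab : (a : EReal) < b)
    (hs : ∀ x : ℝ, ((|x| : ℝ) : EReal) < b → Summable fun m => c m * x ^ m) {f : ℝ → ℝ}
    (hf : ∀ x ∈ psJ a b, HasSum (fun m => c m * x ^ m) (f x)) :
    Filter.Tendsto f (nhdsWithin a (Ioi a)) (nhds (∑' m, c m * a ^ m)) := by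
  have h1 := (psCont hc hs a (by rwa [abs_of_nonneg ha])).tendsto
  refine (h1.mono_left nhdsWithin_le_nhds).congr' ?_
  filter_upwards [self_mem_nhdsWithin, nhdsWithin_le_nhds
    ((isOpen_Iio (a := b)).preimage continuous_coe_real_ereal |>.mem_nhds hab)] with z hz1 hz2
  exact (hf z ⟨hz1, hz2⟩).tsum_eq

lemma psJ_mem_right {a : ℝ} {b : EReal} (hab : (a : EReal) < b) :
    psJ a b ∈ nhdsWithin a (Ioi a) := by
  filter_upwards [self_mem_nhdsWithin, nhdsWithin_le_nhds
    ((isOpen_Iio (a := b)).preimage continuous_coe_real_ereal |>.mem_nhds hab)] with z hz1 hz2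
  exact ⟨hz1, hz2⟩

lemma psEndpoint {f : ℝ → ℝ} {a : ℝ} (ha : 0 ≤ a) {b : EReal} (hab : (a : EReal) < b)
    (hf : psPres f {x : ℝ | a ≤ x ∧ (x : EReal) < b}) {L : ℝ}
    (hL : Filter.Tendsto f (nhdsWithin a (Ioi a)) (nhds L)) : f a = L := by
  have haI : a ∈ {x : ℝ | a ≤ x ∧ (x : EReal) < b} := ⟨le_rfl, hab⟩
  have hfa := psPres_nonneg hf haI ha
  have hmem := psJ_mem_right hab
  have hle : f a ≤ L := by
    refine ge_of_tendsto hL ?_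
    filter_upwards [hmem] with z hz
    exact psPres_mono hf haI ⟨hz.1.le, hz.2⟩ ha hz.1.le
  refine le_antisymm hle ?_
  rcases ha.eq_or_lt with rfl | hap
  · have e2 : Filter.Tendsto (fun t : ℝ => 2 * t) (nhdsWithin 0 (Ioi 0)) (nhdsWithin 0 (Ioi 0)) := by
      refine tendsto_nhdsWithin_iff.2 ⟨?_, ?_⟩
      · have : ContinuousAt (fun t : ℝ => 2 * t) 0 := by fun_prop
        have := this.tendsto
        rw [mul_zero] at this
        exact this.mono_left nhdsWithin_le_nhds
      · filter_upwards [self_mem_nhdsWithin] with t ht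
        have ht : 0 < t := ht
        show 0 < 2 * t
        linarith
    have key : 0 ≤ -6 * L + 4 * L + 2 * f 0 := by
      refine ge_of_tendsto (((hL.const_mul (-6)).add ((hL.comp e2).const_mul 4)).add_const (2 * f 0)) ?_
      filter_upwards [hmem, e2 hmem] with t ht ht2
      have ht2 : 2 * t ∈ psJ 0 b := ht2
      have htp : 0 < t := ht.1
      have hA : (!![t, t, 0; t, 2 * t, t; 0, t, t] : Matrix (Fin 3) (Fin 3) ℝ).PosSemidef := by
        refine Matrix.PosSemidef.of_dotProduct_mulVec_nonneg ?_ ?_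
        · ext i j; fin_cases i <;> fin_cases j <;> rfl
        · intro w
          simp [dotProduct, Matrix.mulVec, Fin.sum_univ_three]
          nlinarith [mul_nonneg htp.le (sq_nonneg (w 0 + w 1)), mul_nonneg htp.le (sq_nonneg (w 1 + w 2))]
      have h1 := hf (Fin 3) _ hA (by
        have m1 : t ∈ {x : ℝ | 0 ≤ x ∧ (x : EReal) < b} := ⟨ht.1.le, ht.2⟩
        have m2 : 2 * t ∈ {x : ℝ | 0 ≤ x ∧ (x : EReal) < b} := ⟨ht2.1.le, ht2.2⟩
        intro i j; fin_cases i <;> fin_cases j <;> first | exact m1 | exact m2 | exact haI) ![1, -2, 1]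
      simp [Fin.sum_univ_three] at h1
      simp only [Function.comp]
      linarith
    linarith
  · have e2 : Filter.Tendsto (fun t : ℝ => t ^ 2 / a) (nhdsWithin a (Ioi a)) (nhdsWithin a (Ioi a)) := by
      refine tendsto_nhdsWithin_iff.2 ⟨?_, ?_⟩
      · have : ContinuousAt (fun t : ℝ => t ^ 2 / a) a := by fun_prop
        have := this.tendsto
        rw [show a ^ 2 / a = a by field_simp] at this
        exact this.mono_left nhdsWithin_le_nhds
      · filter_upwards [self_mem_nhdsWithin] with t ht
        have ht : a < t := ht
        show a < t ^ 2 / a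
        rw [lt_div_iff₀ hap]
        nlinarith
    have key : L ^ 2 ≤ f a * L := by
      refine le_of_tendsto_of_tendsto (hL.pow 2) ((hL.comp e2).const_mul (f a)) ?_
      filter_upwards [hmem, e2 hmem] with t ht ht2
      have ht2 : t ^ 2 / a ∈ psJ a b := ht2
      refine psPres_two hf haI ⟨ht2.1.le, ht2.2⟩ ⟨ht.1.le, ht.2⟩ ha (ha.trans ht2.1.le) (le_of_eq ?_)
      field_simp
    by_contra hc
    push Not at hc
    nlinarith

lemma psExtend {c : ℕ → ℝ} (hc : ∀ m, 0 ≤ c m) {a : ℝ} (ha : 0 ≤ a) {b : EReal}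
    (hab : (a : EReal) < b) {f : ℝ → ℝ}
    (hf : ∀ x ∈ psJ a b, HasSum (fun m => c m * x ^ m) (f x)) {I : Set ℝ}
    (hI : I = {x : ℝ | a < x ∧ (x : EReal) < b} ∨ I = {x : ℝ | a ≤ x ∧ (x : EReal) < b})
    (hend : I = {x : ℝ | a ≤ x ∧ (x : EReal) < b} → ∀ L,
      Filter.Tendsto f (nhdsWithin a (Ioi a)) (nhds L) → f a = L) :
    ∃ c : ℕ → ℝ, (∀ m, 0 ≤ c m) ∧
        (∀ x : ℝ, ((|x| : ℝ) : EReal) < b → Summable fun m => c m * x ^ m) ∧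
        ∀ x ∈ I, HasSum (fun m => c m * x ^ m) (f x) := by
  have hs := psSummable_all hc hab (fun x hx => (hf x hx).summable)
  refine ⟨c, hc, hs, ?_⟩
  rcases hI with rfl | hI
  · exact hf
  · intro x hx
    have hx' := hx
    rw [hI] at hx'
    rcases hx'.1.eq_or_lt with rfl | h
    · rw [hend hI _ (psRightLim hc ha hab hs hf)]
      exact (hs a (by rwa [abs_of_nonneg ha])).hasSum
    · exact hf x ⟨h, hx'.2⟩

lemma psAM_rep {f : ℝ → ℝ} {b : EReal} (hb : ((0 : ℝ) : EReal) < b)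
    (hd : ContDiffOn ℝ (⊤ : ℕ∞) f (psJ 0 b))
    (hn : ∀ (k : ℕ), ∀ x ∈ psJ 0 b, 0 ≤ iteratedDerivWithin k f (psJ 0 b) x) :
    ∃ d : ℕ → ℝ, (∀ m, 0 ≤ d m) ∧ ∀ x ∈ psJ 0 b, HasSum (fun m => d m * x ^ m) (f x) := by
  have hO := psJ_isOpen 0 b
  set D : ℕ → ℝ → ℝ := fun k => iteratedDerivWithin k f (psJ 0 b) with hD
  have hDer : ∀ k, ∀ x ∈ psJ 0 b, HasDerivAt (D k) (D (k + 1) x) x := by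
    intro k x hx
    have h1 := hd.differentiableOn_iteratedDerivWithin (m := k)
      (by exact_mod_cast ENat.natCast_lt_top k) hO.uniqueDiffOn
    have h2 := ((h1 x hx).differentiableAt (hO.mem_nhds hx)).hasDerivAt
    simp only [hD]
    rw [iteratedDerivWithin_succ, derivWithin_of_isOpen hO hx]
    exact h2
  obtain ⟨y0, hy0, hy0b⟩ := psJ_up (a := 0) hb
  set X : ℕ → ℝ := fun j => y0 / ((j : ℝ) + 1) with hX
  have hXp : ∀ j, 0 < X j := fun j => by positivity
  have hXy : ∀ j, X j ≤ y0 := fun j => div_le_self hy0.le (by linarith [Nat.cast_nonneg (α := ℝ) j])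
  have hXJ : ∀ j, X j ∈ psJ 0 b := fun j => ⟨hXp j, lt_of_le_of_lt (by exact_mod_cast hXy j) hy0b⟩
  have hXlim : Filter.Tendsto X Filter.atTop (nhds 0) := by
    have := (tendsto_one_div_add_atTop_nhds_zero_nat (𝕜 := ℝ)).const_mul y0
    simp only [mul_zero, mul_one_div] at this
    exact this
  refine psClosure (c := fun j n => D n (X j) / n.factorial) (F := fun j x => f (X j + x))
    (fun j n => div_nonneg (hn n _ (hXJ j)) (by positivity)) (fun x hx => hx.1) ?_ ?_ ?_
  · intro x hx
    obtain ⟨y, h1, h2⟩ := psJ_up (a := 0) hx.2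
    exact ⟨y, ⟨hx.1.trans h1, h2⟩, h1⟩
  · intro x hx
    obtain ⟨y, h1, h2⟩ := psJ_up (a := 0) hx.2
    filter_upwards [hXlim.eventually (gt_mem_nhds (sub_pos.2 h1))] with j hj
    have hm : ∀ v, 0 ≤ v → v ≤ y - X j → X j + v ∈ psJ 0 b := fun v hv hv' =>
      ⟨by linarith [hXp j], lt_of_le_of_lt (by exact_mod_cast (by linarith : X j + v ≤ y)) h2⟩
    have h3 := psBernstein (D := D) (s0 := X j) (r := y - X j) (fun i v hv hv' => hDer i _ (hm v hv hv'))
      (fun i v hv hv' => hn i _ (hm v hv hv')) x hx.1.le (by linarith)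
    refine psHS h3 (fun n => by ring) ?_
    simp [hD]
  · intro x hx
    have hc : ContinuousAt f x := (hd.continuousOn x hx).continuousAt (hO.mem_nhds hx)
    have : Filter.Tendsto (fun j => X j + x) Filter.atTop (nhds x) := by
      simpa using hXlim.add_const x
    exact hc.tendsto.comp this

theorem psd_preservers_power_series
    (a : ℝ) (b : EReal) (ha : 0 ≤ a) (hab : (a : EReal) < b) (I : Set ℝ)
    (hI : I = {x : ℝ | a < x ∧ (x : EReal) < b} ∨
          I = {x : ℝ | a ≤ x ∧ (x : EReal) < b}) (f : ℝ → ℝ) :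
    ((∀ n : ℕ, 1 ≤ n → ∀ A : Matrix (Fin n) (Fin n) ℝ, A.PosSemidef →
        (∀ i j, A i j ∈ I) → (A.map f).PosSemidef) →
      (∃ c : ℕ → ℝ, (∀ m, 0 ≤ c m) ∧
        (∀ x : ℝ, ((|x| : ℝ) : EReal) < b → Summable fun m => c m * x ^ m) ∧
        ∀ x ∈ I, HasSum (fun m => c m * x ^ m) (f x))) ∧
    ((∃ c : ℕ → ℝ, (∀ m, 0 ≤ c m) ∧
        (∀ x : ℝ, ((|x| : ℝ) : EReal) < b → Summable fun m => c m * x ^ m) ∧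
        ∀ x ∈ I, HasSum (fun m => c m * x ^ m) (f x)) →
      AbsolutelyMonotonicOn f I) ∧
    (a = 0 → I = {x : ℝ | 0 ≤ x ∧ (x : EReal) < b} →
      AbsolutelyMonotonicOn f I →
      (∃ c : ℕ → ℝ, (∀ m, 0 ≤ c m) ∧
        (∀ x : ℝ, ((|x| : ℝ) : EReal) < b → Summable fun m => c m * x ^ m) ∧
        ∀ x ∈ I, HasSum (fun m => c m * x ^ m) (f x))) := by
  refine ⟨fun h => ?_, ?_, ?_⟩
  · have hP := psPres_of h
    have hsub : psJ a b ⊆ I := by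
      rcases hI with rfl | rfl
      · exact fun x hx => hx
      · exact fun x hx => ⟨hx.1.le, hx.2⟩
    obtain ⟨c, hc, hf⟩ := psExhaust ha hab (hP.subset hsub)
    refine psExtend hc ha hab hf hI ?_
    intro hI' L hL
    rw [hI'] at hP
    exact psEndpoint ha hab hP hL
  · rintro ⟨c, hc, hs, hf⟩
    have hsub : psJ a b ⊆ I := by
      rcases hI with rfl | rfl
      · exact fun x hx => hx
      · exact fun x hx => ⟨hx.1.le, hx.2⟩
    have hfJ : ∀ x ∈ psJ a b, HasSum (fun m => c m * x ^ m) (f x) := fun x hx => hf x (hsub hx)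
    have hIabs : ∀ x ∈ I, ((|x| : ℝ) : EReal) < b := by
      intro x hx
      rcases hI with rfl | rfl
      · rw [abs_of_nonneg (ha.trans hx.1.le)]; exact hx.2
      · rw [abs_of_nonneg (ha.trans hx.1)]; exact hx.2
    refine ⟨?_, ?_, ?_⟩
    · have h1 : ContinuousOn (fun x => ∑' m, c m * x ^ m) I := fun x hx =>
        (psCont hc hs x (hIabs x hx)).continuousWithinAt
      exact h1.congr fun x hx => (hf x hx).tsum_eq.symm
    · rw [psInterior hI, contDiffOn_infty]
      exact fun n => (psAM_nonneg ha n c f hc hs hfJ).1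
    · intro k x hx
      rw [psInterior hI] at hx ⊢
      exact (psAM_nonneg ha k c f hc hs hfJ).2 x hx
  · rintro rfl hI' ⟨hcont, hd, hn⟩
    rw [psInterior hI] at hd hn
    obtain ⟨c, hc, hf⟩ := psAM_rep hab hd hn
    refine psExtend hc ha hab hf hI ?_
    intro _ L hL
    have h0 : (0 : ℝ) ∈ I := by rw [hI']; exact ⟨le_rfl, hab⟩
    have h1 : Filter.Tendsto f (nhdsWithin 0 (Ioi 0)) (nhds (f 0)) := by
      refine (hcont 0 h0).tendsto.mono_left ?_
      refine nhdsWithin_le_iff.2 ?_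
      filter_upwards [psJ_mem_right hab] with z hz
      rw [hI']; exact ⟨hz.1.le, hz.2⟩
    exact tendsto_nhds_unique h1 hL
end

section
/- Let 0 < R ≤ ∞, let I = [0,R) or I = (-R,R), and let h : I → ℝ with h(0) ≠ 0. Fix integers n ≥ 2 and 1 ≤ k, l ≤ n. Consider: (1) h[A] ∈ S_n^k for all A ∈ P_n^l(I); (2) (h − h(0))[A] ∈ S_n^{k−1} for all A ∈ P_n^l(I); (3) (h − h(0))[A] ∈ S_{n−1}^{k−1} for all A ∈ P_{n−1}^l(I). Then (2) ⇒ (1) ⇒ (3), and if k < n−1 then (1) ⇒ (2). Moreover, if h[A] ∈ P_n^k for all A ∈ P_n^l(I), then (h − h(0))[A] ∈ P_{n−1}^{k−1} for all A ∈ P_{n−1}^l(I), and when k < n−1 also (h − h(0))[A] ∈ P_n^{k−1} for all A ∈ P_n^l(I). -/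
open Matrix Set


namespace RankRed

lemma rank_add_le' {p : ℕ} (A B : Matrix (Fin p) (Fin p) ℝ) :
    (A + B).rank ≤ A.rank + B.rank := by
  unfold Matrix.rank
  rw [Matrix.mulVecLin_add]
  refine (Submodule.finrank_mono (LinearMap.range_add_le _ _)).trans ?_
  exact Submodule.finrank_add_le_finrank_add_finrank _ _

/-- zero padding at index 0 -/
def pad {m : ℕ} (A : Matrix (Fin m) (Fin m) ℝ) : Matrix (Fin (m + 1)) (Fin (m + 1)) ℝ :=
  Matrix.of fun i j => Fin.cases 0 (fun i' => Fin.cases 0 (fun j' => A i' j') j) i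

def padP (m : ℕ) : Matrix (Fin (m + 1)) (Fin m) ℝ :=
  Matrix.of fun i j => if i = j.succ then 1 else 0

lemma pad_eq {m : ℕ} (A : Matrix (Fin m) (Fin m) ℝ) :
    pad A = padP m * A * (padP m)ᴴ := by
  ext i j
  refine Fin.cases ?_ (fun i' => ?_) i <;> refine Fin.cases ?_ (fun j' => ?_) j <;>
    simp [pad, padP, Matrix.mul_apply, (Fin.succ_ne_zero _).symm]

lemma pad_psd {m : ℕ} {A : Matrix (Fin m) (Fin m) ℝ} (hA : A.PosSemidef) :
    (pad A).PosSemidef := by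
  rw [pad_eq]; exact hA.mul_mul_conjTranspose_same _

lemma pad_rank {m : ℕ} (A : Matrix (Fin m) (Fin m) ℝ) : (pad A).rank ≤ A.rank := by
  rw [pad_eq]
  exact (Matrix.rank_mul_le_left _ _).trans (Matrix.rank_mul_le_right _ _)

lemma pad_mem {m : ℕ} {A : Matrix (Fin m) (Fin m) ℝ} {I : Set ℝ} (h0 : (0 : ℝ) ∈ I)
    (hA : ∀ i j, A i j ∈ I) (i j) : pad A i j ∈ I := by
  refine Fin.cases ?_ (fun i' => ?_) i <;> refine Fin.cases ?_ (fun j' => ?_) j <;>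
    simp [pad, h0, hA]

/-- difference matrix -/
def dif (m : ℕ) : Matrix (Fin m) (Fin (m + 1)) ℝ :=
  Matrix.of fun i j => Fin.cases (-1) (fun j' => if i = j' then 1 else 0) j

lemma dif_eq {m : ℕ} (A : Matrix (Fin m) (Fin m) ℝ) (h : ℝ → ℝ) :
    (A.map fun x => h x - h 0) = dif m * (pad A).map h * (dif m)ᴴ := by
  ext i j
  simp [dif, pad, Matrix.mul_apply, Fin.sum_univ_succ]
  ring

lemma schur_rank {m : ℕ} (A : Matrix (Fin m) (Fin m) ℝ) (h : ℝ → ℝ) (h0 : h 0 ≠ 0) :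
    (A.map fun x => h x - h 0).rank + 1 ≤ ((pad A).map h).rank := by
  set C := (pad A).map h with hC
  set D := A.map fun x => h x - h 0 with hD
  have e1 := LinearMap.finrank_range_add_finrank_ker C.mulVecLin
  have e2 := LinearMap.finrank_range_add_finrank_ker D.mulVecLin
  simp only [Module.finrank_fintype_fun_eq_card, Fintype.card_fin] at e1 e2
  have key : ∀ x : Fin (m + 1) → ℝ, C *ᵥ x = 0 →
      x 0 + ∑ j : Fin m, x j.succ = 0 ∧ D *ᵥ (fun j => x j.succ) = 0 := by
    intro x hx
    have a0 : x 0 + ∑ j : Fin m, x j.succ = 0 := by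
      have := congrFun hx 0
      simp [hC, pad, Matrix.mulVec, dotProduct, Fin.sum_univ_succ] at this
      rw [← Finset.mul_sum, ← mul_add] at this
      exact (mul_eq_zero.1 this).resolve_left h0
    refine ⟨a0, ?_⟩
    funext i
    have := congrFun hx i.succ
    simp [hC, pad, Matrix.mulVec, dotProduct, Fin.sum_univ_succ] at this
    simp [hD, Matrix.mulVec, dotProduct, sub_mul, Finset.sum_sub_distrib, ← Finset.mul_sum]
    linear_combination this - h 0 * a0
  have le : Module.finrank ℝ (LinearMap.ker C.mulVecLin) ≤
      Module.finrank ℝ (LinearMap.ker D.mulVecLin) := by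
    let F : (LinearMap.ker C.mulVecLin) →ₗ[ℝ] (LinearMap.ker D.mulVecLin) :=
      (LinearMap.funLeft ℝ ℝ (Fin.succ : Fin m → Fin (m + 1))).restrict (by
        intro x hx
        exact (key x hx).2)
    apply LinearMap.finrank_le_finrank_of_injective (f := F)
    rw [← LinearMap.ker_eq_bot, LinearMap.ker_eq_bot']
    rintro ⟨x, hx⟩ hF
    have hs : ∀ j : Fin m, x j.succ = 0 := fun j => congrFun (congrArg Subtype.val hF) j
    have a0 := (key x hx).1
    simp [hs] at a0
    ext j
    exact Fin.cases a0 hs j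
  unfold Matrix.rank
  omega

lemma rank_drop {m : ℕ} (B : Matrix (Fin (m + 1)) (Fin (m + 1)) ℝ) (i : Fin (m + 1)) :
    B.rank ≤ (B.submatrix i.succAbove i.succAbove).rank + 2 := by
  let P : Matrix (Fin (m + 1)) (Fin m) ℝ := Matrix.of fun a b => if a = i.succAbove b then 1 else 0
  have : B = P * B.submatrix i.succAbove i.succAbove * Pᵀ
      + (vecMulVec (fun a => B a i) (Pi.single i 1)
      + vecMulVec (Pi.single i 1) (fun b => if b = i then 0 else B i b)) := by
    ext a b
    refine Fin.succAboveCases i ?_ (fun a' => ?_) a <;>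
      refine Fin.succAboveCases i ?_ (fun b' => ?_) b <;>
      simp [P, Matrix.mul_apply, vecMulVec_apply, Fin.succAbove_ne, (Fin.succAbove_ne _ _).symm]
  have r1 : (P * B.submatrix i.succAbove i.succAbove * Pᵀ).rank ≤
    (B.submatrix i.succAbove i.succAbove).rank := 
    (Matrix.rank_mul_le_left _ _).trans (Matrix.rank_mul_le_right _ _)
  have r2 := Matrix.rank_vecMulVec_le (fun a => B a i) (Pi.single i (1:ℝ))
  have r3 := Matrix.rank_vecMulVec_le (Pi.single i (1:ℝ)) (fun b => if b = i then 0 else B i b)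
  calc B.rank = _ := congrArg Matrix.rank this
    _ ≤ _ := (rank_add_le' _ _).trans (Nat.add_le_add r1
      ((rank_add_le' _ _).trans (Nat.add_le_add r2 r3)))

lemma compress {m : ℕ} (B : Matrix (Fin (m + 1)) (Fin (m + 1)) ℝ) (hB : B.IsSymm)
    (v : Fin (m + 1) → ℝ) (hv : B *ᵥ v = 0) (i : Fin (m + 1)) (hi : v i ≠ 0) :
    ∃ T : Matrix (Fin m) (Fin (m + 1)) ℝ,
      B = Tᴴ * B.submatrix i.succAbove i.succAbove * T := by
  let W : Matrix (Fin (m + 1)) (Fin (m + 1)) ℝ := 1 - vecMulVec v (Pi.single i (v i)⁻¹)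
  have hW : ∀ b, W i b = 0 := by
    intro b
    by_cases hb : i = b
    · subst hb; simp [W, vecMulVec_apply, hi]
    · simp [W, vecMulVec_apply, hb, Ne.symm hb]
  have h1 : B * W = B := by
    simp [W, Matrix.mul_sub, Matrix.mul_vecMulVec, hv]
  have h2 : Wᵀ * B = B := by
    have := congrArg Matrix.transpose h1
    rwa [Matrix.transpose_mul, hB.eq] at this
  refine ⟨W.submatrix i.succAbove id, ?_⟩
  have h3 : Wᵀ * B * W = B := by rw [h2, h1]
  conv_lhs => rw [← h3]
  ext a b
  simp [Matrix.mul_apply, Fin.sum_univ_succAbove _ i, hW]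

end RankRed

/-- **Rank reduction.** Let `I = [0,R)` or `(-R,R)` with `0 < R ≤ ∞`, `h : I → ℝ` with
`h(0) ≠ 0`, `n ≥ 2`, `1 ≤ k, l ≤ n`.  With (1): `h[-] : P_n^l(I) → S_n^k`,
(2): `(h - h(0))[-] : P_n^l(I) → S_n^{k-1}`, (3): `(h - h(0))[-] : P_{n-1}^l(I) → S_{n-1}^{k-1}`,
we have (2) ⇒ (1) ⇒ (3), and (1) ⇒ (2) when `k < n-1`.  Moreover if
`h[-] : P_n^l(I) → P_n^k` then `(h - h(0))[-] : P_{n-1}^l(I) → P_{n-1}^{k-1}`, and when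
`k < n-1` also `(h - h(0))[-] : P_n^l(I) → P_n^{k-1}`. -/
theorem rank_reduction_subtracting_constant
    (R : EReal) (hR : 0 < R) (I : Set ℝ)
    (hI : I = {x : ℝ | 0 ≤ x ∧ (x : EReal) < R} ∨
          I = {x : ℝ | -R < (x : EReal) ∧ (x : EReal) < R})
    (h : ℝ → ℝ) (hh0 : h 0 ≠ 0) (n k l : ℕ) (hn : 2 ≤ n)
    (hk1 : 1 ≤ k) (hkn : k ≤ n) (hl1 : 1 ≤ l) (hln : l ≤ n) :
    (((∀ A : Matrix (Fin n) (Fin n) ℝ, A.PosSemidef → A.rank ≤ l → (∀ i j, A i j ∈ I) →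
        (A.map fun x => h x - h 0).IsSymm ∧ (A.map fun x => h x - h 0).rank ≤ k - 1) →
      (∀ A : Matrix (Fin n) (Fin n) ℝ, A.PosSemidef → A.rank ≤ l → (∀ i j, A i j ∈ I) →
        (A.map h).IsSymm ∧ (A.map h).rank ≤ k))) ∧
    (((∀ A : Matrix (Fin n) (Fin n) ℝ, A.PosSemidef → A.rank ≤ l → (∀ i j, A i j ∈ I) →
        (A.map h).IsSymm ∧ (A.map h).rank ≤ k) →
      (∀ A : Matrix (Fin (n - 1)) (Fin (n - 1)) ℝ, A.PosSemidef → A.rank ≤ l →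
        (∀ i j, A i j ∈ I) →
        (A.map fun x => h x - h 0).IsSymm ∧ (A.map fun x => h x - h 0).rank ≤ k - 1))) ∧
    (k < n - 1 →
      ((∀ A : Matrix (Fin n) (Fin n) ℝ, A.PosSemidef → A.rank ≤ l → (∀ i j, A i j ∈ I) →
          (A.map h).IsSymm ∧ (A.map h).rank ≤ k) →
        (∀ A : Matrix (Fin n) (Fin n) ℝ, A.PosSemidef → A.rank ≤ l → (∀ i j, A i j ∈ I) →
          (A.map fun x => h x - h 0).IsSymm ∧ (A.map fun x => h x - h 0).rank ≤ k - 1))) ∧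
    ((∀ A : Matrix (Fin n) (Fin n) ℝ, A.PosSemidef → A.rank ≤ l → (∀ i j, A i j ∈ I) →
        (A.map h).PosSemidef ∧ (A.map h).rank ≤ k) →
      ((∀ A : Matrix (Fin (n - 1)) (Fin (n - 1)) ℝ, A.PosSemidef → A.rank ≤ l →
          (∀ i j, A i j ∈ I) →
          (A.map fun x => h x - h 0).PosSemidef ∧ (A.map fun x => h x - h 0).rank ≤ k - 1) ∧
       (k < n - 1 →
        ∀ A : Matrix (Fin n) (Fin n) ℝ, A.PosSemidef → A.rank ≤ l → (∀ i j, A i j ∈ I) →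
          (A.map fun x => h x - h 0).PosSemidef ∧ (A.map fun x => h x - h 0).rank ≤ k - 1))) := by
  have h0I : (0 : ℝ) ∈ I := by
    rcases hI with rfl | rfl
    · exact ⟨le_refl _, by simpa using hR⟩
    · refine ⟨?_, by simpa using hR⟩
      have := EReal.neg_lt_neg_iff.2 hR
      simpa using this
  obtain ⟨m, rfl⟩ : ∃ m, n = m + 1 := ⟨n - 1, by omega⟩
  simp only [Nat.add_sub_cancel]
  have symm : ∀ (p : ℕ) (A : Matrix (Fin p) (Fin p) ℝ) (g : ℝ → ℝ), A.PosSemidef →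
      (A.map g).IsSymm := by
    intro p A g hA
    have hs : A.IsSymm := by simpa using hA.isHermitian
    exact hs.map g
  -- (1) implies (3), rank part
  have h13 : (∀ A : Matrix (Fin (m + 1)) (Fin (m + 1)) ℝ, A.PosSemidef → A.rank ≤ l →
      (∀ i j, A i j ∈ I) → (A.map h).rank ≤ k) →
      ∀ A : Matrix (Fin m) (Fin m) ℝ, A.PosSemidef → A.rank ≤ l → (∀ i j, A i j ∈ I) →
        (A.map fun x => h x - h 0).rank ≤ k - 1 := by
    intro H A hA hr hm
    have a := H (RankRed.pad A) (RankRed.pad_psd hA) ((RankRed.pad_rank A).trans hr)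
      (RankRed.pad_mem h0I hm)
    have b := RankRed.schur_rank A h hh0
    omega
  have hsub : ∀ (A : Matrix (Fin (m + 1)) (Fin (m + 1)) ℝ) (i : Fin (m + 1)), A.rank ≤ l →
      (A.submatrix i.succAbove i.succAbove).rank ≤ l := by
    intro A i hr
    exact (Matrix.rank_submatrix_le _ _ _).trans hr
  -- compression
  have h12 : k < m → (∀ A : Matrix (Fin (m + 1)) (Fin (m + 1)) ℝ, A.PosSemidef → A.rank ≤ l →
      (∀ i j, A i j ∈ I) → (A.map h).rank ≤ k) →
      ∀ A : Matrix (Fin (m + 1)) (Fin (m + 1)) ℝ, A.PosSemidef → A.rank ≤ l →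
        (∀ i j, A i j ∈ I) → ∃ (i : Fin (m + 1)) (T : Matrix (Fin m) (Fin (m + 1)) ℝ),
        (A.map fun x => h x - h 0) =
          Tᴴ * ((A.submatrix i.succAbove i.succAbove).map fun x => h x - h 0) * T := by
    intro hk H A hA hr hm
    set B := A.map fun x => h x - h 0 with hB
    have b1 := RankRed.rank_drop B 0
    have b2 := h13 H (A.submatrix (Fin.succAbove 0) (Fin.succAbove 0)) (hA.submatrix _)
      (hsub A 0 hr) (fun i j => hm _ _)
    have b3 : (B.submatrix (Fin.succAbove 0) (Fin.succAbove 0)).rank ≤ k - 1 := b2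
    have hdet : B.det = 0 := by
      by_contra hd
      have := Matrix.rank_of_isUnit B ((Matrix.isUnit_iff_isUnit_det B).2 (isUnit_iff_ne_zero.2 hd))
      simp at this
      omega
    obtain ⟨v, hv0, hv⟩ := Matrix.exists_mulVec_eq_zero_iff.2 hdet
    obtain ⟨i, hi⟩ := Function.ne_iff.1 hv0
    obtain ⟨T, hT⟩ := RankRed.compress B (symm _ A _ hA) v hv i hi
    exact ⟨i, T, hT⟩
  refine ⟨?_, ?_, ?_, ?_⟩
  · intro H A hA hr hm
    refine ⟨symm _ A _ hA, ?_⟩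
    have e : A.map h = (A.map fun x => h x - h 0) + vecMulVec (fun _ => h 0) (fun _ => 1) := by
      ext i j; simp [vecMulVec_apply]
    have a := (H A hA hr hm).2
    have b := RankRed.rank_add_le' (A.map fun x => h x - h 0)
      (vecMulVec (fun _ => h 0) (fun _ => 1))
    have c := Matrix.rank_vecMulVec_le (fun _ : Fin (m + 1) => h 0) (fun _ : Fin (m + 1) => (1 : ℝ))
    rw [e]
    omega
  · intro H A hA hr hm
    exact ⟨symm _ A _ hA, h13 (fun A a b c => (H A a b c).2) A hA hr hm⟩
  · intro hk H A hA hr hm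
    have H' := fun A a b c => (H A a b c).2
    refine ⟨symm _ A _ hA, ?_⟩
    obtain ⟨i, T, hT⟩ := h12 hk H' A hA hr hm
    rw [hT]
    exact ((Matrix.rank_mul_le_left _ _).trans (Matrix.rank_mul_le_right _ _)).trans
      (h13 H' _ (hA.submatrix _) (hsub A i hr) (fun _ _ => hm _ _))
  · intro H
    have H' := fun A a b c => (H A a b c).2
    have P : ∀ A : Matrix (Fin m) (Fin m) ℝ, A.PosSemidef → A.rank ≤ l →
        (∀ i j, A i j ∈ I) → (A.map fun x => h x - h 0).PosSemidef := by
      intro A hA hr hm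
      rw [RankRed.dif_eq]
      exact (H (RankRed.pad A) (RankRed.pad_psd hA) ((RankRed.pad_rank A).trans hr)
        (RankRed.pad_mem h0I hm)).1.mul_mul_conjTranspose_same _
    refine ⟨fun A hA hr hm => ⟨P A hA hr hm, h13 H' A hA hr hm⟩, ?_⟩
    intro hk A hA hr hm
    obtain ⟨i, T, hT⟩ := h12 hk H' A hA hr hm
    rw [hT]
    exact ⟨(P _ (hA.submatrix _) (hsub A i hr) (fun _ _ => hm _ _)).conjTranspose_mul_mul_same T,
      ((Matrix.rank_mul_le_left _ _).trans (Matrix.rank_mul_le_right _ _)).trans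
      (h13 H' _ (hA.submatrix _) (hsub A i hr) (fun _ _ => hm _ _))⟩
end

section
/- Let 0 < R ≤ ∞ and f : (0,R) → ℝ. Then the following are equivalent: (1) f is continuous on (0,R) and f[A] ∈ P_n for all A ∈ P_n^1((0,R)) and all n ≥ 1; (2) there exists a (nonnegative) Borel measure μ on ℝ such that for every x ∈ (0,R) the function α ↦ x^α is μ-integrable and f(x) = ∫_ℝ x^α dμ(α). -/
open Matrix Set MeasureTheory

lemma sos_aux (n : ℕ) : ∀ P : Polynomial ℝ, P.natDegree ≤ n → (∀ x, 0 ≤ P.eval x) →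
    ∃ l : List (Polynomial ℝ), P = (l.map (fun q => q ^ 2)).sum ∧
      ∀ q ∈ l, 2 * q.natDegree ≤ P.natDegree := by
  induction n using Nat.strong_induction_on with
  | _ n ih =>
  intro P hPn hP
  obtain ⟨a, ha⟩ := P.exists_forall_norm_le
  have ha' : ∀ y, P.eval a ≤ P.eval y := fun y => by
    have := ha y
    rwa [Real.norm_of_nonneg (hP _), Real.norm_of_nonneg (hP _)] at this
  set m := P.eval a with hm
  have hm0 : 0 ≤ m := hP a
  have hsq : (Polynomial.C (Real.sqrt m)) ^ 2 = Polynomial.C m := by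
    rw [← Polynomial.C_pow, Real.sq_sqrt hm0]
  by_cases hd : P.natDegree = 0
  · refine ⟨[Polynomial.C (Real.sqrt m)], ?_, by simp⟩
    rw [Polynomial.eq_C_of_natDegree_eq_zero hd] at hm ⊢
    simp at hm
    simp only [List.map_cons, List.map_nil, List.sum_cons, List.sum_nil, add_zero]
    rw [hsq, hm]
  have hder : P.derivative.eval a = 0 := by
    have h1 : IsLocalMin (fun y => P.eval y) a := Filter.Eventually.of_forall ha'
    have := h1.deriv_eq_zero
    simpa using this
  have hne : P - Polynomial.C m ≠ 0 := by
    intro h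
    rw [sub_eq_zero] at h
    rw [h] at hd; simp at hd
  obtain ⟨Q, hQ⟩ : (Polynomial.X - Polynomial.C a) ^ 2 ∣ P - Polynomial.C m := by
    rw [← Polynomial.le_rootMultiplicity_iff hne]
    apply Nat.succ_le_of_lt
    rw [Polynomial.one_lt_rootMultiplicity_iff_isRoot hne]
    simp [Polynomial.IsRoot, hder, hm]
  have hQ0 : Q ≠ 0 := by rintro rfl; simp at hQ; exact hne hQ
  have hdeg : P.natDegree = 2 + Q.natDegree := by
    rw [← Polynomial.natDegree_sub_C (a := m), hQ, Polynomial.natDegree_mul (pow_ne_zero _ (Polynomial.X_sub_C_ne_zero a)) hQ0]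
    simp
  have hQe : ∀ x, P.eval x = m + (x - a) ^ 2 * Q.eval x := by
    intro x
    have := congrArg (Polynomial.eval x) hQ
    simp at this
    linarith
  have hQp : ∀ x, x ≠ a → 0 ≤ Q.eval x := by
    intro x hx
    have h1 := hQe x
    have h2 := ha' x
    have h3 : 0 < (x - a) ^ 2 := by have := sub_ne_zero.2 hx; positivity
    by_contra h
    push Not at h
    nlinarith
  have hQp' : ∀ x, 0 ≤ Q.eval x := by
    have hcl : IsClosed {x | 0 ≤ Q.eval x} := isClosed_le continuous_const Q.continuous
    have hde : Dense {x | 0 ≤ Q.eval x} := (dense_compl_singleton a).mono hQp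
    intro x
    have := hde x
    rwa [hcl.closure_eq] at this
  obtain ⟨l, hl, hl2⟩ := ih (Q.natDegree) (by omega) Q le_rfl hQp'
  refine ⟨Polynomial.C (Real.sqrt m) :: l.map (fun q => (Polynomial.X - Polynomial.C a) * q), ?_, ?_⟩
  · simp only [List.map_cons, List.sum_cons, hsq, List.map_map, Function.comp_def, mul_pow, List.sum_map_mul_left]
    rw [← hl, ← hQ]; ring
  · intro q hq
    simp only [List.mem_cons, List.mem_map] at hq
    rcases hq with rfl | ⟨r, hr, rfl⟩
    · simp
    · have := hl2 r hr
      have h3 := Polynomial.natDegree_mul_le (p := Polynomial.X - Polynomial.C a) (q := r)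
      rw [Polynomial.natDegree_X_sub_C] at h3
      omega

lemma functional_nonneg (ℓ : Polynomial ℝ →ₗ[ℝ] ℝ) (N : ℕ)
    (h : ∀ q : Polynomial ℝ, q.natDegree ≤ N → 0 ≤ ℓ (q ^ 2)) (P : Polynomial ℝ)
    (hP : P.natDegree ≤ 2 * N) (hP0 : ∀ x, 0 ≤ P.eval x) : 0 ≤ ℓ P := by
  obtain ⟨l, hl, hl2⟩ := sos_aux _ P le_rfl hP0
  rw [hl, map_list_sum]
  apply List.sum_nonneg
  intro x hx
  simp only [List.mem_map, List.map_map, Function.comp_def] at hx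
  obtain ⟨q, hq, rfl⟩ := hx
  exact h q (by have := hl2 q hq; omega)

lemma psd_apply {I : Set ℝ} {f : ℝ → ℝ}
    (H : ∀ n : ℕ, 1 ≤ n → ∀ A : Matrix (Fin n) (Fin n) ℝ,
        A.PosSemidef → A.rank ≤ 1 → (∀ i j, A i j ∈ I) → (A.map f).PosSemidef)
    (N : ℕ) (u : Fin (N+1) → ℝ) (hu : ∀ i j, u i * u j ∈ I) (c : Fin (N+1) → ℝ) :
    0 ≤ ∑ i, ∑ j, c i * c j * f (u i * u j) := by
  have h := H (N+1) (by omega) (vecMulVec u u)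
    (by simpa using Matrix.posSemidef_vecMulVec_self_star u) (Matrix.rank_vecMulVec_le _ _)
    (by intro i j; exact hu i j)
  have h2 := h.dotProduct_mulVec_nonneg c
  simp only [dotProduct, mulVec, Finset.mul_sum, vecMulVec_apply, map_apply] at h2
  refine h2.trans_eq ?_
  refine Finset.sum_congr rfl fun i _ => Finset.sum_congr rfl fun j _ => ?_
  simp; ring

lemma rank_one_sqrt {n : ℕ} (A : Matrix (Fin n) (Fin n) ℝ) (hA : A.PosSemidef) (hr : A.rank ≤ 1)
    (hp : ∀ i j, 0 < A i j) (i j : Fin n) : A i j = Real.sqrt (A i i) * Real.sqrt (A j j) := by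
  have hs : A j i = A i j := by simpa using hA.1.apply i j
  have hcol : ∀ k, A.col k ∈ LinearMap.range A.mulVecLin := fun k => by
    refine ⟨Pi.single k 1, by simp⟩
  obtain ⟨v, hv⟩ := (finrank_le_one_iff).1 (show Module.finrank ℝ (LinearMap.range A.mulVecLin) ≤ 1 from hr)
  obtain ⟨a, ha⟩ := hv ⟨_, hcol i⟩
  obtain ⟨b, hb⟩ := hv ⟨_, hcol j⟩
  have ha1 : ∀ k, a * v.1 k = A k i := fun k => congrFun (congrArg Subtype.val ha) k
  have hb1 : ∀ k, b * v.1 k = A k j := fun k => congrFun (congrArg Subtype.val hb) k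
  have key : A i j * A i j = A i i * A j j := by
    nth_rewrite 1 [← hs]
    rw [← ha1, ← hb1, ← ha1, ← hb1]; ring
  rw [← Real.sqrt_mul (hp i i).le, ← key, Real.sqrt_mul_self (hp i j).le]

lemma lattice_nonneg {I : Set ℝ} {f : ℝ → ℝ}
    (hdown : ∀ x y, 0 < x → x ≤ y → y ∈ I → x ∈ I)
    (H : ∀ n : ℕ, 1 ≤ n → ∀ A : Matrix (Fin n) (Fin n) ℝ,
        A.PosSemidef → A.rank ≤ 1 → (∀ i j, A i j ∈ I) → (A.map f).PosSemidef)
    (s : Finset ℚ) (c : ℚ → ℝ) (hs : ∀ t ∈ s, Real.exp (t : ℝ) ∈ I)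
    (hc : ∀ α : ℝ, 0 ≤ ∑ t ∈ s, c t * Real.exp (t * α)) :
    0 ≤ ∑ t ∈ s, c t * f (Real.exp (t : ℝ)) := by
  rcases s.eq_empty_or_nonempty with rfl | hne
  · simp
  obtain ⟨N, hN0, k, hk⟩ : ∃ N : ℕ, 0 < N ∧ ∃ k : ℚ → ℤ, ∀ t ∈ s, t * N = k t := by
    refine ⟨∏ t ∈ s, t.den, Finset.prod_pos fun t _ => t.den_pos, ?_⟩
    have : ∀ t : ℚ, ∃ k : ℤ, t ∈ s → t * ((∏ t ∈ s, t.den : ℕ) : ℚ) = k := by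
      intro t
      by_cases ht : t ∈ s
      · obtain ⟨d, hd⟩ := Finset.dvd_prod_of_mem (fun t : ℚ => t.den) ht
        refine ⟨t.num * d, fun _ => ?_⟩
        rw [hd]
        push_cast
        rw [← mul_assoc, Rat.mul_den_eq_num]
      · exact ⟨0, fun h => absurd h ht⟩
    choose k hk using this
    exact ⟨k, hk⟩
  obtain ⟨t1, ht1, hmin⟩ := s.exists_min_image k hne
  set m : ℤ := k t1 - 1 with hm
  obtain ⟨j, hj⟩ : ∃ j : ℚ → ℕ, ∀ t ∈ s, k t = j t + m ∧ 1 ≤ j t :=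
    ⟨fun t => (k t - m).toNat, fun t ht => by have := hmin t ht; dsimp only; omega⟩
  obtain ⟨t2, ht2, hmax⟩ := s.exists_max_image j hne
  have hNr : (0:ℝ) < N := by exact_mod_cast hN0
  have htr : ∀ t ∈ s, (t:ℝ) = (m + j t) / N := by
    intro t ht
    rw [eq_div_iff hNr.ne']
    have h1 := hk t ht
    rw [(hj t ht).1] at h1
    have h2 : ((t * N : ℚ) : ℝ) = ((j t + m : ℤ) : ℚ) := by rw [h1]
    push_cast at h2
    linarith
  set w : ℕ → ℝ := fun i => f (Real.exp ((m + i / 2) / N)) with hw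
  let ℓ : Polynomial ℝ →ₗ[ℝ] ℝ := Polynomial.lsum (fun i => w i • LinearMap.id)
  have hℓ : ∀ i a, ℓ (Polynomial.monomial i a) = a * w i := by
    intro i a
    simp [ℓ, Polynomial.lsum_apply, Polynomial.sum_monomial_index, mul_comm]
  let P : Polynomial ℝ := ∑ t ∈ s, Polynomial.monomial (2 * j t) (c t)
  have hPℓ : ℓ P = ∑ t ∈ s, c t * f (Real.exp (t : ℝ)) := by
    simp only [P, map_sum, hℓ]
    refine Finset.sum_congr rfl fun t ht => ?_
    simp only [hw]
    rw [htr t ht]; push_cast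
    congr 4; ring
  rw [← hPℓ]
  refine functional_nonneg ℓ (j t2) ?_ P ?_ ?_
  · intro q hq
    have hq2 : ℓ (q ^ 2) = ∑ a : Fin (j t2 + 1), ∑ b : Fin (j t2 + 1),
        q.coeff a * q.coeff b * w (a + b) := by
      have h1 := q.as_sum_range' (j t2 + 1) (by omega)
      rw [sq]
      nth_rewrite 1 [h1]
      nth_rewrite 2 [h1]
      simp only [Finset.sum_mul_sum, map_sum, Polynomial.monomial_mul_monomial, hℓ, Finset.sum_range]
    rw [hq2]
    have := psd_apply H (j t2) (fun a => Real.exp ((m / 2 + (a:ℕ) / 2) / N)) ?_ (fun a => q.coeff a)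
    · refine this.trans_eq ?_
      refine Finset.sum_congr rfl fun a _ => Finset.sum_congr rfl fun b _ => ?_
      simp only [hw, ← Real.exp_add]
      congr 3; push_cast; ring
    · intro a b
      rw [← Real.exp_add]
      refine hdown _ _ (Real.exp_pos _) ?_ (hs t2 ht2)
      rw [Real.exp_le_exp, htr t2 ht2, ← add_div]
      have ha : ((a:ℕ):ℝ) ≤ j t2 := by exact_mod_cast Nat.lt_succ_iff.1 a.2
      have hb : ((b:ℕ):ℝ) ≤ j t2 := by exact_mod_cast Nat.lt_succ_iff.1 b.2
      rw [div_le_div_iff_of_pos_right hNr]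
      linarith
  · refine Polynomial.natDegree_sum_le_of_forall_le _ _ fun t ht => ?_
    exact (Polynomial.natDegree_monomial_le _).trans (by have := hmax t ht; omega)
  · intro x
    simp only [P, Polynomial.eval_finsetSum, Polynomial.eval_monomial]
    by_cases hx : x = 0
    · subst hx
      refine (Finset.sum_eq_zero fun t ht => ?_).ge
      rw [zero_pow (by have := (hj t ht).2; omega), mul_zero]
    · have hx2 : 0 < x ^ 2 := by positivity
      have h1 := hc (N * Real.log (x ^ 2))
      have h2 : ∑ t ∈ s, c t * Real.exp (t * (N * Real.log (x ^ 2))) =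
          Real.exp (m * Real.log (x ^ 2)) * ∑ t ∈ s, c t * x ^ (2 * j t) := by
        rw [Finset.mul_sum]
        refine Finset.sum_congr rfl fun t ht => ?_
        have : (t:ℝ) * (N * Real.log (x ^ 2)) = m * Real.log (x^2) + j t * Real.log (x ^ 2) := by
          rw [htr t ht]; field_simp
        rw [this, Real.exp_add, Real.exp_nat_mul, Real.exp_log hx2, pow_mul]; ring
      rw [h2] at h1
      exact nonneg_of_mul_nonneg_right h1 (Real.exp_pos _)

lemma rpow_bound {a y b : ℝ} (ha : 0 < a) (h1 : a ≤ y) (h2 : y ≤ b) (α : ℝ) :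
    y ^ α ≤ a ^ α + b ^ α := by
  have hy : 0 < y := ha.trans_le h1
  have hb : 0 < b := hy.trans_le h2
  rcases le_total 0 α with h | h
  · have := Real.rpow_le_rpow hy.le h2 h
    have := Real.rpow_pos_of_pos ha α
    linarith
  · have := Real.rpow_le_rpow_of_nonpos ha h1 h
    have := Real.rpow_pos_of_pos hb α
    linarith

lemma continuousOn_laplace {I : Set ℝ} (hpos : ∀ x ∈ I, 0 < x)
    (hdown : ∀ x y, 0 < x → x ≤ y → y ∈ I → x ∈ I) (hup : ∀ x ∈ I, ∃ y ∈ I, x < y)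
    (μ : Measure ℝ) (hμ : ∀ x ∈ I, Integrable (fun α : ℝ => x ^ α) μ) :
    ContinuousOn (fun x : ℝ => ∫ α : ℝ, x ^ α ∂μ) I := by
  intro x hx
  apply ContinuousAt.continuousWithinAt
  obtain ⟨b, hb, hxb⟩ := hup x hx
  have hx0 := hpos x hx
  have haI : x / 2 ∈ I := hdown _ _ (by linarith) (by linarith) hx
  have hnear : ∀ᶠ y in nhds x, y ∈ Set.Ioo (x / 2) b := Ioo_mem_nhds (by linarith) hxb
  refine continuousAt_of_dominated (bound := fun α => (x / 2) ^ α + b ^ α) ?_ ?_ ((hμ _ haI).add (hμ _ hb)) ?_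
  · filter_upwards [hnear] with y hy
    exact (hμ y (hdown _ _ (by linarith [hy.1]) hy.2.le hb)).aestronglyMeasurable
  · filter_upwards [hnear] with y hy
    refine Filter.Eventually.of_forall fun α => ?_
    have hy0 : 0 < y := by linarith [hy.1]
    rw [Real.norm_of_nonneg (Real.rpow_pos_of_pos hy0 _).le]
    exact rpow_bound (by linarith) hy.1.le hy.2.le α
  · exact Filter.Eventually.of_forall fun α => Real.continuousAt_rpow_const _ _ (Or.inl hx0.ne')

lemma psd_of_laplace {I : Set ℝ} {f : ℝ → ℝ} (hpos : ∀ x ∈ I, 0 < x)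
    (μ : Measure ℝ) (hμ : ∀ x ∈ I, Integrable (fun α : ℝ => x ^ α) μ)
    (hf : ∀ x ∈ I, f x = ∫ α : ℝ, x ^ α ∂μ) (n : ℕ) (A : Matrix (Fin n) (Fin n) ℝ)
    (hA : A.PosSemidef) (hr : A.rank ≤ 1) (hI : ∀ i j, A i j ∈ I) : (A.map f).PosSemidef := by
  have hs : ∀ i j, A j i = A i j := fun i j => by simpa using hA.1.apply i j
  refine Matrix.PosSemidef.of_dotProduct_mulVec_nonneg ?_ ?_
  · ext i j
    simp [hs i j]
  · intro c
    have h1 : star c ⬝ᵥ (A.map f) *ᵥ c = ∫ α : ℝ, ∑ i, ∑ j, c i * c j * (A i j) ^ α ∂μ := by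
      rw [integral_finsetSum]
      · simp only [dotProduct, mulVec, Finset.mul_sum, map_apply]
        refine Finset.sum_congr rfl fun i _ => ?_
        rw [integral_finsetSum]
        · refine Finset.sum_congr rfl fun j _ => ?_
          rw [integral_const_mul, ← hf _ (hI i j)]
          simp; ring
        · intro j _
          exact (hμ _ (hI i j)).const_mul _
      · intro i _
        exact integrable_finsetSum _ fun j _ => (hμ _ (hI i j)).const_mul _
    rw [h1]
    refine integral_nonneg fun α => ?_
    have h2 : ∑ i, ∑ j, c i * c j * (A i j) ^ α = (∑ i, c i * (Real.sqrt (A i i)) ^ α) ^ 2 := by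
      rw [sq, Finset.sum_mul_sum]
      refine Finset.sum_congr rfl fun i _ => Finset.sum_congr rfl fun j _ => ?_
      rw [rank_one_sqrt A hA hr (fun i j => hpos _ (hI i j)) i j,
        Real.mul_rpow (Real.sqrt_nonneg _) (Real.sqrt_nonneg _)]
      ring
    simp only [Pi.zero_apply]
    rw [h2]; positivity

/-- cutoff function -/
noncomputable def cutoff (n : ℕ) (α : ℝ) : ℝ := max 0 (min 1 (n + 1 - |α|))

lemma cutoff_cont (n : ℕ) : Continuous (cutoff n) := by unfold cutoff; fun_prop
lemma cutoff_nonneg (n : ℕ) (α : ℝ) : 0 ≤ cutoff n α := le_max_left _ _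
lemma cutoff_le_one (n : ℕ) (α : ℝ) : cutoff n α ≤ 1 := max_le zero_le_one (min_le_left _ _)
lemma cutoff_eq_one (n : ℕ) (α : ℝ) (h : |α| ≤ n) : cutoff n α = 1 := by
  unfold cutoff
  rw [min_eq_left (by linarith), max_eq_right zero_le_one]
lemma cutoff_supp (n : ℕ) : HasCompactSupport (cutoff n) := by
  refine HasCompactSupport.intro (isCompact_Icc (a := -((n:ℝ)+1)) (b := n+1)) fun x hx => ?_
  have : (n:ℝ) + 1 < |x| := by
    by_contra h
    push Not at h
    exact hx (abs_le.1 h)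
  unfold cutoff
  exact max_eq_left (min_le_of_right_le (by linarith))
lemma cutoff_mono (α : ℝ) : Monotone (fun n => cutoff n α) := by
  intro m n h
  have : (m:ℝ) ≤ n := by exact_mod_cast h
  unfold cutoff
  dsimp only
  gcongr

/-- the truncated exponential -/
noncomputable def truncExp (t : ℝ) (n : ℕ) : CompactlySupportedContinuousMap ℝ ℝ where
  toFun α := cutoff n α * Real.exp (t * α)
  continuous_toFun := (cutoff_cont n).mul (by fun_prop)
  hasCompactSupport' := (cutoff_supp n).mul_right

lemma truncExp_apply (t : ℝ) (n : ℕ) (α : ℝ) :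
    truncExp t n α = cutoff n α * Real.exp (t * α) := rfl

lemma tail_bound (t δ : ℝ) (hδ : 0 < δ) (n : ℕ) (α : ℝ) :
    Real.exp (t * α) - truncExp t n α ≤
      Real.exp (-(δ * n)) * (Real.exp ((t + δ) * α) + Real.exp ((t - δ) * α)) := by
  rw [truncExp_apply]
  by_cases h : |α| ≤ n
  · rw [cutoff_eq_one n α h, one_mul, sub_self]; positivity
  · push Not at h
    have h0 : 0 ≤ cutoff n α * Real.exp (t * α) := mul_nonneg (cutoff_nonneg _ _) (Real.exp_pos _).le
    have h1 : Real.exp (t * α) ≤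
        Real.exp (-(δ * n)) * (Real.exp ((t + δ) * α) + Real.exp ((t - δ) * α)) := by
      rw [mul_add, ← Real.exp_add, ← Real.exp_add]
      rcases le_total 0 α with ha | ha
      · rw [abs_of_nonneg ha] at h
        have : Real.exp (t * α) ≤ Real.exp (-(δ * n) + (t + δ) * α) := by
          rw [Real.exp_le_exp]; nlinarith
        have := Real.exp_pos (-(δ * n) + (t - δ) * α)
        linarith
      · rw [abs_of_nonpos ha] at h
        have : Real.exp (t * α) ≤ Real.exp (-(δ * n) + (t - δ) * α) := by
          rw [Real.exp_le_exp]; nlinarith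
        have := Real.exp_pos (-(δ * n) + (t + δ) * α)
        linarith
    linarith

lemma exists_functional {T : Type} (e : T → ℝ → ℝ) (g : T → ℝ)
    (hpos : ∀ c : T →₀ ℝ, (∀ α, 0 ≤ c.sum fun t a => a * e t α) → 0 ≤ c.sum fun t a => a * g t)
    (t0 : T) (he : Continuous (e t0)) (he0 : ∀ α, 0 < e t0 α) :
    ∃ G : ((T →₀ ℝ) × CompactlySupportedContinuousMap ℝ ℝ) →ₗ[ℝ] ℝ,
      (∀ t a, G (Finsupp.single t a, 0) = a * g t) ∧
      ∀ c φ, (∀ α, 0 ≤ (c.sum fun t a => a * e t α) + φ α) → 0 ≤ G (c, φ) := by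
  let ev : (T →₀ ℝ) →ₗ[ℝ] (ℝ → ℝ) := Finsupp.linearCombination ℝ e
  let L : (T →₀ ℝ) →ₗ[ℝ] ℝ := Finsupp.linearCombination ℝ g
  have hev : ∀ c α, ev c α = c.sum fun t a => a * e t α := by
    intro c α
    simp [ev, Finsupp.linearCombination_apply, Finsupp.sum, Finset.sum_apply]
  have hL : ∀ c, L c = c.sum fun t a => a * g t := by
    intro c
    simp [L, Finsupp.linearCombination_apply, Finsupp.sum]
  let s : PointedCone ℝ ((T →₀ ℝ) × CompactlySupportedContinuousMap ℝ ℝ) :=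
    { carrier := {p | ∀ α, 0 ≤ ev p.1 α + p.2 α}
      zero_mem' := by intro α; simp
      add_mem' := by
        intro p q hp hq α
        have h1 := hp α
        have h2 := hq α
        simp only [Prod.fst_add, Prod.snd_add, map_add, Pi.add_apply,
          CompactlySupportedContinuousMap.coe_add]
        linarith
      smul_mem' := by
        intro a p hp α
        have h1 := mul_nonneg a.2 (hp α)
        have h2 : ev (a • p).1 α + (a • p).2 α = (a:ℝ) * (ev p.1 α + p.2 α) := by
          have : a • p = (a:ℝ) • p := rfl
          rw [this, Prod.smul_fst, Prod.smul_snd, map_smul, mul_add]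
          rfl
        rw [h2]; exact h1 }
  have hs : ∀ p, p ∈ s ↔ ∀ α, 0 ≤ ev p.1 α + p.2 α := fun p => Iff.rfl
  let dom : Submodule ℝ ((T →₀ ℝ) × CompactlySupportedContinuousMap ℝ ℝ) := Submodule.prod ⊤ ⊥
  let F : ((T →₀ ℝ) × CompactlySupportedContinuousMap ℝ ℝ) →ₗ.[ℝ] ℝ :=
    ⟨dom, (L ∘ₗ LinearMap.fst ℝ _ _).domRestrict dom⟩
  have hnonneg : ∀ x : F.domain, (x : (T →₀ ℝ) × CompactlySupportedContinuousMap ℝ ℝ) ∈ s → 0 ≤ F x := by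
    rintro ⟨⟨c, φ⟩, hx⟩ hmem
    have hφ : φ = 0 := by simpa [F, dom] using hx
    subst hφ
    change 0 ≤ L c
    rw [hL]
    apply hpos
    intro α
    have := (hs _).1 hmem α
    rw [hev] at this
    simpa using this
  have hdense : ∀ y, ∃ x : F.domain, (x : (T →₀ ℝ) × CompactlySupportedContinuousMap ℝ ℝ) + y ∈ s := by
    rintro ⟨c, φ⟩
    obtain ⟨C, hC⟩ : ∃ C, ∀ α, ‖φ α / e t0 α‖ ≤ C := by
      refine HasCompactSupport.exists_bound_of_continuous (f := fun α => φ α / e t0 α) ?_ ?_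
      · simp only [div_eq_mul_inv]
        exact φ.hasCompactSupport.mul_right
      · exact φ.continuous.div he fun α => (he0 α).ne'
    refine ⟨⟨(Finsupp.single t0 C - c, 0), by simp [F, dom]⟩, (hs _).2 fun α => ?_⟩
    have h1 := neg_le_of_abs_le (hC α)
    rw [le_div_iff₀ (he0 α)] at h1
    have h2 : ev (Finsupp.single t0 C) α = C * e t0 α := by rw [hev]; simp
    simp only [Prod.mk_add_mk, sub_add_cancel, zero_add, h2]
    linarith
  obtain ⟨G, hG1, hG2⟩ := riesz_extension s F hnonneg hdense
  refine ⟨G, ?_, ?_⟩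
  · intro t a
    have := hG1 ⟨(Finsupp.single t a, 0), by simp [F, dom]⟩
    refine this.trans ?_
    change L (Finsupp.single t a) = _
    rw [hL]; simp
  · intro c φ h
    refine hG2 _ ((hs _).2 fun α => ?_)
    rw [hev]; exact h α

lemma exists_measure {I : Set ℝ} {f : ℝ → ℝ} (hne : ∃ q : ℚ, Real.exp (q:ℝ) ∈ I)
    (hdown : ∀ x y, 0 < x → x ≤ y → y ∈ I → x ∈ I) (hup : ∀ x ∈ I, ∃ y ∈ I, x < y)
    (H : ∀ n : ℕ, 1 ≤ n → ∀ A : Matrix (Fin n) (Fin n) ℝ,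
        A.PosSemidef → A.rank ≤ 1 → (∀ i j, A i j ∈ I) → (A.map f).PosSemidef) :
    ∃ μ : Measure ℝ, ∀ q : ℚ, Real.exp (q:ℝ) ∈ I →
      Integrable (fun α : ℝ => Real.exp (q * α)) μ ∧
      ∫ α : ℝ, Real.exp (q * α) ∂μ = f (Real.exp (q:ℝ)) := by
  obtain ⟨q0, hq0⟩ := hne
  let T := {q : ℚ // Real.exp (q:ℝ) ∈ I}
  obtain ⟨G, hG1, hG2⟩ := exists_functional (T := T) (fun t α => Real.exp ((t.1:ℝ) * α))
    (fun t => f (Real.exp (t.1:ℝ))) (by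
      intro c hc
      classical
      have := lattice_nonneg hdown H (c.support.map (Function.Embedding.subtype _))
        (fun q => if h : Real.exp (q:ℝ) ∈ I then c ⟨q, h⟩ else 0) (by
          intro t ht
          simp only [Finset.mem_map] at ht
          obtain ⟨a, _, rfl⟩ := ht
          exact a.2) (by
          intro α
          rw [Finset.sum_map]
          refine (hc α).trans_eq (Finset.sum_congr rfl fun t _ => ?_)
          have := t.2
          simp [this])
      refine this.trans_eq ?_
      rw [Finset.sum_map]
      refine Finset.sum_congr rfl fun t _ => ?_
      have := t.2
      simp [this]) ⟨q0, hq0⟩ (by fun_prop) (fun α => Real.exp_pos _)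
  let Λ : CompactlySupportedContinuousMap ℝ ℝ →ₚ[ℝ] ℝ :=
    PositiveLinearMap.mk₀ (G ∘ₗ LinearMap.inr ℝ _ _) (by
      intro φ hφ
      refine hG2 0 φ fun α => ?_
      simpa using hφ α)
  have hΛ : ∀ φ, Λ φ = G (0, φ) := fun φ => rfl
  have hGs : ∀ c φ, G (c, φ) = G (c, 0) + Λ φ := by
    intro c φ
    rw [hΛ, ← map_add]; simp
  let μ := RealRMK.rieszMeasure Λ
  refine ⟨μ, fun q hq => ?_⟩
  have hint : ∀ φ : CompactlySupportedContinuousMap ℝ ℝ, ∫ α, φ α ∂μ = Λ φ :=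
    fun φ => RealRMK.integral_rieszMeasure Λ φ
  -- a rational to the right
  obtain ⟨y, hy, hqy⟩ := hup _ hq
  have hy0 : 0 < y := (Real.exp_pos _).trans hqy
  obtain ⟨q', hq1, hq2⟩ := exists_rat_btwn ((Real.lt_log_iff_exp_lt hy0).2 hqy)
  have hq'I : Real.exp (q':ℝ) ∈ I :=
    hdown _ _ (Real.exp_pos _) ((Real.lt_log_iff_exp_lt hy0).1 hq2).le hy
  let q'' : ℚ := q - (q' - q)
  have hq''r : (q'':ℝ) = q - (q' - q) := by simp [q'']
  have hq''I : Real.exp (q'':ℝ) ∈ I :=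
    hdown _ _ (Real.exp_pos _) (Real.exp_le_exp.2 (by rw [hq''r]; linarith)) hq
  set δ : ℝ := q' - q with hδ
  have hδ0 : 0 < δ := by rw [hδ]; linarith
  set g : ℝ := f (Real.exp (q:ℝ))
  set B : ℝ := f (Real.exp (q':ℝ)) + f (Real.exp (q'':ℝ)) with hB
  have hub : ∀ n, Λ (truncExp q n) ≤ g := by
    intro n
    have := hG2 (Finsupp.single ⟨q, hq⟩ 1) (-truncExp q n) (by
      intro α
      simp only [Finsupp.sum_single_index, zero_mul, one_mul,
        CompactlySupportedContinuousMap.coe_neg, Pi.neg_apply, truncExp_apply]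
      have h1 := cutoff_le_one n α
      have h2 := Real.exp_pos ((q:ℝ) * α)
      nlinarith)
    rw [hGs, hG1, map_neg] at this
    linarith
  have hlb : ∀ n : ℕ, g - Real.exp (-(δ * n)) * B ≤ Λ (truncExp q n) := by
    intro n
    have := hG2 (Finsupp.single ⟨q', hq'I⟩ (Real.exp (-(δ * n))) +
      Finsupp.single ⟨q'', hq''I⟩ (Real.exp (-(δ * n))) + Finsupp.single ⟨q, hq⟩ (-1)) (truncExp q n) (by
      intro α
      rw [Finsupp.sum_add_index' (by simp) (by intros; ring),
        Finsupp.sum_add_index' (by simp) (by intros; ring),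
        Finsupp.sum_single_index (by simp), Finsupp.sum_single_index (by simp),
        Finsupp.sum_single_index (by simp)]
      have := tail_bound q δ hδ0 n α
      have e1 : (q:ℝ) + δ = q' := by rw [hδ]; ring
      rw [e1, ← hq''r] at this
      dsimp only
      linarith)
    rw [hGs] at this
    have h3 : ∀ c d : T →₀ ℝ, G (c + d, 0) = G (c, 0) + G (d, 0) := by
      intro c d; rw [← map_add]; simp
    rw [h3, h3, hG1, hG1, hG1] at this
    rw [hB]
    linarith
  have hlim : Filter.Tendsto (fun n => Λ (truncExp q n)) Filter.atTop (nhds g) := by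
    refine tendsto_of_tendsto_of_tendsto_of_le_of_le ?_ tendsto_const_nhds hlb hub
    have h1 : Filter.Tendsto (fun n : ℕ => Real.exp (-(δ * n))) Filter.atTop (nhds 0) := by
      refine Real.tendsto_exp_neg_atTop_nhds_zero.comp ?_
      exact Filter.Tendsto.const_mul_atTop hδ0 tendsto_natCast_atTop_atTop
    have := (tendsto_const_nhds (x := g)).sub (h1.mul_const B)
    simpa using this
  have hmono : ∀ α, Monotone fun n => truncExp q n α := by
    intro α m n h
    simp only [truncExp_apply]
    exact mul_le_mul_of_nonneg_right (cutoff_mono α h) (Real.exp_pos _).le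
  have hnn : ∀ n α, 0 ≤ truncExp q n α := fun n α =>
    mul_nonneg (cutoff_nonneg _ _) (Real.exp_pos _).le
  have hptw : ∀ α, Filter.Tendsto (fun n => truncExp q n α) Filter.atTop (nhds (Real.exp (q * α))) := by
    intro α
    refine tendsto_const_nhds.congr' ?_
    obtain ⟨N, hN⟩ := exists_nat_ge |α|
    filter_upwards [Filter.eventually_ge_atTop N] with n hn
    rw [truncExp_apply, cutoff_eq_one n α (hN.trans (by exact_mod_cast hn)), one_mul]
  have hg0 : 0 ≤ g := by
    refine ge_of_tendsto' hlim fun n => ?_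
    rw [← hint]
    exact integral_nonneg (hnn n)
  have hl1 : Filter.Tendsto (fun n => ∫⁻ α, ENNReal.ofReal (truncExp q n α) ∂μ) Filter.atTop
      (nhds (∫⁻ α, ENNReal.ofReal (Real.exp (q * α)) ∂μ)) := by
    refine lintegral_tendsto_of_tendsto_of_monotone ?_ ?_ ?_
    · intro n
      exact ((truncExp q n).continuous.measurable.ennreal_ofReal).aemeasurable
    · exact Filter.Eventually.of_forall fun α m n h => ENNReal.ofReal_le_ofReal (hmono α h)
    · exact Filter.Eventually.of_forall fun α => (ENNReal.continuous_ofReal.tendsto _).comp (hptw α)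
  have hl2 : ∀ n, ∫⁻ α, ENNReal.ofReal (truncExp q n α) ∂μ = ENNReal.ofReal (Λ (truncExp q n)) := by
    intro n
    rw [← hint, ofReal_integral_eq_lintegral_ofReal]
    · exact (truncExp q n).continuous.integrable_of_hasCompactSupport (truncExp q n).hasCompactSupport
    · exact Filter.Eventually.of_forall (hnn n)
  simp only [hl2] at hl1
  have hl3 := tendsto_nhds_unique hl1 ((ENNReal.continuous_ofReal.tendsto _).comp hlim)
  have hmeas : AEStronglyMeasurable (fun α : ℝ => Real.exp (q * α)) μ :=
    (by fun_prop : Continuous fun α : ℝ => Real.exp (q * α)).aestronglyMeasurable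
  have hpos : 0 ≤ᵐ[μ] fun α : ℝ => Real.exp (q * α) :=
    Filter.Eventually.of_forall fun α => (Real.exp_pos _).le
  constructor
  · refine ⟨hmeas, ?_⟩
    rw [hasFiniteIntegral_iff_ofReal hpos, hl3]
    exact ENNReal.ofReal_lt_top
  · rw [integral_eq_lintegral_of_nonneg_ae hpos hmeas, hl3, ENNReal.toReal_ofReal hg0]

/-- **Rank one preservers and the Laplace transform.** Let `0 < R ≤ ∞` and
`f : (0,R) → ℝ`.  Then `f` is continuous on `(0,R)` and `f[A]` is positive semidefinite
for all rank-one positive semidefinite `A` of any size with entries in `(0,R)` iff there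
exists a nonnegative Borel measure `μ` on `ℝ` such that `α ↦ x^α` is `μ`-integrable
and `f(x) = ∫ x^α dμ(α)` for every `x ∈ (0,R)`. -/
theorem rank_one_preservers_laplace
    (R : EReal) (hR : 0 < R) (I : Set ℝ)
    (hI : I = {x : ℝ | 0 < x ∧ (x : EReal) < R}) (f : ℝ → ℝ) :
    (ContinuousOn f I ∧ ∀ n : ℕ, 1 ≤ n → ∀ A : Matrix (Fin n) (Fin n) ℝ,
        A.PosSemidef → A.rank ≤ 1 → (∀ i j, A i j ∈ I) → (A.map f).PosSemidef) ↔
    (∃ μ : Measure ℝ, (∀ x ∈ I, Integrable (fun α : ℝ => x ^ α) μ) ∧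
      ∀ x ∈ I, f x = ∫ α : ℝ, x ^ α ∂μ) := by
  have hpos : ∀ x ∈ I, 0 < x := by
    intro x hx; rw [hI] at hx; exact hx.1
  have hdown : ∀ x y, 0 < x → x ≤ y → y ∈ I → x ∈ I := by
    intro x y hx hxy hy
    rw [hI] at hy ⊢
    exact ⟨hx, (EReal.coe_le_coe_iff.2 hxy).trans_lt hy.2⟩
  have hup : ∀ x ∈ I, ∃ y ∈ I, x < y := by
    intro x hx
    rw [hI] at hx ⊢
    obtain ⟨y, hy1, hy2⟩ := EReal.lt_iff_exists_real_btwn.1 hx.2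
    have := EReal.coe_lt_coe_iff.1 hy1
    exact ⟨y, ⟨hx.1.trans this, hy2⟩, this⟩
  constructor
  · rintro ⟨hf, H⟩
    have hne : ∃ q : ℚ, Real.exp (q:ℝ) ∈ I := by
      obtain ⟨y, hy1, hy2⟩ := EReal.lt_iff_exists_real_btwn.1 hR
      have hy0 : 0 < y := by exact_mod_cast hy1
      obtain ⟨q, hq⟩ := exists_rat_lt (Real.log y)
      refine ⟨q, hdown _ y (Real.exp_pos _) ((Real.lt_log_iff_exp_lt hy0).1 hq).le ?_⟩
      rw [hI]; exact ⟨hy0, hy2⟩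
    obtain ⟨μ, hμ⟩ := exists_measure hne hdown hup H
    have hexp : ∀ (q : ℚ) (α : ℝ), (Real.exp (q:ℝ)) ^ α = Real.exp (q * α) := by
      intro q α; rw [← Real.exp_mul]
    have hbt : ∀ x y : ℝ, 0 < x → x < y → ∃ q : ℚ, x < Real.exp (q:ℝ) ∧ Real.exp (q:ℝ) < y := by
      intro x y hx hxy
      obtain ⟨q, h1, h2⟩ := exists_rat_btwn (Real.log_lt_log hx hxy)
      exact ⟨q, (Real.log_lt_iff_lt_exp hx).1 h1, (Real.lt_log_iff_exp_lt (hx.trans hxy)).1 h2⟩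
    have hint : ∀ x ∈ I, Integrable (fun α : ℝ => x ^ α) μ := by
      intro x hx
      have hx0 := hpos x hx
      obtain ⟨y, hy, hxy⟩ := hup x hx
      obtain ⟨q1, h1, h1'⟩ := hbt (x / 2) x (by linarith) (by linarith)
      obtain ⟨q2, h2, h2'⟩ := hbt x y hx0 hxy
      have i1 := (hμ q1 (hdown _ _ (Real.exp_pos _) h1'.le hx)).1
      have i2 := (hμ q2 (hdown _ _ (Real.exp_pos _) h2'.le hy)).1
      refine (i1.add i2).mono' ?_ (Filter.Eventually.of_forall fun α => ?_)
      · exact (Real.continuous_const_rpow hx0.ne').aestronglyMeasurable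
      · rw [Real.norm_of_nonneg (Real.rpow_pos_of_pos hx0 _).le]
        simp only [Pi.add_apply]
        rw [← hexp, ← hexp]
        exact rpow_bound (Real.exp_pos _) h1'.le h2.le α
    refine ⟨μ, hint, ?_⟩
    have hEq : EqOn f (fun x : ℝ => ∫ α : ℝ, x ^ α ∂μ) {x | x ∈ I ∧ ∃ q : ℚ, x = Real.exp (q:ℝ)} := by
      rintro x ⟨hx, q, rfl⟩
      simp only [hexp]
      exact (hμ q hx).2.symm
    refine hEq.of_subset_closure hf (continuousOn_laplace hpos hdown hup μ hint) (fun x hx => hx.1) ?_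
    intro x hx
    rw [Metric.mem_closure_iff]
    intro ε hε
    have hx0 := hpos x hx
    obtain ⟨q, h1, h2⟩ := hbt (max (x / 2) (x - ε)) x (lt_max_of_lt_left (by linarith))
      (max_lt (by linarith) (by linarith))
    refine ⟨_, ⟨hdown _ _ (Real.exp_pos _) h2.le hx, q, rfl⟩, ?_⟩
    rw [Real.dist_eq, abs_of_pos (by linarith)]
    have := (le_max_right (x/2) (x - ε)).trans_lt h1
    linarith
  · rintro ⟨μ, hμ, hf⟩
    refine ⟨(continuousOn_laplace hpos hdown hup μ hμ).congr hf, fun n _ A hA hr hAI => ?_⟩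
    exact psd_of_laplace hpos μ hμ hf n A hA hr hAI
end

section
/- Let 0 < R ≤ ∞, let I = (0,R), and let f : I → ℝ. Fix an integer n ≥ 3, and suppose that f[a·1_{n×n} + u uᵀ] ∈ P_n for every a ∈ [0,R) and every u ∈ [0, √(R−a))^n. Then f is (n−3) times continuously differentiable on I, the k-th derivative f^{(k)}(x) ≥ 0 for all x ∈ I and all 0 ≤ k ≤ n−3, and f^{(n−3)} is convex and nondecreasing on I. In particular, if in addition f is (n−1) times continuously differentiable on I, then f^{(k)}(x) ≥ 0 for all x ∈ I and all 0 ≤ k ≤ n−1. -/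
open Matrix Set

/-- Signed binomial weights. -/
noncomputable def hlW (k i : ℕ) : ℝ := (-1 : ℝ) ^ (k - i) * (k.choose i : ℝ)

/-- The quadratic form of `f[a + t (ij)]` at the binomial weights. -/
noncomputable def hlV (k : ℕ) (f : ℝ → ℝ) (a t : ℝ) : ℝ :=
  ∑ i ∈ Finset.range (k + 1), ∑ j ∈ Finset.range (k + 1),
    hlW k i * hlW k j * f (a + t * i * j)

/-- The linear inequalities extracted from the hypothesis. -/
def hlE (N : ℕ) (S : Set ℝ) (f : ℝ → ℝ) : Prop :=
  ∀ k ≤ N, ∀ a t : ℝ, a ∈ S → 0 < t → a + t * k * k ∈ S → 0 ≤ hlV k f a t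

/-- All mixed differences up to order `p` are nonnegative. -/
def hlD : ℕ → Set ℝ → (ℝ → ℝ) → Prop
  | 0, S, f => ∀ x ∈ S, 0 ≤ f x
  | p + 1, S, f => (∀ x ∈ S, 0 ≤ f x) ∧
      ∀ h > 0, hlD p (S ∩ {x | x + h ∈ S}) (fun x => f (x + h) - f x)

lemma hlW_moment (k m : ℕ) :
    ∑ i ∈ Finset.range (k + 1), hlW k i * (i : ℝ) ^ m
      = (fwdDiff (1 : ℝ))^[k] (fun x : ℝ => x ^ m) 0 := by
  rw [fwdDiff_iter_eq_sum_shift]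
  apply Finset.sum_congr rfl
  intro i _
  simp [hlW]

lemma hlW_moment_lt {k m : ℕ} (h : m < k) :
    ∑ i ∈ Finset.range (k + 1), hlW k i * (i : ℝ) ^ m = 0 := by
  rw [hlW_moment, fwdDiff_iter_pow_eq_zero_of_lt h]; rfl

lemma hlW_moment_eq (k : ℕ) :
    ∑ i ∈ Finset.range (k + 1), hlW k i * (i : ℝ) ^ k = (k.factorial : ℝ) := by
  rw [hlW_moment, fwdDiff_iter_eq_factorial]; rfl

lemma hlV_pow (k m : ℕ) (t : ℝ) :
    ∑ i ∈ Finset.range (k + 1), ∑ j ∈ Finset.range (k + 1),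
      hlW k i * hlW k j * (t * i * j) ^ m
      = t ^ m * (∑ i ∈ Finset.range (k + 1), hlW k i * (i : ℝ) ^ m) ^ 2 := by
  rw [sq, Finset.sum_mul_sum, Finset.mul_sum]
  apply Finset.sum_congr rfl
  intro i _
  rw [Finset.mul_sum]
  apply Finset.sum_congr rfl
  intro j _
  ring

lemma hlE_of_map (R : EReal) (f : ℝ → ℝ) (n : ℕ) (hn : 1 ≤ n)
    (hmap : ∀ a : ℝ, 0 ≤ a → (a : EReal) < R → ∀ u : Fin n → ℝ,
      (∀ i, 0 ≤ u i ∧ ((a + u i * u i : ℝ) : EReal) < R) →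
      (Matrix.of fun i j => f (a + u i * u j)).PosSemidef) :
    hlE (n - 1) {x : ℝ | 0 < x ∧ (x : EReal) < R} f := by
  intro k hk a t ha ht hat
  have hkn : k + 1 ≤ n := by omega
  have key := hmap a ha.1.le ha.2
    (fun i => if (i : ℕ) ≤ k then Real.sqrt t * (i : ℕ) else 0) (by
      intro i
      constructor
      · split_ifs <;> positivity
      · refine lt_of_le_of_lt ?_ hat.2
        rw [EReal.coe_le_coe_iff]
        have hs : Real.sqrt t * Real.sqrt t = t := Real.mul_self_sqrt ht.le
        split_ifs with h
        · have h' : ((i : ℕ) : ℝ) ≤ k := by exact_mod_cast h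
          have h0 : (0 : ℝ) ≤ ((i : ℕ) : ℝ) := by positivity
          have : Real.sqrt t * ((i : ℕ) : ℝ) * (Real.sqrt t * ((i : ℕ) : ℝ))
              = t * (((i : ℕ) : ℝ) * ((i : ℕ) : ℝ)) := by
            rw [← hs]; ring_nf
            rw [Real.sqrt_sq (Real.sqrt_nonneg _)]
          rw [this, mul_assoc t]
          gcongr
        · have : 0 ≤ t * k * k := by positivity
          simpa using this)
  have h2 := key.dotProduct_mulVec_nonneg (fun i => hlW k (i : ℕ))
  have hs : Real.sqrt t * Real.sqrt t = t := Real.mul_self_sqrt ht.le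
  have h3 : hlV k f a t = ∑ i : Fin n, ∑ j : Fin n, hlW k i * hlW k j *
      f (a + (if (i : ℕ) ≤ k then Real.sqrt t * (i : ℕ) else 0) *
        (if (j : ℕ) ≤ k then Real.sqrt t * (j : ℕ) else 0)) := by
    rw [Fin.sum_univ_eq_sum_range (fun i => ∑ j : Fin n, hlW k i * hlW k j *
      f (a + (if (i : ℕ) ≤ k then Real.sqrt t * (i : ℕ) else 0) *
        (if (j : ℕ) ≤ k then Real.sqrt t * (j : ℕ) else 0))) n]
    have hsub : Finset.range (k + 1) ⊆ Finset.range n := Finset.range_subset_range.2 hkn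
    have hz : ∀ i, i ∉ Finset.range (k + 1) → hlW k i = 0 := by
      intro i hi
      have : k < i := by simpa using hi
      simp [hlW, Nat.choose_eq_zero_of_lt this]
    rw [hlV, ← Finset.sum_subset hsub]
    · apply Finset.sum_congr rfl
      intro i hi
      rw [Fin.sum_univ_eq_sum_range (fun j => hlW k i * hlW k j *
      f (a + (if (i : ℕ) ≤ k then Real.sqrt t * (i : ℕ) else 0) *
        (if (j : ℕ) ≤ k then Real.sqrt t * (j : ℕ) else 0))) n, ← Finset.sum_subset hsub]
      · apply Finset.sum_congr rfl
        intro j hj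
        rw [if_pos (by simpa [Nat.lt_succ_iff] using hi),
          if_pos (by simpa [Nat.lt_succ_iff] using hj)]
        congr 3
        nth_rw 1 [← hs]; ring
      · intro j _ hj
        simp [hz j hj]
    · intro i _ hi
      simp [hz i hi]
  rw [h3]
  refine h2.trans_eq ?_
  simp only [dotProduct, mulVec, Matrix.of_apply, Finset.mul_sum, star_trivial]
  refine Finset.sum_congr rfl fun i _ => Finset.sum_congr rfl fun j _ => ?_
  ring

open Topology Filter Asymptotics in
lemma hlE_deriv {N : ℕ} {S : Set ℝ} {F : ℝ → ℝ} (hS : IsOpen S) (hc : S.OrdConnected)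
    (hE : hlE N S F) {k : ℕ} (hk : k ≤ N) (hF : ContDiffOn ℝ k F S) {x : ℝ} (hx : x ∈ S) :
    0 ≤ iteratedDeriv k F x := by
  rw [← iteratedDerivWithin_of_isOpen hS hx]
  set c := iteratedDerivWithin k F S x with hcdef
  have hT := taylor_isLittleO hc.convex hx hF
  rw [hS.nhdsWithin_eq hx] at hT
  set r : ℝ → ℝ := fun y => F y - taylorWithinEval F k S x y with hr
  have htend : ∀ p : ℝ, Tendsto (fun t : ℝ => x + t * p) (𝓝[>] 0) (𝓝 x) := by
    intro p
    have : Tendsto (fun t : ℝ => x + t * p) (𝓝 0) (𝓝 (x + 0 * p)) :=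
      (Continuous.tendsto (by fun_prop) 0)
    simp only [zero_mul, add_zero] at this
    exact this.mono_left nhdsWithin_le_nhds
  have hro : (fun t : ℝ => hlV k r x t) =o[𝓝[>] 0] (fun t => t ^ k) := by
    unfold hlV
    refine IsLittleO.fun_sum ?_
    intro i _
    refine IsLittleO.fun_sum ?_
    intro j _
    refine IsLittleO.const_mul_left ?_ _
    have h1 := hT.comp_tendsto (htend (i * j))
    simp only [Function.comp_def, add_sub_cancel_left, mul_pow] at h1
    simp only [mul_assoc]
    refine h1.trans_isBigO ?_
    have := isBigO_const_mul_self (((i : ℝ) ^ k * (j : ℝ) ^ k)) (fun t : ℝ => t ^ k) (𝓝[>] 0)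
    refine this.congr_left fun t => ?_
    ring
  have hV : ∀ t : ℝ, hlV k F x t = hlV k r x t + t ^ k * (k.factorial * c) := by
    intro t
    have : ∀ y, F y = r y + taylorWithinEval F k S x y := by intro y; simp [hr]
    have h2 : hlV k (fun y => taylorWithinEval F k S x y) x t = t ^ k * (k.factorial * c) := by
      unfold hlV
      simp only [taylor_within_apply, add_sub_cancel_left, smul_eq_mul, Finset.mul_sum]
      have e1 : ∀ i ∈ Finset.range (k + 1), (∑ j ∈ Finset.range (k + 1),
          ∑ m ∈ Finset.range (k + 1), hlW k i * hlW k j *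
            (((m.factorial : ℝ))⁻¹ * (t * i * j) ^ m * iteratedDerivWithin m F S x))
          = ∑ m ∈ Finset.range (k + 1), ∑ j ∈ Finset.range (k + 1), hlW k i * hlW k j *
            (((m.factorial : ℝ))⁻¹ * (t * i * j) ^ m * iteratedDerivWithin m F S x) :=
        fun i _ => Finset.sum_comm
      rw [Finset.sum_congr rfl e1, Finset.sum_comm]
      have e2 : ∀ m, (∑ i ∈ Finset.range (k + 1), ∑ j ∈ Finset.range (k + 1),
          hlW k i * hlW k j *
            (((m.factorial : ℝ))⁻¹ * (t * i * j) ^ m * iteratedDerivWithin m F S x))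
          = ((m.factorial : ℝ))⁻¹ * iteratedDerivWithin m F S x *
            (t ^ m * (∑ i ∈ Finset.range (k + 1), hlW k i * (i : ℝ) ^ m) ^ 2) := by
        intro m
        rw [← hlV_pow, Finset.mul_sum]
        refine Finset.sum_congr rfl fun i _ => ?_
        rw [Finset.mul_sum]
        refine Finset.sum_congr rfl fun j _ => ?_
        ring
      simp only [e2]
      rw [Finset.sum_range_succ, Finset.sum_eq_zero, hlW_moment_eq, ← hcdef]
      · have : (k.factorial : ℝ) ≠ 0 := by positivity
        field_simp
        ring
      · intro m hm
        rw [hlW_moment_lt (Finset.mem_range.1 hm)]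
        simp
    rw [← h2]
    unfold hlV
    rw [← Finset.sum_add_distrib]
    refine Finset.sum_congr rfl fun i _ => ?_
    rw [← Finset.sum_add_distrib]
    refine Finset.sum_congr rfl fun j _ => ?_
    rw [← mul_add, ← this]
  have hlim : Tendsto (fun t : ℝ => hlV k r x t / t ^ k + k.factorial * c) (𝓝[>] 0)
      (𝓝 (0 + k.factorial * c)) := hro.tendsto_div_nhds_zero.add_const _
  rw [zero_add] at hlim
  have hnn : 0 ≤ (k.factorial : ℝ) * c := by
    refine ge_of_tendsto hlim ?_
    have hev : ∀ᶠ t in 𝓝[>] (0 : ℝ), x + t * ((k : ℝ) * k) ∈ S :=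
      (htend _).eventually (hS.mem_nhds hx)
    filter_upwards [hev, self_mem_nhdsWithin] with t ht ht0
    have ht0' : (0 : ℝ) < t := ht0
    have h1 := hE k hk x t hx ht0' (by rwa [mul_assoc])
    rw [hV] at h1
    have h2 : 0 < t ^ k := pow_pos ht0' k
    have : hlV k r x t / t ^ k + k.factorial * c
        = (hlV k r x t + t ^ k * (k.factorial * c)) / t ^ k := by
      field_simp
    rw [this]
    positivity
  have : (0 : ℝ) < k.factorial := by positivity
  exact nonneg_of_mul_nonneg_right hnn this

open Topology Filter in
lemma hl_cont {S : Set ℝ} {f : ℝ → ℝ} (hS : IsOpen S) (hm : MonotoneOn f S)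
    (H : ∀ a t, 0 < t → a ∈ S → a + 4 * t ∈ S →
      2 * f (a + 2 * t) + f a ≤ 2 * f (a + t) + f (a + 4 * t)) : ContinuousOn f S := by
  intro c hcS
  apply ContinuousAt.continuousWithinAt
  obtain ⟨ε, hε, hb⟩ := Metric.isOpen_iff.1 hS c hcS
  rw [Real.ball_eq_Ioo] at hb
  have hl : Tendsto f (𝓝[<] c) (𝓝 (sSup (f '' Ioo (c - ε) c))) := by
    apply MonotoneOn.tendsto_nhdsWithin_Ioo_left (by simpa using hε)
    · exact hm.mono fun y hy => hb ⟨hy.1, by linarith [hy.2]⟩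
    · refine ⟨f c, ?_⟩
      rintro _ ⟨y, hy, rfl⟩
      exact hm (hb ⟨hy.1, by linarith [hy.2]⟩) hcS hy.2.le
  have hr : Tendsto f (𝓝[>] c) (𝓝 (sInf (f '' Ioo c (c + ε)))) := by
    apply MonotoneOn.tendsto_nhdsWithin_Ioo_right (by simpa using hε)
    · exact hm.mono fun y hy => hb ⟨by linarith [hy.1], hy.2⟩
    · refine ⟨f c, ?_⟩
      rintro _ ⟨y, hy, rfl⟩
      exact hm hcS (hb ⟨by linarith [hy.1], hy.2⟩) hy.1.le
  set l := sSup (f '' Ioo (c - ε) c)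
  set r := sInf (f '' Ioo c (c + ε))
  have hlc : l ≤ f c := by
    refine le_of_tendsto hl ?_
    filter_upwards [Ioo_mem_nhdsLT (show c - ε < c by linarith)] with y hy
    exact hm (hb ⟨hy.1, by linarith [hy.2]⟩) hcS hy.2.le
  have hrc : f c ≤ r := by
    refine ge_of_tendsto hr ?_
    filter_upwards [Ioo_mem_nhdsGT (show c < c + ε by linarith)] with y hy
    exact hm hcS (hb ⟨by linarith [hy.1], hy.2⟩) hy.1.le
  have hlin : ∀ p : ℝ, Tendsto (fun t : ℝ => c + t * p) (𝓝[>] 0) (𝓝 c) := by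
    intro p
    have : Tendsto (fun t : ℝ => c + t * p) (𝓝 0) (𝓝 (c + 0 * p)) :=
      (Continuous.tendsto (by fun_prop) 0)
    simp only [zero_mul, add_zero] at this
    exact this.mono_left nhdsWithin_le_nhds
  have hpos : ∀ p : ℝ, 0 < p → Tendsto (fun t : ℝ => f (c + t * p)) (𝓝[>] 0) (𝓝 r) := by
    intro p hp
    refine hr.comp (tendsto_nhdsWithin_iff.2 ⟨hlin p, ?_⟩)
    filter_upwards [self_mem_nhdsWithin] with t ht
    have : 0 < t * p := mul_pos ht hp
    simpa using this
  have hneg : ∀ p : ℝ, p < 0 → Tendsto (fun t : ℝ => f (c + t * p)) (𝓝[>] 0) (𝓝 l) := by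
    intro p hp
    refine hl.comp (tendsto_nhdsWithin_iff.2 ⟨hlin p, ?_⟩)
    filter_upwards [self_mem_nhdsWithin] with t ht
    have : t * p < 0 := mul_neg_of_pos_of_neg ht hp
    simpa using this
  have hfin : 2 * r + l ≤ 2 * l + r := by
    refine le_of_tendsto_of_tendsto
      (((hpos (1/2) (by norm_num)).const_mul 2).add (hneg (-3/2) (by norm_num)))
      (((hneg (-1/2) (by norm_num)).const_mul 2).add (hpos (5/2) (by norm_num))) ?_
    filter_upwards [(hlin (-3/2)).eventually (hS.mem_nhds hcS),
      (hlin (5/2)).eventually (hS.mem_nhds hcS), self_mem_nhdsWithin] with t h1 h2 h3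
    have := H (c + t * (-3/2)) t h3 h1 (by
      have e : c + t * (-3/2) + 4 * t = c + t * (5/2) := by ring
      rw [e]; exact h2)
    have e1 : c + t * (-3/2) + 4 * t = c + t * (5/2) := by ring
    have e2 : c + t * (-3/2) + 2 * t = c + t * (1/2) := by ring
    have e3 : c + t * (-3/2) + t = c + t * (-1/2) := by ring
    rwa [e1, e2, e3] at this
  have e1 : l = f c := by linarith
  have e2 : r = f c := by linarith
  rw [e1] at hl
  rw [e2] at hr
  exact continuousAt_iff_continuous_left'_right'.2 ⟨hl, hr⟩

lemma hl_ftc {S : Set ℝ} {g : ℝ → ℝ} (hS : IsOpen S) (hc : S.OrdConnected)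
    (hg : ContinuousOn g S) {a x : ℝ} (ha : a ∈ S) (hx : x ∈ S) :
    HasDerivAt (fun u => ∫ s in a..u, g s) (g x) x :=
  intervalIntegral.integral_hasDerivAt_right
    (hg.mono (hc.uIcc_subset ha hx)).intervalIntegrable
    (hg.stronglyMeasurableAtFilter hS x hx) (hg.continuousAt (hS.mem_nhds hx))

lemma hlD_nonneg {p : ℕ} {S : Set ℝ} {f : ℝ → ℝ} (h : hlD p S f) : ∀ x ∈ S, 0 ≤ f x := by
  cases p with
  | zero => exact h
  | succ p => exact h.1

lemma hlD_pred {p : ℕ} {S : Set ℝ} {f : ℝ → ℝ} (h : hlD (p + 1) S f) : hlD p S f := by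
  induction p generalizing S f with
  | zero => exact h.1
  | succ p ih => exact ⟨h.1, fun t ht => ih (h.2 t ht)⟩

lemma hlD_le {p q : ℕ} (hpq : q ≤ p) {S : Set ℝ} {f : ℝ → ℝ} (h : hlD p S f) : hlD q S f := by
  induction p, hpq using Nat.le_induction with
  | base => exact h
  | succ p _ ih => exact ih (hlD_pred h)

lemma hlD_congr {p : ℕ} {S : Set ℝ} {f g : ℝ → ℝ} (h : hlD p S f) (hfg : EqOn f g S) :
    hlD p S g := by
  induction p generalizing S f g with
  | zero => exact fun x hx => hfg hx ▸ h x hx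
  | succ p ih =>
    refine ⟨fun x hx => hfg hx ▸ h.1 x hx, fun t ht => ih (h.2 t ht) ?_⟩
    intro x hx
    simp only [hfg hx.1, hfg hx.2]

open Topology Filter in
lemma hlD_lim {p : ℕ} {S : Set ℝ} {g : ℝ → ℝ} {ι : Type*} {l : Filter ι} [l.NeBot]
    (T : ι → Set ℝ) (F : ι → ℝ → ℝ) (hD : ∀ᶠ e in l, hlD p (T e) (F e))
    (hT : ∀ x ∈ S, ∀ᶠ e in l, x ∈ T e)
    (hF : ∀ x ∈ S, Tendsto (fun e => F e x) l (𝓝 (g x))) : hlD p S g := by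
  induction p generalizing S g T F with
  | zero =>
    intro x hx
    refine ge_of_tendsto (hF x hx) ?_
    filter_upwards [hD, hT x hx] with e h1 h2 using h1 x h2
  | succ p ih =>
    refine ⟨?_, ?_⟩
    · intro x hx
      refine ge_of_tendsto (hF x hx) ?_
      filter_upwards [hD, hT x hx] with e h1 h2 using h1.1 x h2
    · intro t ht
      refine ih (fun e => T e ∩ {x | x + t ∈ T e}) (fun e x => F e (x + t) - F e x) ?_ ?_ ?_
      · filter_upwards [hD] with e h1 using h1.2 t ht
      · intro x hx
        filter_upwards [hT x hx.1, hT _ hx.2] with e h1 h2 using ⟨h1, h2⟩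
      · intro x hx
        exact (hF _ hx.2).sub (hF _ hx.1)

lemma hlD_const_mul {p : ℕ} {S : Set ℝ} {f : ℝ → ℝ} {c : ℝ} (hc : 0 ≤ c) (h : hlD p S f) :
    hlD p S (fun x => c * f x) := by
  induction p generalizing S f with
  | zero => exact fun x hx => mul_nonneg hc (h x hx)
  | succ p ih =>
    refine ⟨fun x hx => mul_nonneg hc (h.1 x hx), fun t ht => hlD_congr (ih (h.2 t ht)) ?_⟩
    intro x _
    simp only; ring

lemma hlD_mono {S : Set ℝ} {f : ℝ → ℝ} (h : hlD 1 S f) : MonotoneOn f S := by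
  intro x hx y hy hxy
  rcases hxy.eq_or_lt with rfl | hlt
  · exact le_rfl
  have := h.2 (y - x) (by linarith) x ⟨hx, by simpa using hy⟩
  simpa using this

lemma hlD_mid {S : Set ℝ} {f : ℝ → ℝ} (hc : S.OrdConnected) (h : hlD 2 S f) {x t : ℝ}
    (ht : 0 < t) (hx : x ∈ S) (hy : x + 2 * t ∈ S) :
    2 * f (x + t) ≤ f x + f (x + 2 * t) := by
  have h1 : x + t ∈ S := hc.out hx hy ⟨by linarith, by linarith⟩
  have e : x + t + t = x + 2 * t := by ring
  have := (h.2 t ht).2 t ht x ⟨⟨hx, h1⟩, h1, by simpa [e] using hy⟩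
  simp only [e] at this
  linarith

lemma hlD_cont {S : Set ℝ} {f : ℝ → ℝ} (hS : IsOpen S) (hc : S.OrdConnected) (h : hlD 2 S f) :
    ContinuousOn f S := by
  have hm := hlD_mono (hlD_pred h)
  refine hl_cont hS hm ?_
  intro a t ht ha hb
  have h1 : a + t ∈ S := hc.out ha hb ⟨by linarith, by linarith⟩
  have h3 : a + 3 * t ∈ S := hc.out ha hb ⟨by linarith, by linarith⟩
  have e2 : a + t + t = a + 2 * t := by ring
  have e3 : a + t + 2 * t = a + 3 * t := by ring
  have k1 := hlD_mid hc h ht h1 (by rwa [e3])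
  rw [e2, e3] at k1
  have k2 := hm h3 hb (by linarith)
  have k3 := hm ha h1 (by linarith)
  linarith

lemma hlD_convex {S : Set ℝ} {f : ℝ → ℝ} (hS : IsOpen S) (hc : S.OrdConnected) (h : hlD 2 S f) :
    ConvexOn ℝ S f := by
  have hcont := hlD_cont hS hc h
  refine LinearOrder.convexOn_of_lt hc.convex ?_
  intro x hx y hy hxy a b ha hb hab
  by_contra! hlt
  simp only [smul_eq_mul] at hlt
  set s := (f y - f x) / (y - x) with hs
  have hyx : 0 < y - x := by linarith
  have hsy : s * (y - x) = f y - f x := by rw [hs]; field_simp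
  set g : ℝ → ℝ := fun t => f t - (f x + s * (t - x)) with hg
  have hsub : Icc x y ⊆ S := hc.out hx hy
  have hgc : ContinuousOn g (Icc x y) := by
    apply ContinuousOn.sub (hcont.mono hsub); fun_prop
  obtain ⟨z, hz, hmax⟩ := isCompact_Icc.exists_isMaxOn (nonempty_Icc.2 hxy.le) hgc
  have hw : a * x + b * y ∈ Icc x y := by
    have ha' : a = 1 - b := by linarith
    have q1 := mul_pos hb hyx
    have q2 := mul_pos ha hyx
    rw [ha'] at q2 ⊢
    constructor <;> nlinarith
  have hgw : 0 < g (a * x + b * y) := by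
    have : f x + s * (a * x + b * y - x) = a * f x + b * f y := by
      have : a = 1 - b := by linarith
      subst this
      have : (1 - b) * x + b * y - x = b * (y - x) := by ring
      rw [this]; linear_combination b * hsy
    simp only [hg, this]; linarith
  have hM : 0 < g z := hgw.trans_le (hmax hw)
  have hclosed : IsCompact (Icc x y ∩ g ⁻¹' {g z}) :=
    isCompact_Icc.of_isClosed_subset (hgc.preimage_isClosed_of_isClosed isClosed_Icc
      isClosed_singleton) inter_subset_left
  obtain ⟨m, ⟨hm, hmz⟩, hleast⟩ := hclosed.exists_isLeast ⟨z, hz, rfl⟩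
  have hmz : g m = g z := hmz
  have hgx : g x = 0 := by simp [hg]
  have hgy : g y = 0 := by simp only [hg]; linarith
  have hmx : x < m := lt_of_le_of_ne hm.1 (by rintro rfl; linarith)
  have hmy : m < y := lt_of_le_of_ne hm.2 (by rintro rfl; linarith)
  set t := min (m - x) (y - m) with ht
  have ht0 : 0 < t := lt_min (by linarith) (by linarith)
  have ht1 : t ≤ m - x := min_le_left _ _
  have ht2 : t ≤ y - m := min_le_right _ _
  have i1 : m - t ∈ Icc x y := ⟨by linarith, by linarith⟩
  have i2 : m + t ∈ Icc x y := ⟨by linarith, by linarith⟩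
  have e1 : m - t + t = m := by ring
  have e2 : m - t + 2 * t = m + t := by ring
  have k := hlD_mid hc h ht0 (hsub i1) (by rw [e2]; exact hsub i2)
  rw [e1, e2] at k
  have g1 : g (m - t) ≤ g z := hmax i1
  have g2 : g (m + t) ≤ g z := hmax i2
  have g3 : g (m - t) ≠ g z := fun hh => by
    have := hleast ⟨i1, hh⟩
    linarith
  have g4 := lt_of_le_of_ne g1 g3
  have : 2 * g m ≤ g (m - t) + g (m + t) := by
    simp only [hg]; linarith
  linarith

open Topology Filter in
lemma hlD_reg {p : ℕ} {S : Set ℝ} {f : ℝ → ℝ} (hS : IsOpen S) (hc : S.OrdConnected)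
    (h : hlD (p + 2) S f) :
    ContDiffOn ℝ p f S ∧ ∀ k ≤ p, hlD (p + 2 - k) S (iteratedDerivWithin k f S) := by
  induction p generalizing f with
  | zero =>
    refine ⟨contDiffOn_zero.2 (hlD_cont hS hc h), ?_⟩
    intro k hk
    obtain rfl : k = 0 := by omega
    simpa using h
  | succ p ih =>
    have hconv := hlD_convex hS hc (hlD_le (show 2 ≤ p + 1 + 2 by omega) h)
    have hfc := hlD_cont hS hc (hlD_le (show 2 ≤ p + 1 + 2 by omega) h)
    set g : ℝ → ℝ := fun x => derivWithin f (Ioi x) x with hg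
    have hgd : ∀ x ∈ S, HasDerivWithinAt f (g x) (Ioi x) x := fun x hx =>
      hconv.hasDerivWithinAt_rightDeriv_of_mem_interior (by rwa [hS.interior_eq])
    have hgD : hlD (p + 2) S g := by
      refine hlD_lim (l := 𝓝[>] (0 : ℝ)) (fun e => S ∩ {x | x + e ∈ S})
        (fun e x => e⁻¹ * (f (x + e) - f x)) ?_ ?_ ?_
      · filter_upwards [self_mem_nhdsWithin] with e he
        exact hlD_const_mul (inv_nonneg.2 (le_of_lt he)) (h.2 e he)
      · intro x hx
        have : Tendsto (fun e : ℝ => x + e) (𝓝 0) (𝓝 (x + 0)) :=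
          Continuous.tendsto (by fun_prop) 0
        rw [add_zero] at this
        filter_upwards [(this.mono_left nhdsWithin_le_nhds).eventually (hS.mem_nhds hx)]
          with e he using ⟨hx, he⟩
      · intro x hx
        have h1 := (hasDerivWithinAt_iff_tendsto_slope' (by simp)).1 (hgd x hx)
        have h2 : Tendsto (fun e : ℝ => x + e) (𝓝[>] 0) (𝓝[>] x) := by
          refine tendsto_nhdsWithin_iff.2 ⟨?_, ?_⟩
          · have : Tendsto (fun e : ℝ => x + e) (𝓝 0) (𝓝 (x + 0)) :=
              Continuous.tendsto (by fun_prop) 0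
            rw [add_zero] at this
            exact this.mono_left nhdsWithin_le_nhds
          · filter_upwards [self_mem_nhdsWithin] with e he
            simpa using he
        have h3 := h1.comp h2
        simpa [Function.comp_def, slope] using h3
    have hgc := hlD_cont hS hc (hlD_le (show 2 ≤ p + 2 by omega) hgD)
    have hder : ∀ x ∈ S, HasDerivAt f (g x) x := by
      intro x hx
      have h1 := (hl_ftc hS hc hgc hx hx).const_add (f x)
      refine h1.congr_of_eventuallyEq ?_
      filter_upwards [hS.mem_nhds hx] with y hy
      have hsub : uIcc x y ⊆ S := hc.uIcc_subset hx hy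
      rw [intervalIntegral.integral_eq_sub_of_hasDeriv_right (hfc.mono hsub)
        (fun z hz => hgd z (hsub (Ioo_subset_Icc_self hz)))
        (hgc.mono hsub).intervalIntegrable]
      ring
    have hdw : EqOn g (derivWithin f S) S := fun x hx =>
      ((hder x hx).hasDerivWithinAt.derivWithin (hS.uniqueDiffOn x hx)).symm
    obtain ⟨r1, r2⟩ := ih (hlD_congr hgD hdw)
    refine ⟨?_, ?_⟩
    · have : ((p + 1 : ℕ) : WithTop ℕ∞) = (p : WithTop ℕ∞) + 1 := by push_cast; rfl
      rw [this, contDiffOn_succ_iff_derivWithin hS.uniqueDiffOn]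
      exact ⟨fun x hx => (hder x hx).differentiableAt.differentiableWithinAt, by simp, r1⟩
    · intro k hk
      cases k with
      | zero => simpa using h
      | succ k =>
        rw [iteratedDerivWithin_succ']
        have := r2 k (by omega)
        convert this using 1
        omega

lemma hlE_mono {N : ℕ} {S : Set ℝ} {f : ℝ → ℝ} (hN : 1 ≤ N) (hE : hlE N S f) :
    MonotoneOn f S := by
  intro x hx y hy hxy
  rcases hxy.eq_or_lt with rfl | hlt
  · exact le_rfl
  have := hE 1 hN x (y - x) hx (by linarith) (by simpa using hy)
  simp [hlV, hlW, Finset.sum_range_succ] at this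
  linarith

lemma hlE_cont {N : ℕ} {S : Set ℝ} {f : ℝ → ℝ} (hS : IsOpen S) (hc : S.OrdConnected)
    (hN : 2 ≤ N) (hE : hlE N S f) : ContinuousOn f S := by
  have hm := hlE_mono (by omega) hE
  refine hl_cont hS hm ?_
  intro a t ht ha hb
  have e4 : a + t * 2 * 2 = a + 4 * t := by ring
  have h1 : a + t ∈ S := hc.out ha hb ⟨by linarith, by linarith⟩
  have h2 : a + 2 * t ∈ S := hc.out ha hb ⟨by linarith, by linarith⟩
  have k := hE 2 hN a t ha ht (by push_cast; rwa [e4])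
  have k2 := hm h1 h2 (by linarith)
  simp [hlV, hlW, Finset.sum_range_succ, mul_comm t 2] at k
  have e5 : a + 2 * t * 2 = a + 4 * t := by ring
  rw [e5] at k
  linarith

lemma hlE_integral {N : ℕ} {S : Set ℝ} {f : ℝ → ℝ} (hc : S.OrdConnected)
    (hf : ContinuousOn f S) (hE : hlE N S f) {h : ℝ} (hh : 0 < h) :
    hlE N (S ∩ {x | x + h ∈ S}) (fun x => ∫ s in (0 : ℝ)..h, f (x + s)) := by
  intro k hk a t ha ht hb
  have hmem : ∀ i ∈ Finset.range (k + 1), ∀ j ∈ Finset.range (k + 1), ∀ s ∈ Icc 0 h,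
      a + t * i * j + s ∈ S := by
    intro i hi j hj s hs
    have hi' : (i : ℝ) ≤ k := by exact_mod_cast Nat.lt_succ_iff.1 (Finset.mem_range.1 hi)
    have hj' : (j : ℝ) ≤ k := by exact_mod_cast Nat.lt_succ_iff.1 (Finset.mem_range.1 hj)
    have h1 : t * i * j ≤ t * k * k := by gcongr
    have h0 : 0 ≤ t * i * j := by positivity
    exact hc.out ha.1 hb.2 ⟨by linarith [hs.1], by linarith [hs.2]⟩
  have hint : ∀ i ∈ Finset.range (k + 1), ∀ j ∈ Finset.range (k + 1),
      IntervalIntegrable (fun s => hlW k i * hlW k j * f (a + t * i * j + s))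
        MeasureTheory.volume 0 h := by
    intro i hi j hj
    apply ContinuousOn.intervalIntegrable
    rw [uIcc_of_le hh.le]
    refine continuousOn_const.mul (hf.comp (by fun_prop) (fun s hs => hmem i hi j hj s hs))
  have key : hlV k (fun x => ∫ s in (0 : ℝ)..h, f (x + s)) a t
      = ∫ s in (0 : ℝ)..h, hlV k f (a + s) t := by
    have e : ∀ s, hlV k f (a + s) t = ∑ i ∈ Finset.range (k + 1), ∑ j ∈ Finset.range (k + 1),
        hlW k i * hlW k j * f (a + t * i * j + s) := by
      intro s
      unfold hlV
      refine Finset.sum_congr rfl fun i _ => Finset.sum_congr rfl fun j _ => ?_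
      congr 2; ring
    simp only [e]
    rw [intervalIntegral.integral_finsetSum]
    · unfold hlV
      refine Finset.sum_congr rfl fun i hi => ?_
      rw [intervalIntegral.integral_finsetSum (fun j hj => hint i hi j hj)]
      refine Finset.sum_congr rfl fun j hj => ?_
      rw [intervalIntegral.integral_const_mul]
    · intro i hi
      apply ContinuousOn.intervalIntegrable
      rw [uIcc_of_le hh.le]
      refine continuousOn_finsetSum _ fun j hj => ?_
      exact continuousOn_const.mul (hf.comp (by fun_prop) (fun s hs => hmem i hi j hj s hs))
  rw [key]
  refine intervalIntegral.integral_nonneg hh.le ?_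
  intro s hs
  have m1 := hmem 0 (by simp) 0 (by simp) s hs
  have m2 := hmem k (by simp) k (by simp) s hs
  refine hE k hk (a + s) t (by simpa using m1) ht ?_
  have e : a + s + t * k * k = a + t * k * k + s := by ring
  rwa [e]

lemma hl_open {S : Set ℝ} (hS : IsOpen S) (h : ℝ) : IsOpen (S ∩ {x | x + h ∈ S}) :=
  hS.inter (hS.preimage (by fun_prop : Continuous fun x : ℝ => x + h))

lemma hl_ord {S : Set ℝ} (hc : S.OrdConnected) (h : ℝ) :
    (S ∩ {x | x + h ∈ S}).OrdConnected := by
  refine ⟨fun x hx y hy z hz => ⟨hc.out hx.1 hy.1 hz, hc.out hx.2 hy.2 ⟨?_, ?_⟩⟩⟩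
  · linarith [hz.1]
  · linarith [hz.2]

lemma hl_integral_deriv {S : Set ℝ} {f : ℝ → ℝ} (hS : IsOpen S) (hc : S.OrdConnected)
    (hf : ContinuousOn f S) {h : ℝ} {x : ℝ} (hx : x ∈ S ∩ {x | x + h ∈ S}) :
    HasDerivAt (fun x => ∫ s in (0 : ℝ)..h, f (x + s)) (f (x + h) - f x) x := by
  have h1 := hl_ftc hS hc hf hx.1 hx.1
  have h2 := (hl_ftc hS hc hf hx.1 hx.2).comp_add_const x h
  refine (h2.sub h1).congr_of_eventuallyEq ?_
  filter_upwards [(hl_open hS h).mem_nhds hx] with y hy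
  rw [intervalIntegral.integral_comp_add_left, add_zero]
  simp only [Pi.sub_apply]
  rw [intervalIntegral.integral_interval_sub_left]
  · exact (hf.mono (hc.uIcc_subset hx.1 hy.2)).intervalIntegrable
  · exact (hf.mono (hc.uIcc_subset hx.1 hy.1)).intervalIntegrable

lemma hlD_of_hlE {N k : ℕ} : ∀ {m : ℕ} {S : Set ℝ} {F : ℝ → ℝ}, IsOpen S → S.OrdConnected →
    hlE N S F → ContDiffOn ℝ m F S → k + m ≤ N → hlD k S (iteratedDeriv m F) := by
  induction k with
  | zero =>
    intro m S F hS hc hE hF hm x hx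
    exact hlE_deriv hS hc hE (by omega) hF hx
  | succ k ih =>
    intro m S F hS hc hE hF hm
    refine ⟨fun x hx => hlE_deriv hS hc hE (by omega) hF hx, fun h hh => ?_⟩
    have hSo := hl_open hS h
    have hd := fun x hx => hl_integral_deriv (h := h) (x := x) hS hc hF.continuousOn hx
    set G : ℝ → ℝ := fun x => ∫ s in (0 : ℝ)..h, F (x + s) with hG
    have hFs : ContDiffOn ℝ m (fun x => F (x + h)) (S ∩ {x | x + h ∈ S}) :=
      hF.comp (by fun_prop) (fun x hx => hx.2)
    have hFm : ContDiffOn ℝ m F (S ∩ {x | x + h ∈ S}) := hF.mono inter_subset_left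
    have hGc : ContDiffOn ℝ (m + 1 : ℕ) G (S ∩ {x | x + h ∈ S}) := by
      have : ((m + 1 : ℕ) : WithTop ℕ∞) = (m : WithTop ℕ∞) + 1 := by push_cast; rfl
      rw [this, contDiffOn_succ_iff_deriv_of_isOpen hSo]
      refine ⟨fun x hx => (hd x hx).differentiableAt.differentiableWithinAt, by simp, ?_⟩
      exact (hFs.sub hFm).congr fun x hx => (hd x hx).deriv
    have := ih hSo (hl_ord hc h) (hlE_integral hc hF.continuousOn hE hh) hGc (by omega)
    refine hlD_congr this ?_
    intro x hx
    rw [iteratedDeriv_succ']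
    have e : deriv G =ᶠ[nhds x] (fun x => F (x + h)) - F := by
      filter_upwards [hSo.mem_nhds hx] with y hy using (hd y hy).deriv
    rw [e.iteratedDeriv_eq, iteratedDeriv_sub (hFs.contDiffAt (hSo.mem_nhds hx))
      (hFm.contDiffAt (hSo.mem_nhds hx)), iteratedDeriv_comp_add_const]

/-- **Horn–Loewner-type necessary condition, fixed dimension.** Let `0 < R ≤ ∞`,
`I = (0,R)`, `n ≥ 3`, and suppose `f[a·1 + uuᵀ]` is positive semidefinite for every
`a ∈ [0,R)` and `u ∈ [0,√(R-a))ⁿ`.  Then `f ∈ C^{n-3}(I)` with all derivatives of order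
`≤ n-3` nonnegative on `I`, and `f^{(n-3)}` is convex and nondecreasing on `I`.  In
particular, if `f ∈ C^{n-1}(I)` then `f^{(k)} ≥ 0` on `I` for all `0 ≤ k ≤ n-1`. -/
theorem horn_loewner_necessary_condition
    (R : EReal) (hR : 0 < R) (I : Set ℝ)
    (hI : I = {x : ℝ | 0 < x ∧ (x : EReal) < R}) (f : ℝ → ℝ) (n : ℕ) (hn : 3 ≤ n)
    (hmap : ∀ a : ℝ, 0 ≤ a → (a : EReal) < R → ∀ u : Fin n → ℝ,
      (∀ i, 0 ≤ u i ∧ ((a + u i * u i : ℝ) : EReal) < R) →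
      (Matrix.of fun i j => f (a + u i * u j)).PosSemidef) :
    ContDiffOn ℝ (n - 3 : ℕ) f I ∧
    (∀ k ≤ n - 3, ∀ x ∈ I, 0 ≤ iteratedDerivWithin k f I x) ∧
    ConvexOn ℝ I (iteratedDerivWithin (n - 3) f I) ∧
    MonotoneOn (iteratedDerivWithin (n - 3) f I) I ∧
    (ContDiffOn ℝ (n - 1 : ℕ) f I →
      ∀ k ≤ n - 1, ∀ x ∈ I, 0 ≤ iteratedDerivWithin k f I x) := by
  have hE : hlE (n - 1) I f := hI ▸ hlE_of_map R f n (by omega) hmap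
  have hS : IsOpen I := by
    rw [hI]
    exact isOpen_Ioi.inter (isOpen_Iio.preimage continuous_coe_real_ereal)
  have hc : I.OrdConnected := by
    rw [hI]
    refine ⟨fun x hx y hy z hz => ⟨lt_of_lt_of_le hx.1 hz.1, lt_of_le_of_lt ?_ hy.2⟩⟩
    exact EReal.coe_le_coe_iff.2 hz.2
  have hcont := hlE_cont hS hc (by omega) hE
  have hD : hlD (n - 3 + 2) I f := by
    have := hlD_of_hlE (k := n - 1) (m := 0) hS hc hE (contDiffOn_zero.2 hcont) (by omega)
    rw [iteratedDeriv_zero] at this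
    convert this using 1
    omega
  obtain ⟨h1, h2⟩ := hlD_reg hS hc hD
  have h3 := h2 (n - 3) le_rfl
  rw [Nat.add_sub_cancel_left] at h3
  refine ⟨h1, fun k hk => hlD_nonneg (h2 k hk), hlD_convex hS hc h3, hlD_mono (hlD_pred h3), ?_⟩
  intro hf k hk x hx
  rw [iteratedDerivWithin_of_isOpen hS hx]
  exact hlE_deriv hS hc hE hk (hf.of_le (by exact_mod_cast hk)) hx
end
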